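/- Let d ≥ 2 and let B be a collision kernel satisfying the standing assumptions (1.1) and the Lipschitz assumption (1.2). Let p ∈ (2,∞), μ_0 ∈ 𝒮(p), and let (μ_t)_{t≥0} be the unique locally bounded measure solution in 𝒮(p) of the spatially homogeneous Boltzmann equation starting from μ_0. Let V_1, …, V_N be independent random variables with distribution μ_0 and let μ_0^N = μ̃^N be the associated rescaled empirical distribution; conditionally on μ_0^N, let (μ_t^N)_{t≥0} be a Kac process starting from μ_0^N. Then for all ε ∈ (0,1], all λ ≥ ∫|v|^p μ_0(dv) and all T ∈ [0,∞), there are constants α = α(d,p) > 0 and C = C(B,d,ε,λ,p,T) < ∞ such that, with probability exceeding 1 − ε, W(μ_t^N, μ_t) ≤ C N^{−α} for all t ≤ T. For p > 8 one can take α = 1/d when d ≥ 3, and when d = 2 the estimate holds with N^{−1/2} log N in place of N^{−α}. -/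

import Mathlib

open MeasureTheory ProbabilityTheory Filter
open scoped ENNReal NNReal RealInnerProductSpace

noncomputable section

abbrev Vd (d : ℕ) := EuclideanSpace ℝ (Fin d)

namespace KacModel

variable {d : ℕ}

/-- Post-collision velocity `v' = (v+v*)/2 + |v-v*|σ/2`. -/
def postV (v vs σ : Vd d) : Vd d := (2:ℝ)⁻¹ • (v + vs) + ((2:ℝ)⁻¹ * ‖v - vs‖) • σ

/-- Post-collision velocity `v'_* = (v+v*)/2 - |v-v*|σ/2`. -/
def postVs (v vs σ : Vd d) : Vd d := (2:ℝ)⁻¹ • (v + vs) - ((2:ℝ)⁻¹ * ‖v - vs‖) • σ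

/-- The unit sphere `S^{d-1}` regarded as a subset of `ℝ^d`. -/
def unitSphere (d : ℕ) : Set (Vd d) := {σ | ‖σ‖ = 1}

/-- Standing assumptions (1.1) on a collision kernel, regarded as a family of
measures on `ℝ^d` carried by the unit sphere. -/
structure IsCollisionKernel (B : Vd d → Measure (Vd d)) : Prop where
  measurable : ∀ s : Set (Vd d), MeasurableSet s → Measurable fun v => B v s
  prob : ∀ u : Vd d, ‖u‖ = 1 → IsProbabilityMeasure (B u)
  support : ∀ u : Vd d, ‖u‖ = 1 → B u ((unitSphere d \ {u, -u})ᶜ) = 0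
  scaling : ∀ (c : ℝ), 0 ≤ c → ∀ u : Vd d, ‖u‖ = 1 →
    B (c • u) = ENNReal.ofReal c • B u
  symm : ∀ (R : Vd d ≃ₗᵢ[ℝ] Vd d) (u : Vd d), ‖u‖ = 1 → B (R u) = (B u).map R

/-- Total variation distance between two finite measures (dual formulation). -/
def tvDist {E : Type*} [MeasurableSpace E] (μ ν : Measure E) : ℝ :=
  ⨆ f : {f : E → ℝ // Measurable f ∧ ∀ x, |f x| ≤ 1},
    ((∫ x, f.1 x ∂μ) - ∫ x, f.1 x ∂ν)

/-- The Lipschitz assumption (1.2). -/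
def IsLipschitzKernel (B : Vd d → Measure (Vd d)) (κ : ℝ) : Prop :=
  1 ≤ κ ∧ ∀ v v' : Vd d, tvDist (B v) (B v') ≤ κ * ‖v - v'‖

/-- The Boltzmann sphere 𝒮. -/
def boltzmannSphere (d : ℕ) : Set (Measure (Vd d)) :=
  {μ | IsProbabilityMeasure μ ∧ (∫ v, v ∂μ) = 0 ∧ (∫ v, ‖v‖ ^ 2 ∂μ) = 1}

/-- 𝒮_N : normalized empirical measures in the Boltzmann sphere. -/
def empiricalSphere (d N : ℕ) : Set (Measure (Vd d)) :=
  {μ | μ ∈ boltzmannSphere d ∧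
    ∃ x : Fin N → Vd d, μ = (N : ℝ≥0∞)⁻¹ • ∑ i, Measure.dirac (x i)}

/-- The class ℱ of test functions. -/
def testF (d : ℕ) : Set (Vd d → ℝ) :=
  {f | (∀ v, |f v / (1 + ‖v‖ ^ 2)| ≤ 1) ∧
    ∀ v v', |f v / (1 + ‖v‖ ^ 2) - f v' / (1 + ‖v'‖ ^ 2)| ≤ ‖v - v'‖}

/-- The weighted Wasserstein distance W. -/
def Wdist (μ ν : Measure (Vd d)) : ℝ :=
  ⨆ f : testF d, ((∫ v, (f : Vd d → ℝ) v ∂μ) - ∫ v, (f : Vd d → ℝ) v ∂ν)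

/-- The p-th moment `∫ |v|^p dμ`, as a lower integral. -/
def momentL (p : ℝ) (μ : Measure (Vd d)) : ℝ≥0∞ :=
  ∫⁻ v, (‖v‖₊ : ℝ≥0∞) ^ p ∂μ

/-- Total variation measure |μ - ν| of the difference of two finite measures. -/
def tvMeasure {E : Type*} [MeasurableSpace E] (μ ν : Measure E) : Measure E :=
  (μ - ν) + (ν - μ)

/-- The post-collision update `μ^{v,v_*,σ}` of an empirical measure. -/
def collUpdate (N : ℕ) (μ : Measure (Vd d)) (v vs σ : Vd d) : Measure (Vd d) :=
  μ + (N : ℝ≥0∞)⁻¹ • (Measure.dirac (postV v vs σ) + Measure.dirac (postVs v vs σ))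
    - (N : ℝ≥0∞)⁻¹ • (Measure.dirac v + Measure.dirac vs)

/-- The generator 𝒢 of the Kac process. -/
def kacGen (B : Vd d → Measure (Vd d)) (N : ℕ) (F : Measure (Vd d) → ℝ)
    (μ : Measure (Vd d)) : ℝ :=
  N * ∫ v, (∫ vs, (∫ σ, (F (collUpdate N μ v vs σ) - F μ) ∂(B (v - vs))) ∂μ) ∂μ

/-- A Kac process with collision kernel `B` and particle number `N`:
a càdlàg adapted 𝒮_N-valued process solving the martingale problem for 𝒢. -/
structure IsKacProcess {Ω : Type*} [m : MeasurableSpace Ω]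
    (B : Vd d → Measure (Vd d)) (N : ℕ) (P : Measure Ω)
    (𝓕 : Filtration ℝ m) (μp : ℝ → Ω → Measure (Vd d)) : Prop where
  mem : ∀ t ω, μp t ω ∈ empiricalSphere d N
  adapted : ∀ f ∈ testF d, StronglyAdapted 𝓕 fun t ω => ∫ v, f v ∂(μp t ω)
  rightCont : ∀ ω, ∀ f ∈ testF d, ∀ t : ℝ,
    ContinuousWithinAt (fun s => ∫ v, f v ∂(μp s ω)) (Set.Ici t) t
  leftLim : ∀ ω, ∀ f ∈ testF d, ∀ t : ℝ, 0 < t →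
    ∃ L : ℝ, Tendsto (fun s => ∫ v, f v ∂(μp s ω)) (nhdsWithin t (Set.Iio t)) (nhds L)
  martingale : ∀ G : Measure (Vd d) → ℝ, Measurable G → (∃ M : ℝ, ∀ ν, |G ν| ≤ M) →
    Martingale (fun t ω => G (μp t ω) - ∫ s in Set.Ioc (0:ℝ) t, kacGen B N G (μp s ω)) 𝓕 P

/-- `⟨f, Q(μ,ν)⟩`, the Boltzmann collision integral. -/
def QInt (B : Vd d → Measure (Vd d)) (f : Vd d → ℝ) (μ ν : Measure (Vd d)) : ℝ :=
  ∫ v, (∫ vs, (∫ σ, (f (postV v vs σ) + f (postVs v vs σ) - f v - f vs) ∂(B (v - vs))) ∂ν) ∂μ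

/-- Measure solution of the spatially homogeneous Boltzmann equation, started at time τ. -/
def IsBoltzmannSolutionFrom (B : Vd d → Measure (Vd d)) (τ : ℝ)
    (μt : ℝ → Measure (Vd d)) : Prop :=
  (∀ t, τ ≤ t → μt t ∈ boltzmannSphere d) ∧
  ∀ f : Vd d → ℝ, Measurable f → (∃ M, ∀ v, |f v| ≤ M) → HasCompactSupport f →
    ∀ t, τ ≤ t →
      (∫ v, f v ∂(μt t)) = (∫ v, f v ∂(μt τ)) + ∫ s in Set.Ioc τ t, QInt B f (μt s) (μt s)

/-- Measure solution of the spatially homogeneous Boltzmann equation (start time 0). -/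
def IsBoltzmannSolution (B : Vd d → Measure (Vd d)) (μt : ℝ → Measure (Vd d)) : Prop :=
  IsBoltzmannSolutionFrom B 0 μt

/-- Local boundedness in 𝒮(p) from time τ on. -/
def LocBddMomentFrom (p τ : ℝ) (μt : ℝ → Measure (Vd d)) : Prop :=
  ∀ T, τ ≤ T → ∃ M : ℝ≥0∞, M ≠ ⊤ ∧ ∀ t ∈ Set.Icc τ T, momentL p (μt t) ≤ M

/-- Sample mean. -/
def sampleMean {Ω : Type*} {N : ℕ} (Vs : Fin N → Ω → Vd d) (ω : Ω) : Vd d :=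
  (N : ℝ)⁻¹ • ∑ i, Vs i ω

/-- Sample mean square. -/
def sampleQ {Ω : Type*} {N : ℕ} (Vs : Fin N → Ω → Vd d) (ω : Ω) : ℝ :=
  (N : ℝ)⁻¹ * ∑ i, ‖Vs i ω‖ ^ 2

/-- Sample variance. -/
def sampleS {Ω : Type*} {N : ℕ} (Vs : Fin N → Ω → Vd d) (ω : Ω) : ℝ :=
  sampleQ Vs ω - ‖sampleMean Vs ω‖ ^ 2

/-- The rescaled empirical distribution μ̃^N. -/
def rescaledEmpirical {Ω : Type*} {N : ℕ} (Vs : Fin N → Ω → Vd d)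
    (μdef : Measure (Vd d)) (ω : Ω) : Measure (Vd d) :=
  if 0 < sampleS Vs ω then
    (N : ℝ≥0∞)⁻¹ • ∑ i, Measure.dirac
      ((Real.sqrt (sampleS Vs ω))⁻¹ • (Vs i ω - sampleMean Vs ω))
  else μdef

/-- The N-sample empirical distribution. -/
def empMeasure {Ω : Type*} {N : ℕ} (Vs : Fin N → Ω → Vd d) (ω : Ω) : Measure (Vd d) :=
  (N : ℝ≥0∞)⁻¹ • ∑ i, Measure.dirac (Vs i ω)

end KacModel

open KacModel


namespace KacPf
open Set (Ioc Icc Ici Ioc_subset_Ioc_right Ioc_union_Ioc_eq_Ioc indicator_of_mem indicator_of_notMem)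
open ENNReal (ofReal ofReal_le_ofReal toReal_ofReal ofReal_ne_top)
open Finset (range sum_le_sum mul_sum measurable_fun_sum mem_range sum_nonneg abs_sum_le_sum_abs sum_add_distrib)
open Real (rpow_le_rpow norm_eq_abs exp log mul_rpow rpow_natCast le_sqrt_of_sq_le rpow_add_one rpow_add rpow_one rpow_two rpow_mul rpow_neg norm_of_nonneg rpow_le_rpow_of_exponent_ge sqrt_mul)
open MeasureTheory.Measure (dirac)
variable {d : ℕ} {c κ p R T b r t D0 ε lam c' : ℝ} {f g F W : Vd d → ℝ} {ν τ : Measure (Vd d)} {B : Vd d → Measure (Vd d)} {K : Kernel (Vd d) (Vd d)} {N j k : ℕ} {v u : Vd d}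
local notation "Ed" => Vd d
local notation "Fn" => Vd d → ℝ
local notation "Ms" => Measure (Vd d)
local notation "tw" => (2:ℝ)
local notation "pz" => by positivity
local notation "nz" => by norm_num
local notation "lz" => by linarith
local notation "mz" => by fun_prop
local notation "Mo" q:max x:max => ∫ v, ‖v‖ ^ q ∂x
section
structure GoodK (B : Ed → Ms) (κ : ℝ) (K : Kernel (Ed) (Ed)) : Prop where
  one_le : 1 ≤ κ
  markov : IsMarkovKernel K
  eqB : ∀ v, B v = ofReal ‖v‖ • K v
  sph : ∀ v, ∀ᵐ σ ∂(K v), ‖σ‖ = 1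
  tv : ∀ v w (f : Fn), Measurable f → (∀ x, |f x| ≤ 1) →
    ‖v‖ * (∫ x, f x ∂(K v)) - ‖w‖ * ∫ x, f x ∂(K w) ≤ κ * ‖v - w‖
  neg : ∀ v, v ≠ 0 → K (-v) = (K v).map (fun x => -x)
  pov : ∀ p : ℝ, 2 < p → ∃ η δ : ℝ, 0 < η ∧ η ≤ 1/4 ∧ 0 < δ ∧ ∀ v, v ≠ 0 →
    ∫ σ, ((‖‖v‖⁻¹ • v + σ‖ / 2 + 2 * η) ^ p + (‖‖v‖⁻¹ • v - σ‖ / 2 + 2 * η) ^ p) ∂(K v) ≤ 1 - δ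
lemma exists_unit (hd : 2 ≤ d) : ∃ e : Ed, ‖e‖ = 1 :=
  ⟨EuclideanSpace.single (⟨0, by omega⟩ : Fin d) (1:ℝ), by simp⟩
lemma norm_unit (hv : v ≠ 0) : ‖‖v‖⁻¹ • v‖ = 1 := by
  rw [norm_smul, norm_inv, norm_norm, inv_mul_cancel₀ (norm_ne_zero_iff.2 hv)]
def Bn (B : Ed → Ms) (e : Ed) (v : Ed) : Ms :=
  B (if v = 0 then e else ‖v‖⁻¹ • v)
lemma meas_nrm (e : Ed) : Measurable (fun v : Ed => if v = 0 then e else ‖v‖⁻¹ • v) := by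
  refine Measurable.ite (measurableSet_singleton 0) measurable_const mz
lemma norm_nrm {e : Ed} (he : ‖e‖ = 1) (v : Ed) :
    ‖(if v = 0 then e else ‖v‖⁻¹ • v)‖ = 1 := by
  split_ifs with h
  · exact he
  · exact norm_unit h
lemma pov_aux {μ : Ms} [IsProbabilityMeasure μ] (hu : ‖u‖ = 1)
    (hs : μ ((unitSphere d \ {u, -u})ᶜ) = 0) (p : ℝ) (hp : 2 < p) :
    ∃ η δ : ℝ, 0 < η ∧ η ≤ 1/4 ∧ 0 < δ ∧
    ∫ σ, ((‖u + σ‖ / 2 + 2 * η) ^ p + (‖u - σ‖ / 2 + 2 * η) ^ p) ∂μ ≤ 1 - δ := by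
  have hae : ∀ᵐ σ ∂μ, σ ∈ unitSphere d \ {u, -u} := by
    rw [ae_iff]; exact hs
  set F : ℝ → Ed → ℝ := fun η σ => (‖u + σ‖ / 2 + 2 * η) ^ p + (‖u - σ‖ / 2 + 2 * η) ^ p with hF
  have hcs : ∀ σ : Ed, ‖σ‖ = 1 → (‖u + σ‖/2)^2 + (‖u - σ‖/2)^2 = 1 := by
    intro σ hσ
    have := parallelogram_law_with_norm ℝ u σ
    rw [hu, hσ] at this
    nlinarith
  have hle : ∀ σ : Ed, ‖σ‖ = 1 → ‖u + σ‖/2 ≤ 1 ∧ ‖u - σ‖/2 ≤ 1 := by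
    intro σ hσ
    have h1 := norm_add_le u σ
    have h2 := norm_sub_le u σ
    rw [hu, hσ] at h1 h2
    constructor <;> linarith
  have hp0 : 0 ≤ p := lz
  have hFc : ∀ η, Continuous (F η) := by
    intro η
    have h1 : Continuous fun σ : Ed => (‖u + σ‖ / 2 + 2 * η) := mz
    have h2 : Continuous fun σ : Ed => (‖u - σ‖ / 2 + 2 * η) := mz
    exact (h1.rpow_const (fun _ => Or.inr hp0)).add (h2.rpow_const (fun _ => Or.inr hp0))
  have hint0 : Integrable (F 0) μ := by
    refine Integrable.of_bound (C := 2) (hFc 0).aestronglyMeasurable ?_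
    filter_upwards [hae] with σ hσ
    have h := hle σ hσ.1
    simp only [hF, mul_zero, add_zero]
    rw [norm_of_nonneg pz]
    have h1 := Real.rpow_le_one pz h.1 hp0
    have h2 := Real.rpow_le_one pz h.2 hp0
    linarith
  have hlt : ∫ σ, F 0 σ ∂μ < 1 := by
    have hpos : ∀ᵐ σ ∂μ, 0 < 1 - F 0 σ := by
      filter_upwards [hae] with σ hσ
      have h := hle σ hσ.1
      have h0 := hcs σ hσ.1
      have hn : u + σ ≠ 0 := fun h => hσ.2 (by right; simp [eq_neg_of_add_eq_zero_right h])
      have hn' : u - σ ≠ 0 := fun h => hσ.2 (by left; exact (sub_eq_zero.1 h).symm)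
      have a1 : 0 < ‖u + σ‖/2 := pz
      have a2 : 0 < ‖u - σ‖/2 := pz
      have b1 : ‖u + σ‖/2 < 1 := by nlinarith
      have b2 : ‖u - σ‖/2 < 1 := by nlinarith
      have e1 := Real.rpow_lt_rpow_of_exponent_gt a1 b1 hp
      have e2 := Real.rpow_lt_rpow_of_exponent_gt a2 b2 hp
      simp only [hF, mul_zero, add_zero]
      norm_cast at e1 e2
      rw [← rpow_natCast, ← rpow_natCast] at h0
      norm_cast at h0
      norm_cast at *
      linarith
    have : 0 < ∫ σ, (1 - F 0 σ) ∂μ := by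
      rw [integral_pos_iff_support_of_nonneg_ae (hpos.mono fun σ h => h.le) ((integrable_const _).sub hint0)]
      have : Function.support (fun σ => 1 - F 0 σ) =ᵐ[μ] Set.univ := by
        filter_upwards [hpos] with σ h
        exact propext ⟨fun _ => trivial, fun _ => h.ne'⟩
      rw [measure_congr this]; simp
    rw [integral_sub (integrable_const _) hint0] at this
    simp at this; linarith
  have hlim : Tendsto (fun n : ℕ => ∫ σ, F (1/((n:ℝ)+4)) σ ∂μ) atTop (nhds (∫ σ, F 0 σ ∂μ)) := by
    refine tendsto_integral_of_dominated_convergence (fun _ => 2 * tw^p)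
      (fun n => (hFc _).aestronglyMeasurable) (integrable_const _) ?_ ?_
    · intro n
      filter_upwards [hae] with σ hσ
      have h := hle σ hσ.1
      have hn : (1/((n:ℝ)+4)) ≤ 1/4 := by
        exact one_div_le_one_div_of_le nz (by linarith [Nat.cast_nonneg (α := ℝ) n])
      simp only [hF]
      rw [norm_of_nonneg pz]
      have h1 := rpow_le_rpow (z := p) pz (show ‖u + σ‖ / 2 + 2 * (1/((n:ℝ)+4)) ≤ 2 by linarith) hp0
      have h2 := rpow_le_rpow (z := p) pz (show ‖u - σ‖ / 2 + 2 * (1/((n:ℝ)+4)) ≤ 2 by linarith) hp0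
      linarith
    · refine Eventually.of_forall fun σ => ?_
      have h0 : Tendsto (fun n : ℕ => 1/((n:ℝ)+4)) atTop (nhds 0) := by
        have := (tendsto_const_nhds (x := (1:ℝ))).div_atTop (tendsto_atTop_add_const_right atTop (4:ℝ) (tendsto_natCast_atTop_atTop (R := ℝ)))
        simpa using this
      have hc : Continuous fun η : ℝ => F η σ := by
        have h1 : Continuous fun η : ℝ => (‖u + σ‖ / 2 + 2 * η) := mz
        have h2 : Continuous fun η : ℝ => (‖u - σ‖ / 2 + 2 * η) := mz
        exact (h1.rpow_const (fun _ => Or.inr hp0)).add (h2.rpow_const (fun _ => Or.inr hp0))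
      exact (hc.tendsto 0).comp h0
  obtain ⟨δ, hδ, hδ'⟩ : ∃ δ, 0 < δ ∧ ∫ σ, F 0 σ ∂μ < 1 - δ :=
    ⟨(1 - ∫ σ, F 0 σ ∂μ)/2, lz, lz⟩
  obtain ⟨n, hn⟩ := (hlim.eventually (gt_mem_nhds hδ')).exists
  refine ⟨1/((n:ℝ)+4), δ, pz, ?_, hδ, hn.le⟩
  exact one_div_le_one_div_of_le nz (by linarith [Nat.cast_nonneg (α := ℝ) n])
theorem exists_goodK (hd : 2 ≤ d) (B : Ed → Ms) (κ : ℝ)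
    (hB : IsCollisionKernel B) (hBL : IsLipschitzKernel B κ) :
    ∃ K : Kernel (Ed) (Ed), GoodK B κ K := by
  obtain ⟨e, he⟩ := exists_unit hd
  have hmeas : Measurable (Bn B e) := by
    refine Measure.measurable_of_measurable_coe _ fun s hs => ?_
    exact (hB.measurable s hs).comp (meas_nrm e)
  let K : Kernel (Ed) (Ed) := ⟨Bn B e, hmeas⟩
  have hK : ∀ v, K v = B (if v = 0 then e else ‖v‖⁻¹ • v) := fun v => rfl
  have hM : IsMarkovKernel K := ⟨fun v => by rw [hK]; exact hB.prob _ (norm_nrm he v)⟩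
  have heq : ∀ v, B v = ofReal ‖v‖ • K v := by
    intro v
    rw [hK, ← hB.scaling _ (norm_nonneg v) _ (norm_nrm he v)]
    split_ifs with h
    · simp [h]
    · rw [smul_smul, mul_inv_cancel₀ (norm_ne_zero_iff.2 h), one_smul]
  have hint : ∀ v (f : Fn), ∫ x, f x ∂(B v) = ‖v‖ * ∫ x, f x ∂(K v) := by
    intro v f
    rw [heq, integral_smul_measure, toReal_ofReal (norm_nonneg v), smul_eq_mul]
  have hb : ∀ v (f : Fn), (∀ x, |f x| ≤ 1) → |∫ x, f x ∂(K v)| ≤ 1 := by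
    intro v f hf
    have := norm_integral_le_of_norm_le_const (μ := K v) (C := 1) (f := f) (Eventually.of_forall hf)
    simpa using this
  have hrot : ∀ v, v ≠ 0 → ∃ R : Ed ≃ₗᵢ[ℝ] Ed, R e = ‖v‖⁻¹ • v ∧ K v = (B e).map R := by
    intro v hv
    refine ⟨((ℝ ∙ (e - ‖v‖⁻¹ • v))ᗮ).reflection, ?_, ?_⟩
    · exact Submodule.reflection_sub (by rw [he, norm_unit hv])
    · rw [← hB.symm _ _ he, Submodule.reflection_sub (by rw [he, norm_unit hv]), hK, if_neg hv]
  refine ⟨K, hBL.1, hM, heq, ?_, ?_, ?_, ?_⟩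
  · intro v
    have := hB.support _ (norm_nrm he v)
    rw [ae_iff, hK]
    refine measure_mono_null ?_ this
    intro σ hσ h
    exact hσ h.1
  · intro v w f hf hf1
    rw [← hint, ← hint]
    refine le_trans ?_ (hBL.2 v w)
    unfold tvDist
    refine le_ciSup (f := fun f : {f : Ed → ℝ // Measurable f ∧ ∀ x, |f x| ≤ 1} => (∫ x, f.1 x ∂(B v)) - ∫ x, f.1 x ∂(B w)) ?_ ⟨f, hf, hf1⟩
    refine ⟨‖v‖ + ‖w‖, ?_⟩
    rintro _ ⟨g, rfl⟩
    simp only [hint]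
    have h1 := abs_le.1 (hb v g.1 g.2.2)
    have h2 := abs_le.1 (hb w g.1 g.2.2)
    have := norm_nonneg v
    have := norm_nonneg w
    nlinarith
  · intro v hv
    have h := hB.symm (LinearIsometryEquiv.neg ℝ) (‖v‖⁻¹ • v) (norm_unit hv)
    rw [hK, hK, if_neg hv, if_neg (neg_ne_zero.2 hv), norm_neg, smul_neg]
    exact h
  · intro p hp
    have := hB.prob e he
    obtain ⟨η, δ, h1, h2, h3, h4⟩ := pov_aux (μ := B e) he (hB.support e he) p hp
    refine ⟨η, δ, h1, h2, h3, fun v hv => ?_⟩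
    obtain ⟨R, hR, hR'⟩ := hrot v hv
    have hp0 : 0 ≤ p := lz
    rw [hR', ← hR, integral_map R.continuous.measurable.aemeasurable]
    · simp only [← map_add, ← map_sub, LinearIsometryEquiv.norm_map]
      exact h4
    · have h1 : Continuous fun σ : Ed => (‖R e + σ‖ / 2 + 2 * η) := mz
      have h2 : Continuous fun σ : Ed => (‖R e - σ‖ / 2 + 2 * η) := mz
      exact ((h1.rpow_const (fun _ => Or.inr hp0)).add (h2.rpow_const (fun _ => Or.inr hp0))).aestronglyMeasurable
end
section
def Df (f : Fn) (v vs σ : Ed) : ℝ := f (postV v vs σ) + f (postVs v vs σ) - f v - f vs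
def KK (K : Kernel (Ed) (Ed)) (f : Fn) (v vs : Ed) : ℝ :=
  ‖v - vs‖ * ∫ σ, Df f v vs σ ∂(K (v - vs))
structure S2 (μ : Ms) : Prop where
  prob : IsProbabilityMeasure μ
  int : Integrable (fun v => ‖v‖ ^ 2) μ
  one : Mo 2 μ = 1
lemma S2_of_mem {μ : Ms} (h : μ ∈ boltzmannSphere d) : S2 μ := by
  refine ⟨h.1, ?_, h.2.2⟩
  by_contra hc
  have := integral_undef hc
  rw [h.2.2] at this
  exact one_ne_zero this
lemma S2.int1 {μ : Ms} (h : S2 μ) : Integrable (fun v => ‖v‖) μ := by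
  have := h.prob
  refine Integrable.mono' ((integrable_const 1).add h.int) mz (Eventually.of_forall fun v => ?_)
  simp only [norm_norm, Pi.add_apply]
  nlinarith [sq_nonneg (‖v‖ - 1), norm_nonneg v]
lemma S2.m1 {μ : Ms} (h : S2 μ) : ∫ v, ‖v‖ ∂μ ≤ 1 := by
  have := h.prob
  have h1 : ∫ v, ‖v‖ ∂μ ≤ ∫ v, (1/2 + 1/2 * ‖v‖^2) ∂μ := by
    refine integral_mono h.int1 ((integrable_const _).add (h.int.const_mul _)) fun v => ?_
    simp only
    nlinarith [sq_nonneg (‖v‖ - 1), norm_nonneg v]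
  rw [integral_add (integrable_const _) (h.int.const_mul _), integral_const_mul, h.one] at h1
  simp at h1
  linarith
lemma energy (v vs σ : Ed) (hσ : ‖σ‖ = 1) :
    ‖postV v vs σ‖ ^ 2 + ‖postVs v vs σ‖ ^ 2 = ‖v‖ ^ 2 + ‖vs‖ ^ 2 := by
  unfold postV postVs
  set a := tw⁻¹ • (v + vs)
  set b := (tw⁻¹ * ‖v - vs‖) • σ with hb
  have h1 := parallelogram_law_with_norm ℝ a b
  have h2 := parallelogram_law_with_norm ℝ v vs
  have h3 : ‖a‖ = 2⁻¹ * ‖v + vs‖ := by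
    rw [show a = tw⁻¹ • (v+vs) from rfl, norm_smul]; norm_num
  have h4 : ‖b‖ = 2⁻¹ * ‖v - vs‖ := by simp [hb, norm_smul, hσ]
  rw [h3, h4] at h1
  nlinarith
lemma meas_postV : Measurable (fun x : (Ed × Ed) × Ed => postV x.1.1 x.1.2 x.2) := by
  unfold postV; fun_prop
lemma meas_postVs : Measurable (fun x : (Ed × Ed) × Ed => postVs x.1.1 x.1.2 x.2) := by
  unfold postVs; fun_prop
lemma meas_Df (hf : Measurable f) :
    Measurable (fun x : (Ed × Ed) × Ed => Df f x.1.1 x.1.2 x.2) := by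
  unfold Df
  exact (((hf.comp meas_postV).add (hf.comp meas_postVs)).sub (hf.comp (measurable_fst.comp measurable_fst))).sub
    (hf.comp (measurable_snd.comp measurable_fst))
lemma meas_Df' (hf : Measurable f) (v vs : Ed) :
    Measurable (fun σ => Df f v vs σ) :=
  (meas_Df hf).comp (g := fun x : (Ed × Ed) × Ed => Df f x.1.1 x.1.2 x.2)
    (f := fun σ => ((v, vs), σ)) measurable_prodMk_left
lemma meas_intK (K : Kernel (Ed) (Ed)) [IsMarkovKernel K] {F : (Ed × Ed) × Ed → ℝ}
    (hF : Measurable F) : Measurable (fun x : Ed × Ed => ∫ σ, F (x, σ) ∂(K (x.1 - x.2))) := by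
  have hm : Measurable (fun x : Ed × Ed => x.1 - x.2) := measurable_fst.sub measurable_snd
  have := StronglyMeasurable.integral_kernel_prod_right' (κ := K.comap _ hm) hF.stronglyMeasurable
  simpa [Kernel.comap_apply] using this.measurable
lemma meas_KK (K : Kernel (Ed) (Ed)) [IsMarkovKernel K] (hf : Measurable f) :
    Measurable (fun x : Ed × Ed => KK K f x.1 x.2) := by
  unfold KK
  exact (mz : Measurable fun x : Ed × Ed => ‖x.1 - x.2‖).mul (meas_intK K (meas_Df hf))
lemma QInt_eq (hK : GoodK B κ K)
    (f : Fn) (μ ν : Ms) :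
    QInt B f μ ν = ∫ v, ∫ vs, KK K f v vs ∂ν ∂μ := by
  unfold QInt KK Df
  simp only [hK.eqB, integral_smul_measure, toReal_ofReal (norm_nonneg _), smul_eq_mul]
lemma meas_QQ {X : Type*} [MeasurableSpace X] (κ : Kernel X (Ed)) [IsSFiniteKernel κ]
    {F : Ed × Ed → ℝ} (hF : Measurable F) :
    Measurable (fun x => ∫ v, ∫ vs, F (v, vs) ∂(κ x) ∂(κ x)) := by
  have h1 : StronglyMeasurable (fun y : X × Ed => ∫ vs, F (y.2, vs) ∂(κ y.1)) := by
    have := StronglyMeasurable.integral_kernel_prod_right' (κ := κ.comap (Prod.fst : X × Ed → X) measurable_fst)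
      (f := fun z : (X × Ed) × Ed => F (z.1.2, z.2)) (by
        exact (hF.comp mz).stronglyMeasurable)
    simpa [Kernel.comap_apply] using this
  have := StronglyMeasurable.integral_kernel_prod_right' (κ := κ) h1
  exact this.measurable
lemma meas_QInt (hK : GoodK B κ K)
    {X : Type*} [MeasurableSpace X] (k : Kernel X (Ed)) [IsSFiniteKernel k]
    (hf : Measurable f) : Measurable (fun x => QInt B f (k x) (k x)) := by
  have := hK.markov
  simp only [QInt_eq hK]
  exact meas_QQ k (meas_KK K hf)
lemma postV_swap (v vs σ : Ed) : postV vs v (-σ) = postVs v vs σ := by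
  unfold postV postVs; rw [norm_sub_rev, smul_neg, add_comm vs v]; abel
lemma postVs_swap (v vs σ : Ed) : postVs vs v (-σ) = postV v vs σ := by
  unfold postV postVs; rw [norm_sub_rev, smul_neg, add_comm vs v]; abel
lemma KK_symm (hK : GoodK B κ K)
    (hf : Measurable f) (v vs : Ed) : KK K f v vs = KK K f vs v := by
  unfold KK
  by_cases h : v = vs
  · simp [h]
  rw [norm_sub_rev]
  congr 1
  have h2 : vs - v = -(v - vs) := by abel
  have hm : Measurable (fun σ => Df f vs v σ) := meas_Df' hf vs v
  rw [h2, hK.neg _ (sub_ne_zero.2 h), integral_map mz hm.aestronglyMeasurable]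
  congr 1
  ext σ
  simp only [Df, postV_swap, postVs_swap]
  ring
lemma Df_bd (hc : ∀ v, |f v| ≤ c) (v vs σ : Ed) : |Df f v vs σ| ≤ 4 * c := by
  unfold Df
  have h1 := abs_le.1 (hc (postV v vs σ))
  have h2 := abs_le.1 (hc (postVs v vs σ))
  have h3 := abs_le.1 (hc v)
  have h4 := abs_le.1 (hc vs)
  rw [abs_le]; constructor <;> linarith
lemma abs_int_le {μ : Ms} [IsProbabilityMeasure μ] (hc : ∀ᵐ v ∂μ, |f v| ≤ c) : |∫ v, f v ∂μ| ≤ c := by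
  have := norm_integral_le_of_norm_le_const (μ := μ) (f := f) hc
  simpa using this
lemma KK_bd [IsMarkovKernel K] (hc : ∀ v, |f v| ≤ c) (v vs : Ed) : |KK K f v vs| ≤ 4 * c * ‖v - vs‖ := by
  unfold KK
  rw [abs_mul, abs_norm, mul_comm]
  exact mul_le_mul_of_nonneg_right (abs_int_le (Eventually.of_forall fun σ => Df_bd hc v vs σ)) (norm_nonneg _)
lemma int_prod_of_bd {μ : Ms} [IsFiniteMeasure μ] [IsFiniteMeasure ν]
    {F : Ed × Ed → ℝ} (hF : Measurable F) {a b : Fn} (ha : Integrable a μ) (hb : Integrable b ν)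
    (h : ∀ v vs, |F (v, vs)| ≤ a v + b vs) : Integrable F (μ.prod ν) := by
  refine Integrable.mono' ((ha.comp_fst ν).add (hb.comp_snd μ)) hF.aestronglyMeasurable ?_
  exact Eventually.of_forall fun x => h x.1 x.2
lemma KK_int [IsMarkovKernel K] (hf : Measurable f) (hc : ∀ v, |f v| ≤ c) {μ : Ms} (hμ : S2 μ) (hν : S2 ν) :
    Integrable (fun x : Ed × Ed => KK K f x.1 x.2) (μ.prod ν) := by
  have := hμ.prob
  have := hν.prob
  refine int_prod_of_bd (meas_KK K hf) (hμ.int1.const_mul (4*c)) (hν.int1.const_mul (4*c)) fun v vs => ?_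
  have hc0 : 0 ≤ c := (abs_nonneg _).trans (hc 0)
  calc _ ≤ 4 * c * ‖v - vs‖ := KK_bd hc v vs
    _ ≤ 4 * c * (‖v‖ + ‖vs‖) := by gcongr; exact norm_sub_le _ _
    _ = _ := by ring
lemma QInt_prod (hK : GoodK B κ K)
    (hf : Measurable f) (hc : ∀ v, |f v| ≤ c) {μ : Ms} (hμ : S2 μ) (hν : S2 ν) :
    QInt B f μ ν = ∫ x, KK K f x.1 x.2 ∂(μ.prod ν) := by
  have := hμ.prob
  have := hν.prob
  have := hK.markov
  rw [QInt_eq hK, integral_prod _ (KK_int hf hc hμ hν)]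
lemma QInt_bd (hK : GoodK B κ K)
    (hf : Measurable f) (hc : ∀ v, |f v| ≤ c) {μ : Ms} (hμ : S2 μ) (hν : S2 ν) :
    |QInt B f μ ν| ≤ 8 * c := by
  have := hμ.prob
  have := hν.prob
  have := hK.markov
  have hc0 : 0 ≤ c := (abs_nonneg _).trans (hc 0)
  rw [QInt_prod hK hf hc hμ hν, ← norm_eq_abs]
  have hi : Integrable (fun x : Ed × Ed => 4 * c * (‖x.1‖ + ‖x.2‖)) (μ.prod ν) :=
    ((hμ.int1.comp_fst ν).add (hν.int1.comp_snd μ)).const_mul _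
  refine (norm_integral_le_of_norm_le hi (Eventually.of_forall fun x => ?_)).trans ?_
  · refine (KK_bd hc x.1 x.2).trans ?_
    gcongr; exact norm_sub_le _ _
  · rw [integral_const_mul, integral_add (hμ.int1.comp_fst ν) (hν.int1.comp_snd μ)]
    have e1 : ∫ x : Ed × Ed, ‖x.1‖ ∂(μ.prod ν) = ∫ v, ‖v‖ ∂μ := by
      rw [integral_fun_fst (μ := μ) (ν := ν) (f := fun v : Ed => ‖v‖)]; simp
    have e2 : ∫ x : Ed × Ed, ‖x.2‖ ∂(μ.prod ν) = ∫ v, ‖v‖ ∂ν := by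
      rw [integral_fun_snd (μ := μ) (ν := ν) (f := fun v : Ed => ‖v‖)]; simp
    rw [e1, e2]
    have := hμ.m1
    have := hν.m1
    nlinarith
lemma KK_add [IsMarkovKernel K] (hf : Measurable f)
    (hg : Measurable g) (hc : ∀ v, |f v| ≤ c) (hc' : ∀ v, |g v| ≤ c') (h : ℝ) (v vs : Ed) :
    KK K (fun v => f v + h * g v) v vs = KK K f v vs + h * KK K g v vs := by
  have hi : ∀ {f : Fn} {c : ℝ}, Measurable f → (∀ v, |f v| ≤ c) →
      Integrable (fun σ => Df f v vs σ) (K (v - vs)) := fun hf hc =>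
    Integrable.of_bound (C := 4 * _) (meas_Df' hf v vs).aestronglyMeasurable
      (Eventually.of_forall fun σ => Df_bd hc v vs σ)
  unfold KK
  have : ∀ σ, Df (fun v => f v + h * g v) v vs σ = Df f v vs σ + h * Df g v vs σ := by
    intro σ; unfold Df; ring
  simp only [this]
  rw [integral_add (hi hf hc) ((hi hg hc').const_mul h), integral_const_mul]
  ring
lemma QInt_add (hK : GoodK B κ K)
    (hf : Measurable f) (hg : Measurable g) (hc : ∀ v, |f v| ≤ c)
    (hc' : ∀ v, |g v| ≤ c') (h : ℝ) {μ : Ms} (hμ : S2 μ) (hν : S2 ν) :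
    QInt B (fun v => f v + h * g v) μ ν = QInt B f μ ν + h * QInt B g μ ν := by
  have := hK.markov
  have hb : ∀ v, |f v + h * g v| ≤ c + |h| * c' := fun v => by
    refine (abs_add_le _ _).trans ?_
    rw [abs_mul]
    gcongr
    · exact hc v
    · exact hc' v
  rw [QInt_prod hK (f := fun v => f v + h * g v) (hf.add (hg.const_mul h)) hb hμ hν, QInt_prod hK hf hc hμ hν, QInt_prod hK hg hc' hμ hν]
  simp only [KK_add hf hg hc hc']
  rw [integral_add (KK_int hf hc hμ hν) ((KK_int hg hc' hμ hν).const_mul h), integral_const_mul]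
end
section
def ww (v : Ed) : ℝ := 1 + ‖v‖ ^ 2
lemma ww_ge (v : Ed) : 1 ≤ ww v := by unfold ww; nlinarith [sq_nonneg ‖v‖]
structure AA (c : ℝ) (f : Fn) : Prop where
  bd : ∀ v, |f v| ≤ c * ww v
  lip : ∀ v u, |f v - f u| ≤ c * (‖v - u‖ * (ww v + ww u))
lemma ww_sub (v u : Ed) : |ww v - ww u| ≤ ‖v - u‖ * (‖v‖ + ‖u‖) := by
  unfold ww
  rw [show 1 + ‖v‖^2 - (1 + ‖u‖^2) = (‖v‖ - ‖u‖) * (‖v‖ + ‖u‖) by ring, abs_mul,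
    abs_of_nonneg (pz : 0 ≤ ‖v‖ + ‖u‖)]
  gcongr; exact abs_norm_sub_norm_le v u
lemma AA_of_testF (hf : f ∈ testF d) : AA 2 f := by
  obtain ⟨h1, h2⟩ := hf
  have h1' : ∀ v, |f v| ≤ ww v := fun v => by
    have := h1 v
    rwa [abs_div, abs_of_pos (pz : 0 < 1 + ‖v‖^2), div_le_one pz] at this
  refine ⟨fun v => (h1' v).trans (by linarith [ww_ge v]), fun v u => ?_⟩
  have e : f v - f u = (f v / (1 + ‖v‖^2) - f u / (1 + ‖u‖^2)) * ww v + f u / (1 + ‖u‖^2) * (ww v - ww u) := by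
    have : 0 < 1 + ‖v‖^2 := pz
    have : 0 < 1 + ‖u‖^2 := pz
    unfold ww; field_simp; ring
  rw [e]
  refine (abs_add_le _ _).trans ?_
  rw [abs_mul, abs_mul, abs_of_pos (by linarith [ww_ge v] : 0 < ww v)]
  have a1 : |f v / (1 + ‖v‖^2) - f u / (1 + ‖u‖^2)| * ww v ≤ ‖v - u‖ * ww v :=
    mul_le_mul_of_nonneg_right (h2 v u) (by linarith [ww_ge v])
  have a2 : |f u / (1 + ‖u‖^2)| * |ww v - ww u| ≤ 1 * (‖v - u‖ * (‖v‖ + ‖u‖)) :=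
    mul_le_mul (h1 u) (ww_sub v u) (abs_nonneg _) zero_le_one
  have a3 : ‖v - u‖ * (‖v‖ + ‖u‖) ≤ ‖v - u‖ * (ww v + ww u) := by
    gcongr <;> unfold ww <;> nlinarith [sq_nonneg (‖v‖ - 1), sq_nonneg (‖u‖ - 1)]
  have a4 : 0 ≤ ‖v - u‖ * ww u := mul_nonneg (norm_nonneg _) (by linarith [ww_ge u])
  linarith
lemma AA.nonneg (h : AA c f) : 0 ≤ c := by
  have := (abs_nonneg _).trans (h.bd 0)
  simpa [ww] using this
lemma testF_of_AA (hc : 0 < c) (h : AA c f) :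
    (fun v => (3 * c)⁻¹ * f v) ∈ testF d := by
  have key : ∀ v u : Ed, ww u ≤ ww v →
      |f v / ww v - f u / ww u| ≤ 3 * c * ‖v - u‖ := by
    intro v u huv
    have wv := ww_ge v
    have wu := ww_ge u
    have e : f v / ww v - f u / ww u = (f v - f u) / ww v - f u / ww u * (ww v - ww u) / ww v := by
      field_simp; ring
    rw [e]
    refine (abs_sub _ _).trans ?_
    have a1 : |(f v - f u) / ww v| ≤ 2 * c * ‖v - u‖ := by
      rw [abs_div, abs_of_pos (lz : 0 < ww v), div_le_iff₀ lz]
      refine (h.lip v u).trans ?_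
      have : ‖v - u‖ * (ww v + ww u) ≤ ‖v - u‖ * (2 * ww v) := by gcongr; linarith
      nlinarith
    have a2 : |f u / ww u * (ww v - ww u) / ww v| ≤ c * ‖v - u‖ := by
      rw [abs_div, abs_mul, abs_div, abs_of_pos (lz : 0 < ww v), abs_of_pos (lz : 0 < ww u),
        div_le_iff₀ lz]
      have b1 : |f u| / ww u ≤ c := by rw [div_le_iff₀ lz]; exact h.bd u
      have b2 : |ww v - ww u| ≤ ‖v - u‖ * ww v := (ww_sub v u).trans (by
        gcongr
        have : ‖u‖ ≤ ‖v‖ := by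
          unfold ww at huv
          exact le_of_sq_le_sq lz (norm_nonneg _)
        unfold ww; nlinarith [sq_nonneg (‖v‖ - 1)])
      calc _ ≤ c * (‖v - u‖ * ww v) := mul_le_mul b1 b2 (abs_nonneg _) hc.le
        _ = _ := by ring
    linarith
  have key2 : ∀ v u : Ed, |f v / ww v - f u / ww u| ≤ 3 * c * ‖v - u‖ := by
    intro v u
    rcases le_total (ww u) (ww v) with h' | h'
    · exact key v u h'
    · rw [abs_sub_comm, norm_sub_rev]; exact key u v h'
  refine ⟨fun v => ?_, fun v u => ?_⟩
  · rw [mul_div_assoc, abs_mul, abs_of_pos (pz : 0 < (3*c)⁻¹), inv_mul_le_iff₀ pz, abs_div,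
      abs_of_pos (pz : 0 < 1 + ‖v‖^2), div_le_iff₀ pz]
    have := h.bd v
    have := ww_ge v
    unfold ww at *
    nlinarith
  · rw [mul_div_assoc, mul_div_assoc, ← mul_sub, abs_mul, abs_of_pos (pz : 0 < (3*c)⁻¹),
      inv_mul_le_iff₀ pz]
    exact key2 v u
lemma AA_of_lip (h1 : ∀ v, |f v| ≤ c) (h2 : ∀ v u, |f v - f u| ≤ c * ‖v - u‖) : AA c f := by
  have hc : 0 ≤ c := (abs_nonneg _).trans (h1 0)
  refine ⟨fun v => (h1 v).trans (by nlinarith [ww_ge v]), fun v u => (h2 v u).trans ?_⟩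
  gcongr
  nlinarith [ww_ge v, ww_ge u, norm_nonneg (v - u)]
lemma AA.cont (h : AA c f) : Continuous f := by
  have hc := h.nonneg
  rw [continuous_iff_continuousAt]
  intro u
  rw [ContinuousAt, tendsto_iff_dist_tendsto_zero]
  refine squeeze_zero (fun _ => dist_nonneg) (g := fun v => c * (‖v - u‖ * (ww v + ww u))) (fun v => h.lip v u) ?_
  have : Continuous (fun v => c * (‖v - u‖ * (ww v + ww u))) := by unfold ww; fun_prop
  have h0 := this.tendsto u
  simpa using h0
lemma meas_of_closed {X : Type*} [MeasurableSpace X] {k : X → Ms} (hp : ∀ x, IsProbabilityMeasure (k x))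
    (h : ∀ F : Set (Ed), IsClosed F → Measurable fun x => k x F) : Measurable k := by
  refine Measurable.measure_of_isPiSystem_of_isProbabilityMeasure (S := {F | IsClosed F})
    (BorelSpace.measurable_eq.trans borel_eq_generateFrom_isClosed) isPiSystem_isClosed ?_
  exact fun F hF => h F hF
lemma meas_of_testF {X : Type*} [MeasurableSpace X] {k : X → Ms} (hp : ∀ x, IsProbabilityMeasure (k x))
    (h : ∀ f ∈ testF d, Measurable fun x => ∫ v, f v ∂(k x)) : Measurable k := by
  have hA : ∀ {c : ℝ} {f : Fn}, 0 < c → AA c f → Measurable fun x => ∫ v, f v ∂(k x) := by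
    intro c f hc hf
    have := (h _ (testF_of_AA hc hf)).const_mul (3 * c)
    simp only [integral_const_mul] at this
    convert this using 2
    field_simp
  refine meas_of_closed hp fun F hF => ?_
  have δp : ∀ n : ℕ, (0:ℝ) < 1 / ((n:ℝ) + 1) := fun n => Nat.one_div_pos_of_nat
  have key : ∀ n : ℕ, Measurable fun x => ∫⁻ v, (thickenedIndicator (δp n) F v : ℝ≥0∞) ∂(k x) := by
    intro n
    have e : ∀ x, ∫⁻ v, (thickenedIndicator (δp n) F v : ℝ≥0∞) ∂(k x)
        = ofReal (∫ v, (thickenedIndicator (δp n) F v : ℝ) ∂(k x)) := by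
      intro x
      have := hp x
      rw [ofReal_integral_eq_lintegral_ofReal]
      · simp
      · refine Integrable.of_bound (C := 1) ?_ (Eventually.of_forall fun v => ?_)
        · exact (NNReal.continuous_coe.comp (thickenedIndicator (δp n) F).continuous).aestronglyMeasurable
        · simpa using thickenedIndicator_le_one (δp n) F v
      · exact Eventually.of_forall fun v => NNReal.coe_nonneg _
    simp only [e]
    refine ENNReal.measurable_ofReal.comp (hA (c := n + 1) pz (AA_of_lip (fun v => ?_) fun v u => ?_))
    · have := thickenedIndicator_le_one (δp n) F v
      rw [abs_of_nonneg (NNReal.coe_nonneg _)]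
      have h2 : ((thickenedIndicator (δp n) F v : ℝ≥0) : ℝ) ≤ 1 := by exact_mod_cast this
      linarith [(Nat.cast_nonneg n : (0:ℝ) ≤ n)]
    · have := (lipschitzWith_thickenedIndicator (δp n) F).dist_le_mul v u
      rw [NNReal.dist_eq, dist_eq_norm] at this
      refine this.trans (le_of_eq ?_)
      simp
      left
      rw [max_eq_left pz, inv_inv]
  refine measurable_of_tendsto_metrizable key ?_
  rw [tendsto_pi_nhds]
  intro x
  have := hp x
  exact tendsto_lintegral_thickenedIndicator_of_isClosed (k x) hF δp tendsto_one_div_add_atTop_nhds_zero_nat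
end
section
lemma meas_primitive (q : ℝ → ℝ) (c : ℝ) (hq : ∀ s, 0 ≤ s → |q s| ≤ c) :
    Measurable (fun t => ∫ s in Ioc (0:ℝ) t, q s) := by
  classical
  have hc : 0 ≤ c := (abs_nonneg _).trans (hq 0 le_rfl)
  set I : Set ℝ := {t | IntegrableOn q (Ioc 0 t)} with hI
  have hlow : IsLowerSet I := fun a b hab ha => ha.mono_set (Ioc_subset_Ioc_right hab)
  have hIm : MeasurableSet I := hlow.ordConnected.measurableSet
  have e : (fun t => ∫ s in Ioc (0:ℝ) t, q s) = I.piecewise (fun t => ∫ s in Ioc (0:ℝ) t, q s) (fun _ => 0) := by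
    ext t
    by_cases ht : t ∈ I
    · rw [Set.piecewise_eq_of_mem _ _ _ ht]
    · rw [Set.piecewise_eq_of_notMem _ _ _ ht]; exact integral_undef ht
  rw [e]
  refine ContinuousOn.measurable_piecewise ?_ continuousOn_const hIm
  have key : ∀ s ∈ I, ∀ t ∈ I, s ≤ t → |(∫ r in Ioc (0:ℝ) t, q r) - ∫ r in Ioc (0:ℝ) s, q r| ≤ c * (t - s) := by
    intro s hs t ht hst
    rcases le_total s 0 with h0 | h0
    · rw [Set.Ioc_eq_empty_of_le h0]
      simp only [Measure.restrict_empty, integral_zero_measure, sub_zero]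
      rcases le_total t 0 with h1 | h1
      · rw [Set.Ioc_eq_empty_of_le h1]; simp; nlinarith
      have := norm_setIntegral_le_of_norm_le_const (μ := volume) (s := Ioc 0 t) (f := q) (C := c) (by simp)
        (fun x hx => hq x hx.1.le)
      rw [norm_eq_abs] at this
      simp [h1] at this
      nlinarith
    · have hu : Ioc 0 t = Ioc 0 s ∪ Ioc s t := (Ioc_union_Ioc_eq_Ioc h0 hst).symm
      have ht2 : IntegrableOn q (Ioc s t) := IntegrableOn.mono_set ht (Set.Ioc_subset_Ioc_left h0)
      rw [hu, setIntegral_union (Set.Ioc_disjoint_Ioc_of_le le_rfl) measurableSet_Ioc hs ht2, add_sub_cancel_left]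
      have := norm_setIntegral_le_of_norm_le_const (μ := volume) (s := Ioc s t) (f := q) (C := c) (by simp)
        (fun x hx => hq x (h0.trans hx.1.le))
      rw [norm_eq_abs] at this
      simpa [hst] using this
  have hlip : LipschitzOnWith c.toNNReal (fun t => ∫ s in Ioc (0:ℝ) t, q s) I := by
    refine LipschitzOnWith.of_dist_le_mul fun s hs t ht => ?_
    rw [Real.dist_eq, Real.dist_eq, Real.coe_toNNReal _ hc]
    rcases le_total s t with h | h
    · rw [abs_sub_comm, abs_sub_comm s, abs_of_nonneg (sub_nonneg.2 h)]; exact key s hs t ht h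
    · rw [abs_of_nonneg (sub_nonneg.2 h)]; exact key t ht s hs h
  exact hlip.continuousOn
lemma sol_meas (hK : GoodK B κ K)
    {μ : ℝ → Ms} (hsol : IsBoltzmannSolution B μ) : Measurable (fun s => μ (max s 0)) := by
  have hS : ∀ s, 0 ≤ s → S2 (μ s) := fun s hs => S2_of_mem (hsol.1 s hs)
  have hp : ∀ s, IsProbabilityMeasure (μ (max s 0)) := fun s => (hS _ (le_max_right _ _)).prob
  have key : ∀ C : Set (Ed), IsCompact C → Measurable (fun s => μ (max s 0) C) := by
    intro C hC
    have hm : Measurable (C.indicator (fun _ => (1:ℝ))) := measurable_const.indicator hC.measurableSet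
    have hb : ∀ v, |C.indicator (fun _ => (1:ℝ)) v| ≤ 1 := fun v => by
      by_cases h : v ∈ C <;> simp [h]
    have e := hsol.2 (C.indicator (fun _ => (1:ℝ))) hm ⟨1, hb⟩
      (HasCompactSupport.intro hC fun v hv => indicator_of_notMem hv _)
    have m1 := (meas_primitive (fun s => QInt B (C.indicator (fun _ => (1:ℝ))) (μ s) (μ s)) _
      (fun s hs => QInt_bd hK hm hb (hS s hs) (hS s hs))).comp (measurable_id.max (measurable_const (a := (0:ℝ))))
    have m2 : Measurable (fun s => ∫ v, C.indicator (fun _ => (1:ℝ)) v ∂(μ (max s 0))) := by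
      have : ∀ s, ∫ v, C.indicator (fun _ => (1:ℝ)) v ∂(μ (max s 0)) = _ := fun s => e (max s 0) (le_max_right _ _)
      simp only [this]
      exact m1.const_add _
    have m3 : ∀ s, μ (max s 0) C = ofReal (∫ v, C.indicator (fun _ => (1:ℝ)) v ∂(μ (max s 0))) := fun s => by
      rw [integral_indicator_const _ hC.measurableSet]; simp
    simp only [m3]
    exact ENNReal.measurable_ofReal.comp m2
  refine meas_of_closed hp fun F hF => ?_
  have e : ∀ s, Tendsto (fun n : ℕ => μ (max s 0) (F ∩ Metric.closedBall 0 n)) atTop (nhds (μ (max s 0) F)) := by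
    intro s
    have h1 : F = ⋃ n : ℕ, F ∩ Metric.closedBall 0 n := by
      rw [← Set.inter_iUnion, Metric.iUnion_closedBall_nat, Set.inter_univ]
    nth_rewrite 2 [h1]
    refine tendsto_measure_iUnion_atTop fun a b hab => ?_
    exact Set.inter_subset_inter_right _ (Metric.closedBall_subset_closedBall (by exact_mod_cast hab))
  exact measurable_of_tendsto_metrizable (fun n => key _ ((isCompact_closedBall 0 (n:ℝ)).inter_left hF)) (tendsto_pi_nhds.2 e)
lemma path_meas {Ω : Type*} [m : MeasurableSpace Ω] {P : Measure Ω}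
    {𝓕 : Filtration ℝ m} {μp : ℝ → Ω → Ms} (h : IsKacProcess B N P 𝓕 μp) (s : ℝ) :
    Measurable[𝓕 s] (μp s) :=
  @meas_of_testF d Ω (𝓕 s) (μp s) (fun ω => (h.mem s ω).1.1) fun f hf => (h.adapted f hf s).measurable
lemma path_meas2 {Ω : Type*} [m : MeasurableSpace Ω] {P : Measure Ω}
    {𝓕 : Filtration ℝ m} {μp : ℝ → Ω → Ms} (h : IsKacProcess B N P 𝓕 μp) :
    Measurable (fun q : ℝ × Ω => μp q.1 q.2) := by
  refine meas_of_testF (fun q => (h.mem q.1 q.2).1.1) fun f hf => ?_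
  let a : ℕ → ℝ → ℝ := fun n s => ((⌊((n:ℝ)+1) * s⌋ : ℝ) + 1) / ((n:ℝ)+1)
  refine measurable_of_tendsto_metrizable (f := fun n (q : ℝ × Ω) => ∫ v, f v ∂(μp (a n q.1) q.2)) (fun n => ?_) ?_
  · have h1 : Measurable (fun q : ℤ × Ω => ∫ v, f v ∂(μp (((q.1:ℝ) + 1) / ((n:ℝ)+1)) q.2)) :=
      measurable_from_prod_countable_right fun k =>
        ((h.adapted f hf (((k:ℝ) + 1) / ((n:ℝ)+1))).mono (𝓕.le _)).measurable
    have h2 : Measurable (fun q : ℝ × Ω => ((⌊((n:ℝ)+1) * q.1⌋ : ℤ), q.2)) :=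
      (Int.measurable_floor.comp mz).prodMk measurable_snd
    exact h1.comp h2
  · rw [tendsto_pi_nhds]
    rintro ⟨s, ω⟩
    have hc := h.rightCont ω f hf s
    refine (hc.tendsto).comp (tendsto_nhdsWithin_iff.2 ⟨?_, Eventually.of_forall fun n => ?_⟩)
    · have h0 : Tendsto (fun n : ℕ => s + 1 / ((n:ℝ) + 1)) atTop (nhds s) := by
        simpa using tendsto_const_nhds.add (tendsto_one_div_add_atTop_nhds_zero_nat (𝕜 := ℝ))
      refine tendsto_of_tendsto_of_tendsto_of_le_of_le tendsto_const_nhds h0 (fun n => ?_) (fun n => ?_)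
      · simp only [a]; rw [le_div_iff₀ pz]
        linarith [Int.lt_floor_add_one (((n:ℝ)+1) * s)]
      · simp only [a]
        have hn : (0:ℝ) < (n:ℝ) + 1 := pz
        rw [div_le_iff₀ hn, show (s + 1 / ((n:ℝ)+1)) * ((n:ℝ)+1) = ((n:ℝ)+1) * s + 1 by field_simp]
        linarith [Int.floor_le (((n:ℝ)+1) * s)]
    · simp only [a, Set.mem_Ici]; rw [le_div_iff₀ pz]
      linarith [Int.lt_floor_add_one (((n:ℝ)+1) * s)]
end
section
def w3 (v : Ed) : ℝ := (1 + ‖v‖) * ww v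
lemma ww_le_w3 (v : Ed) : ww v ≤ w3 v := by
  unfold w3; nlinarith [ww_ge v, norm_nonneg v]
lemma meas_ww : Measurable (ww : Fn) := by unfold ww; fun_prop
lemma cont_w3 : Continuous (w3 : Fn) := by unfold w3 ww; fun_prop
def chi (R : ℝ) (v : Ed) : ℝ := max 0 (min 1 (2 - ‖v‖ / R))
lemma chi_nonneg (R : ℝ) (v : Ed) : 0 ≤ chi R v := le_max_left _ _
lemma chi_le (R : ℝ) (v : Ed) : chi R v ≤ 1 := max_le zero_le_one (min_le_left _ _)
lemma chi_one (hR : 1 ≤ R) (hv : ‖v‖ ≤ R) : chi R v = 1 := by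
  unfold chi
  have : ‖v‖ / R ≤ 1 := by rw [div_le_one lz]; exact hv
  rw [min_eq_left lz, max_eq_right zero_le_one]
lemma chi_zero (hR : 1 ≤ R) (hv : 2 * R ≤ ‖v‖) : chi R v = 0 := by
  unfold chi
  have : 2 ≤ ‖v‖ / R := by rw [le_div_iff₀ lz]; exact hv
  rw [min_eq_right lz, max_eq_left lz]
lemma chi_lip (hR : 1 ≤ R) (v u : Ed) : |chi R v - chi R u| ≤ ‖v - u‖ / R := by
  unfold chi
  have h1 := abs_max_sub_max_le_abs (min 1 (2 - ‖v‖ / R)) (min 1 (2 - ‖u‖ / R)) 0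
  rw [max_comm _ (0:ℝ), max_comm _ (0:ℝ)] at h1
  refine h1.trans ((abs_min_sub_min_le_max _ _ _ _).trans ?_)
  rw [sub_self, abs_zero, max_eq_right (abs_nonneg _), show 2 - ‖v‖ / R - (2 - ‖u‖ / R) = (‖u‖ - ‖v‖) / R by ring,
    abs_div, abs_of_pos (lz : 0 < R), norm_sub_rev]
  gcongr
  exact abs_norm_sub_norm_le u v
structure AR (R c : ℝ) (W : Fn) (f : Fn) : Prop where
  bd : ∀ v, ‖v‖ ≤ 2 * R → |f v| ≤ c * W v
  lip : ∀ v u, ‖v‖ ≤ 2 * R → ‖u‖ ≤ 2 * R → |f v - f u| ≤ c * (‖v - u‖ * (W v + W u))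
def cut (R : ℝ) (f : Fn) (v : Ed) : ℝ := chi R v * f v
lemma cut_zero (hR : 1 ≤ R) (f : Fn) (hv : 2 * R ≤ ‖v‖) : cut R f v = 0 := by
  unfold cut; rw [chi_zero hR hv, zero_mul]
lemma cut_bd (hR : 1 ≤ R) (hW : ∀ v, 1 ≤ W v) (hc : 0 ≤ c) (h : AR R c W f) (v : Ed) :
    |cut R f v| ≤ c * W v := by
  rcases le_total ‖v‖ (2 * R) with hv | hv
  · unfold cut
    rw [abs_mul, abs_of_nonneg (chi_nonneg _ _)]
    calc _ ≤ 1 * |f v| := by gcongr; exact chi_le _ _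
      _ ≤ _ := by rw [one_mul]; exact h.bd v hv
  · rw [cut_zero hR f hv, abs_zero]; have := hW v; positivity
lemma cut_lip (hR : 1 ≤ R) (hW : ∀ v, 1 ≤ W v) (hc : 0 ≤ c) (h : AR R c W f) (v u : Ed) :
    |cut R f v - cut R f u| ≤ c * (‖v - u‖ * (W v + W u)) * (1 + R⁻¹) := by
  have key : ∀ v u : Ed, ‖v‖ ≤ 2 * R → |cut R f v - cut R f u| ≤ c * (‖v - u‖ * (W v + W u)) * (1 + R⁻¹) := by
    intro v u hv
    have hv1 := hW v
    have hu1 := hW u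
    have hR0 : 0 < R⁻¹ := pz
    have hA : |(chi R v - chi R u) * f v| ≤ ‖v - u‖ * R⁻¹ * (c * W v) := by
      rw [abs_mul]
      exact mul_le_mul ((chi_lip hR v u).trans (le_of_eq (div_eq_mul_inv _ _))) (h.bd v hv) (abs_nonneg _) pz
    have hx : 0 ≤ c * ‖v - u‖ * W u := pz
    have hx2 : 0 ≤ c * ‖v - u‖ * W v := pz
    rcases le_total ‖u‖ (2 * R) with hu | hu
    · have e : cut R f v - cut R f u = (chi R v - chi R u) * f v + chi R u * (f v - f u) := by unfold cut; ring
      have hB : |chi R u * (f v - f u)| ≤ 1 * (c * (‖v - u‖ * (W v + W u))) := by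
        rw [abs_mul, abs_of_nonneg (chi_nonneg _ _)]
        exact mul_le_mul (chi_le _ _) (h.lip v u hv hu) (abs_nonneg _) zero_le_one
      rw [e]
      refine (abs_add_le _ _).trans ?_
      nlinarith [mul_nonneg hx hR0.le]
    · have e : cut R f v - cut R f u = (chi R v - chi R u) * f v := by unfold cut; rw [chi_zero hR hu]; ring
      rw [e]
      refine hA.trans ?_
      nlinarith [mul_nonneg hx hR0.le]
  rcases le_total ‖v‖ (2 * R) with hv | hv
  · exact key v u hv
  rcases le_total ‖u‖ (2 * R) with hu | hu
  · rw [abs_sub_comm, norm_sub_rev, add_comm (W v)]; exact key u v hu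
  · rw [cut_zero hR f hv, cut_zero hR f hu, sub_zero, abs_zero]
    have := hW v; have := hW u; positivity
lemma cut_cont (hR : 1 ≤ R) (hW : ∀ v, 1 ≤ W v) (hWc : Continuous W) (hc : 0 ≤ c)
    (h : AR R c W f) : Continuous (cut R f) := by
  rw [continuous_iff_continuousAt]
  intro u
  rw [ContinuousAt, tendsto_iff_dist_tendsto_zero]
  refine squeeze_zero (fun _ => dist_nonneg) (g := fun v => c * (‖v - u‖ * (W v + W u)) * (1 + R⁻¹))
    (fun v => cut_lip hR hW hc h v u) ?_
  have : Continuous (fun v => c * (‖v - u‖ * (W v + W u)) * (1 + R⁻¹)) := mz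
  have h0 := this.tendsto u
  simpa using h0
lemma cut_sup (hR : 1 ≤ R) (hc : 0 ≤ c) (h : AR R c w3 f) (v : Ed) :
    |cut R f v| ≤ c * (1 + 2 * R) ^ 3 := by
  have hw : ∀ v : Ed, 1 ≤ w3 v := fun v => (ww_ge v).trans (ww_le_w3 v)
  rcases le_total ‖v‖ (2 * R) with hv | hv
  · refine (cut_bd hR hw hc h v).trans ?_
    gcongr
    unfold w3 ww
    rw [show (1 + 2 * R) ^ 3 = (1 + 2 * R) * (1 + 2 * R) ^ 2 by ring]
    have := norm_nonneg v
    exact mul_le_mul lz (by nlinarith) pz pz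
  · rw [cut_zero hR f hv, abs_zero]; positivity
lemma AR_w3 (hc : 0 ≤ c) (h : AR R c ww f) : AR R c w3 f :=
  ⟨fun v hv => (h.bd v hv).trans (by gcongr; exact ww_le_w3 v), fun v u hv hu => (h.lip v u hv hu).trans (by
    gcongr <;> exact ww_le_w3 _)⟩
lemma post_lip (v u vs σ : Ed) (hσ : ‖σ‖ = 1) :
    ‖postV v vs σ - postV u vs σ‖ ≤ ‖v - u‖ ∧ ‖postVs v vs σ - postVs u vs σ‖ ≤ ‖v - u‖ := by
  have h : |‖v - vs‖ - ‖u - vs‖| ≤ ‖v - u‖ := by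
    have := abs_norm_sub_norm_le (v - vs) (u - vs)
    rwa [sub_sub_sub_cancel_right] at this
  have h2 : ‖(tw⁻¹ * (‖v - vs‖ - ‖u - vs‖)) • σ‖ ≤ 2⁻¹ * ‖v - u‖ := by
    rw [norm_smul, hσ, mul_one, norm_mul, norm_eq_abs, norm_eq_abs]
    norm_num; exact h
  have h3 : ‖tw⁻¹ • (v - u)‖ = 2⁻¹ * ‖v - u‖ := by rw [norm_smul]; norm_num
  have e1 : postV v vs σ - postV u vs σ = tw⁻¹ • (v - u) + (tw⁻¹ * (‖v - vs‖ - ‖u - vs‖)) • σ := by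
    unfold postV; module
  have e2 : postVs v vs σ - postVs u vs σ = tw⁻¹ • (v - u) - (tw⁻¹ * (‖v - vs‖ - ‖u - vs‖)) • σ := by
    unfold postVs; module
  rw [e1, e2]
  constructor
  · have := norm_add_le (tw⁻¹ • (v - u)) ((tw⁻¹ * (‖v - vs‖ - ‖u - vs‖)) • σ); linarith
  · have := norm_sub_le (tw⁻¹ • (v - u)) ((tw⁻¹ * (‖v - vs‖ - ‖u - vs‖)) • σ); linarith
lemma ww_energy (v vs σ : Ed) (hσ : ‖σ‖ = 1) : ww (postV v vs σ) + ww (postVs v vs σ) = ww v + ww vs := by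
  unfold ww; linarith [energy v vs σ hσ]
lemma tv' (hK : GoodK B κ K) {h : Fn}
    (hm : Measurable h) (hc : 0 < c) (hb : ∀ σ, ‖σ‖ = 1 → |h σ| ≤ c) (v u : Ed) :
    |‖v‖ * (∫ σ, h σ ∂(K v)) - ‖u‖ * ∫ σ, h σ ∂(K u)| ≤ c * (κ * ‖v - u‖) := by
  classical
  have hs : MeasurableSet {σ : Ed | ‖σ‖ = 1} := measurableSet_eq_fun mz measurable_const
  set f : Ed → ℝ := {σ : Ed | ‖σ‖ = 1}.indicator (fun σ => c⁻¹ * h σ) with hf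
  have fm : Measurable f := (hm.const_mul _).indicator hs
  have fb : ∀ x, |f x| ≤ 1 := by
    intro x
    by_cases hx : ‖x‖ = 1
    · rw [hf, indicator_of_mem (by exact hx), abs_mul, abs_of_pos (pz : 0 < c⁻¹), inv_mul_le_iff₀ hc]
      simpa using hb x hx
    · rw [hf, indicator_of_notMem (by exact hx)]; simp
  have e : ∀ v, ∫ σ, h σ ∂(K v) = c * ∫ σ, f σ ∂(K v) := by
    intro v
    rw [← integral_const_mul]
    refine integral_congr_ae ?_
    filter_upwards [hK.sph v] with σ hσ
    rw [hf, indicator_of_mem (by exact hσ)]; field_simp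
  have k1 := hK.tv v u f fm fb
  have k2 := hK.tv u v f fm fb
  rw [norm_sub_rev] at k2
  rw [e, e, show ‖v‖ * (c * ∫ σ, f σ ∂(K v)) - ‖u‖ * (c * ∫ σ, f σ ∂(K u)) =
    c * (‖v‖ * (∫ σ, f σ ∂(K v)) - ‖u‖ * ∫ σ, f σ ∂(K u)) by ring, abs_mul, abs_of_pos hc]
  gcongr
  rw [abs_le]; constructor <;> linarith
end
section
lemma one_le_w3 (v : Ed) : 1 ≤ w3 v := (ww_ge v).trans (ww_le_w3 v)
structure Tau (τ : Ms) (a : ℝ) : Prop where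
  fin : IsFiniteMeasure τ
  mass : τ.real Set.univ = 2
  i1 : Integrable (fun v => ‖v‖) τ
  m1 : ∫ v, ‖v‖ ∂τ ≤ 2
  i3 : Integrable w3 τ
  m3 : ∫ v, w3 v ∂τ ≤ a
lemma Tau.one {a : ℝ} (h : Tau τ a) : 1 ≤ a := by
  have := h.fin
  have h1 : ∫ _, (1:ℝ) ∂τ ≤ ∫ v, w3 v ∂τ := integral_mono (integrable_const _) h.i3 fun v => one_le_w3 v
  simp [h.mass] at h1
  linarith [h.m3]
def Hf (F : Fn) (v vs σ : Ed) : ℝ := F (postV v vs σ) + F (postVs v vs σ) - F vs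
def Gf (K : Kernel (Ed) (Ed)) (τ : Ms) (F : Fn) (v : Ed) : ℝ :=
  ∫ vs, ‖v - vs‖ * ∫ σ, Hf F v vs σ ∂(K (v - vs)) ∂τ
def Lam (τ : Ms) (v : Ed) : ℝ := ∫ vs, ‖v - vs‖ ∂τ
def Lf (R : ℝ) (K : Kernel (Ed) (Ed)) (τ : Ms) (f : Fn) (v : Ed) : ℝ :=
  Gf K τ (cut R f) v - f v * Lam τ v
lemma Tau.iL {a : ℝ} (h : Tau τ a) (v : Ed) : Integrable (fun vs => ‖v - vs‖) τ := by
  have := h.fin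
  refine Integrable.mono' ((integrable_const ‖v‖).add h.i1) mz (Eventually.of_forall fun u => ?_)
  simpa using norm_sub_le v u
lemma Tau.Lam_le {a : ℝ} (h : Tau τ a) (v : Ed) : Lam τ v ≤ 2 * (1 + ‖v‖) := by
  have := h.fin
  have h1 : Lam τ v ≤ ∫ u, (‖v‖ + ‖u‖) ∂τ := integral_mono (h.iL v) ((integrable_const ‖v‖).add h.i1) fun u => norm_sub_le v u
  rw [integral_add (integrable_const _) h.i1] at h1
  simp [h.mass] at h1
  linarith [h.m1]
lemma Lam_nonneg (τ : Ms) (v : Ed) : 0 ≤ Lam τ v := integral_nonneg fun _ => norm_nonneg _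
lemma Tau.Lam_lip {a : ℝ} (h : Tau τ a) (v u : Ed) : |Lam τ v - Lam τ u| ≤ 2 * ‖v - u‖ := by
  have := h.fin
  unfold Lam
  rw [← integral_sub (h.iL v) (h.iL u)]
  have := norm_integral_le_of_norm_le_const (μ := τ) (f := fun z => ‖v - z‖ - ‖u - z‖) (C := ‖v - u‖)
    (Eventually.of_forall fun z => by
      have := abs_norm_sub_norm_le (v - z) (u - z)
      rwa [sub_sub_sub_cancel_right] at this)
  rw [h.mass, norm_eq_abs] at this
  linarith
lemma meas_Hf (hF : Measurable F) :
    Measurable (fun x : (Ed × Ed) × Ed => Hf F x.1.1 x.1.2 x.2) := by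
  unfold Hf
  exact ((hF.comp meas_postV).add (hF.comp meas_postVs)).sub (hF.comp (measurable_snd.comp measurable_fst))
lemma meas_Hf' (hF : Measurable F) (v vs : Ed) : Measurable (fun σ => Hf F v vs σ) :=
  (meas_Hf hF).comp (g := fun x : (Ed × Ed) × Ed => Hf F x.1.1 x.1.2 x.2)
    (f := fun σ => ((v, vs), σ)) measurable_prodMk_left
lemma meas_G [IsMarkovKernel K] (hF : Measurable F) (v : Ed) :
    Measurable (fun vs => ‖v - vs‖ * ∫ σ, Hf F v vs σ ∂(K (v - vs))) := by
  have h := (meas_intK K (meas_Hf hF)).comp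
    (g := fun x : Ed × Ed => ∫ σ, Hf F x.1 x.2 σ ∂(K (x.1 - x.2))) (f := fun vs => (v, vs)) measurable_prodMk_left
  exact (mz : Measurable fun vs => ‖v - vs‖).mul h
lemma norm_sub_le_mul (v vs : Ed) : ‖v - vs‖ ≤ (1 + ‖v‖) * (1 + ‖vs‖) := by
  have := norm_sub_le v vs
  nlinarith [norm_nonneg v, norm_nonneg vs, mul_nonneg (norm_nonneg v) (norm_nonneg vs)]
section
variable (hK : GoodK B κ K) {a : ℝ}
  (hτ : Tau τ a) (hF : Measurable F) (hb : ∀ v, |F v| ≤ ww v)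
include hK hb
lemma H_bd (v vs σ : Ed) (hσ : ‖σ‖ = 1) : |Hf F v vs σ| ≤ ww v + 2 * ww vs := by
  have h1 := abs_le.1 (hb (postV v vs σ))
  have h2 := abs_le.1 (hb (postVs v vs σ))
  have h3 := abs_le.1 (hb vs)
  have := ww_energy v vs σ hσ
  unfold Hf
  rw [abs_le]; constructor <;> linarith
lemma H_int_bd (v vs : Ed) : |‖v - vs‖ * ∫ σ, Hf F v vs σ ∂(K (v - vs))| ≤ ww v * ‖v - vs‖ + 2 * (1 + ‖v‖) * w3 vs := by
  have := hK.markov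
  have h1 : |∫ σ, Hf F v vs σ ∂(K (v - vs))| ≤ ww v + 2 * ww vs := abs_int_le (by
    filter_upwards [hK.sph (v - vs)] with σ hσ using H_bd hK hb v vs σ hσ)
  rw [abs_mul, abs_norm]
  have h2 : ‖v - vs‖ * (2 * ww vs) ≤ (1 + ‖v‖) * (1 + ‖vs‖) * (2 * ww vs) :=
    mul_le_mul_of_nonneg_right (norm_sub_le_mul v vs) (by linarith [ww_ge vs])
  have h3 := mul_le_mul_of_nonneg_left h1 (norm_nonneg (v - vs))
  unfold w3
  nlinarith
include hF
lemma H_int (v vs : Ed) : Integrable (fun σ => Hf F v vs σ) (K (v - vs)) := by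
  have := hK.markov
  refine Integrable.of_bound (C := ww v + 2 * ww vs) (meas_Hf' hF v vs).aestronglyMeasurable ?_
  filter_upwards [hK.sph (v - vs)] with σ hσ using H_bd hK hb v vs σ hσ
include hτ
lemma G_int (v : Ed) : Integrable (fun vs => ‖v - vs‖ * ∫ σ, Hf F v vs σ ∂(K (v - vs))) τ := by
  have := hK.markov
  exact Integrable.mono' (((hτ.iL v).const_mul (ww v)).add (hτ.i3.const_mul (2 * (1 + ‖v‖))))
    (meas_G hF v).aestronglyMeasurable (Eventually.of_forall fun vs => H_int_bd hK hb v vs)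
lemma G_bd (v : Ed) : |Gf K τ F v| ≤ ww v * Lam τ v + 2 * (1 + ‖v‖) * a := by
  have h1 := norm_integral_le_of_norm_le (f := fun vs => ‖v - vs‖ * ∫ σ, Hf F v vs σ ∂(K (v - vs)))
    (((hτ.iL v).const_mul (ww v)).add (hτ.i3.const_mul (2 * (1 + ‖v‖))))
    (Eventually.of_forall fun vs => H_int_bd hK hb v vs)
  rw [norm_eq_abs] at h1
  refine h1.trans ?_
  rw [integral_add' ((hτ.iL v).const_mul (ww v)) (hτ.i3.const_mul _), integral_const_mul, integral_const_mul]
  unfold Lam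
  have := hτ.m3
  gcongr
lemma G_lip (hR : 1 ≤ R) (hl : ∀ v u, |F v - F u| ≤ ‖v - u‖ * (ww v + ww u) * (1 + R⁻¹)) (v u : Ed)
    (hv : ‖v‖ ≤ 2 * R) : |Gf K τ F v - Gf K τ F u| ≤ ‖v - u‖ * ((ww v + ww u) * (Lam τ v + 10 * κ * a)) := by
  have hκ := hK.one_le
  have := hK.markov
  have pt : ∀ vs, |‖v - vs‖ * (∫ σ, Hf F v vs σ ∂(K (v - vs))) - ‖u - vs‖ * ∫ σ, Hf F u vs σ ∂(K (u - vs))|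
      ≤ ‖v - u‖ * (ww v + ww u) * ‖v - vs‖ + ‖v - u‖ * (ww v + ww u) * (10 * κ) * w3 vs := by
    intro vs
    have wv := ww_ge v
    have wu := ww_ge u
    have wvs := ww_ge vs
    have im : Integrable (fun σ => Hf F u vs σ) (K (v - vs)) := by
      refine Integrable.of_bound (C := ww u + 2 * ww vs) (meas_Hf' hF u vs).aestronglyMeasurable ?_
      filter_upwards [hK.sph (v - vs)] with σ hσ using H_bd hK hb u vs σ hσ
    have e : ‖v - vs‖ * (∫ σ, Hf F v vs σ ∂(K (v - vs))) - ‖u - vs‖ * ∫ σ, Hf F u vs σ ∂(K (u - vs))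
        = ‖v - vs‖ * (∫ σ, (Hf F v vs σ - Hf F u vs σ) ∂(K (v - vs))) +
        (‖v - vs‖ * (∫ σ, Hf F u vs σ ∂(K (v - vs))) - ‖u - vs‖ * ∫ σ, Hf F u vs σ ∂(K (u - vs))) := by
      rw [integral_sub (H_int hK hF hb v vs) im]; ring
    have t1 : |‖v - vs‖ * (∫ σ, Hf F u vs σ ∂(K (v - vs))) - ‖u - vs‖ * ∫ σ, Hf F u vs σ ∂(K (u - vs))|
        ≤ (ww u + 2 * ww vs) * (κ * ‖v - u‖) := by
      have := tv' hK (meas_Hf' hF u vs) (c := ww u + 2 * ww vs) lz (fun σ hσ => H_bd hK hb u vs σ hσ) (v - vs) (u - vs)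
      rwa [sub_sub_sub_cancel_right] at this
    have t2 : |∫ σ, (Hf F v vs σ - Hf F u vs σ) ∂(K (v - vs))| ≤ ‖v - u‖ * (ww v + ww u + 2 * ww vs) * (1 + R⁻¹) := by
      refine abs_int_le ?_
      filter_upwards [hK.sph (v - vs)] with σ hσ
      obtain ⟨p1, p2⟩ := post_lip v u vs σ hσ
      have q1 := hl (postV v vs σ) (postV u vs σ)
      have q2 := hl (postVs v vs σ) (postVs u vs σ)
      have e1 := ww_energy v vs σ hσ
      have e2 := ww_energy u vs σ hσ
      have a1 := ww_ge (postV v vs σ)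
      have a2 := ww_ge (postVs v vs σ)
      have a3 := ww_ge (postV u vs σ)
      have a4 := ww_ge (postVs u vs σ)
      have hRi : 0 < R⁻¹ := pz
      have r1 : ‖postV v vs σ - postV u vs σ‖ * (ww (postV v vs σ) + ww (postV u vs σ)) * (1 + R⁻¹) ≤
        ‖v - u‖ * (ww (postV v vs σ) + ww (postV u vs σ)) * (1 + R⁻¹) := by gcongr
      have r2 : ‖postVs v vs σ - postVs u vs σ‖ * (ww (postVs v vs σ) + ww (postVs u vs σ)) * (1 + R⁻¹) ≤
        ‖v - u‖ * (ww (postVs v vs σ) + ww (postVs u vs σ)) * (1 + R⁻¹) := by gcongr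
      have e3 : ‖v - u‖ * (ww v + ww u + 2 * ww vs) * (1 + R⁻¹) =
        ‖v - u‖ * (ww (postV v vs σ) + ww (postV u vs σ)) * (1 + R⁻¹) +
        ‖v - u‖ * (ww (postVs v vs σ) + ww (postVs u vs σ)) * (1 + R⁻¹) := by
        rw [show ww v + ww u + 2 * ww vs = (ww (postV v vs σ) + ww (postVs v vs σ)) + (ww (postV u vs σ) + ww (postVs u vs σ)) by
          linarith]; ring
      rw [e3]
      have e4 : Hf F v vs σ - Hf F u vs σ = (F (postV v vs σ) - F (postV u vs σ)) + (F (postVs v vs σ) - F (postVs u vs σ)) := by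
        unfold Hf; ring
      rw [e4]
      refine (abs_add_le _ _).trans ?_
      linarith
    rw [e]
    refine (abs_add_le _ _).trans ?_
    rw [abs_mul, abs_norm]
    have t3 := mul_le_mul_of_nonneg_left t2 (norm_nonneg (v - vs))
    set D := ‖v - u‖
    have hD : 0 ≤ D := norm_nonneg _
    set X := ww v + ww u with hX
    have s1 : ‖v - vs‖ * R⁻¹ ≤ 2 * (1 + ‖vs‖) := by
      rw [← div_eq_mul_inv, div_le_iff₀ lz]
      have := norm_sub_le v vs
      nlinarith [norm_nonneg vs]
    have s2 : ‖v - vs‖ * (2 * ww vs) ≤ (1 + ‖v‖) * (1 + ‖vs‖) * (2 * ww vs) :=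
      mul_le_mul_of_nonneg_right (norm_sub_le_mul v vs) lz
    have s3 : ‖v - vs‖ * R⁻¹ * (X + 2 * ww vs) ≤ 2 * (1 + ‖vs‖) * (X + 2 * ww vs) :=
      mul_le_mul_of_nonneg_right s1 lz
    have s4 : 1 + ‖v‖ ≤ 2 * ww v := by unfold ww; nlinarith [sq_nonneg (‖v‖ - 1)]
    have hns := norm_nonneg vs
    have s5 : (1 + ‖vs‖) ≤ w3 vs := by unfold w3; nlinarith
    have s6 : (1 + ‖vs‖) * ww vs = w3 vs := rfl
    have w3p := one_le_w3 vs
    have s7 := ww_le_w3 vs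
    have tot : ‖v - vs‖ * (X + 2 * ww vs) * (1 + R⁻¹) + (ww u + 2 * ww vs) * κ ≤ X * ‖v - vs‖ + X * (10 * κ) * w3 vs := by
      have b1 : 2 * (1 + ‖vs‖) * (X + 2 * ww vs) ≤ 4 * (X * w3 vs) := by
        have : (1 + ‖vs‖) * X ≤ w3 vs * X := mul_le_mul_of_nonneg_right s5 lz
        have : 2 * w3 vs ≤ X * w3 vs := mul_le_mul_of_nonneg_right lz lz
        nlinarith
      have b2 : (1 + ‖v‖) * (1 + ‖vs‖) * (2 * ww vs) ≤ 4 * (X * w3 vs) := by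
        rw [show (1 + ‖v‖) * (1 + ‖vs‖) * (2 * ww vs) = (1 + ‖v‖) * (2 * w3 vs) by rw [← s6]; ring]
        have : (1 + ‖v‖) * (2 * w3 vs) ≤ (2 * X) * (2 * w3 vs) := mul_le_mul_of_nonneg_right lz lz
        linarith
      have b3 : ww u + 2 * ww vs ≤ 2 * (X * w3 vs) := by
        have : 2 * w3 vs ≤ X * w3 vs := mul_le_mul_of_nonneg_right lz lz
        have : X * 1 ≤ X * w3 vs := mul_le_mul_of_nonneg_left w3p lz
        linarith
      have b4 := mul_le_mul_of_nonneg_right b3 (lz : 0 ≤ κ)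
      have b5 : X * w3 vs * 1 ≤ X * w3 vs * κ := mul_le_mul_of_nonneg_left hκ (by nlinarith)
      have e5 : ‖v - vs‖ * (X + 2 * ww vs) * (1 + R⁻¹) = X * ‖v - vs‖ + ‖v - vs‖ * (2 * ww vs) +
        ‖v - vs‖ * R⁻¹ * (X + 2 * ww vs) := by ring
      have e6 : X * (10 * κ) * w3 vs = 10 * (X * w3 vs * κ) := by ring
      rw [e5, e6]
      linarith
    refine (add_le_add t3 t1).trans (le_trans (le_of_eq ?_) ((mul_le_mul_of_nonneg_left tot hD).trans (le_of_eq ?_))) <;> ring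
  unfold Gf
  rw [← integral_sub (G_int hK hτ hF hb v) (G_int hK hτ hF hb u)]
  have h1 := norm_integral_le_of_norm_le (f := fun vs => ‖v - vs‖ * (∫ σ, Hf F v vs σ ∂(K (v - vs))) -
    ‖u - vs‖ * ∫ σ, Hf F u vs σ ∂(K (u - vs))) (((hτ.iL v).const_mul (‖v - u‖ * (ww v + ww u))).add
    (hτ.i3.const_mul (‖v - u‖ * (ww v + ww u) * (10 * κ)))) (Eventually.of_forall pt)
  rw [norm_eq_abs] at h1
  refine h1.trans ?_
  rw [integral_add' ((hτ.iL v).const_mul _) (hτ.i3.const_mul _), integral_const_mul, integral_const_mul]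
  have c1 := hτ.m3
  have c2 : ‖v - u‖ * (ww v + ww u) * (10 * κ) * ∫ z, w3 z ∂τ ≤ ‖v - u‖ * (ww v + ww u) * (10 * κ) * a := by
    have := ww_ge v; have := ww_ge u
    gcongr
  unfold Lam
  linarith
end
end
section
section
variable (hK : GoodK B κ K) {a : ℝ}
  (hτ : Tau τ a) (hR : 1 ≤ R) (hf : AR R 1 ww f)
include hf hR
lemma cut_cont1 : Continuous (cut R f) := cut_cont hR ww_ge (by unfold ww; fun_prop) zero_le_one hf
lemma cut_bd1 (v : Ed) : |cut R f v| ≤ ww v := by simpa using cut_bd hR ww_ge zero_le_one hf v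
include hK hτ
lemma Gc_lip (v u : Ed) (hv : ‖v‖ ≤ 2 * R) : |Gf K τ (cut R f) v - Gf K τ (cut R f) u|
    ≤ ‖v - u‖ * ((ww v + ww u) * (Lam τ v + 10 * κ * a)) :=
  G_lip hK hτ (cut_cont1 hR hf).measurable (cut_bd1 hR hf) hR
    (fun v u => by simpa using cut_lip hR ww_ge zero_le_one hf v u) v u hv
lemma Gc_bd (v : Ed) : |Gf K τ (cut R f) v| ≤ ww v * Lam τ v + 2 * (1 + ‖v‖) * a :=
  G_bd hK hτ (cut_cont1 hR hf).measurable (cut_bd1 hR hf) v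
lemma step1 {h : ℝ} (h0 : 0 ≤ h) (hh : h * (4 * R + 2) ≤ 1) :
    AR R (1 + 20 * κ * a * h) ww (fun v => f v + h * Lf R K τ f v) := by
  have hκ := hK.one_le
  have ha := hτ.one
  have hLam : ∀ v : Ed, ‖v‖ ≤ 2 * R → h * Lam τ v ≤ 1 := fun v hv => by
    refine le_trans (mul_le_mul_of_nonneg_left ((hτ.Lam_le v).trans ?_) h0) hh
    linarith
  have hka : a ≤ κ * a := by nlinarith
  constructor
  · intro v hv
    have h1 := hf.bd v hv
    have h2 := Gc_bd hK hτ hR hf v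
    have h3 := hLam v hv
    have e : f v + h * Lf R K τ f v = f v * (1 - h * Lam τ v) + h * Gf K τ (cut R f) v := by unfold Lf; ring
    rw [e]
    refine (abs_add_le _ _).trans ?_
    rw [abs_mul, abs_mul, abs_of_nonneg h0, abs_of_nonneg (lz : 0 ≤ 1 - h * Lam τ v)]
    have h4 := mul_le_mul_of_nonneg_right h1 (lz : 0 ≤ 1 - h * Lam τ v)
    have h5 := mul_le_mul_of_nonneg_left h2 h0
    have h6 : 1 + ‖v‖ ≤ 2 * ww v := by unfold ww; nlinarith [sq_nonneg (‖v‖ - 1)]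
    have h7 : 2 * (1 + ‖v‖) * a ≤ 20 * κ * a * ww v := by
      have := ww_ge v
      calc 2 * (1 + ‖v‖) * a ≤ 4 * ww v * a := by nlinarith
        _ = 4 * (a * ww v) := by ring
        _ ≤ 20 * (κ * a * ww v) := by nlinarith
        _ = _ := by ring
    have h8 := mul_le_mul_of_nonneg_left h7 h0
    nlinarith
  · intro v u hv hu
    have wv := ww_ge v
    have wu := ww_ge u
    have h1 := hf.lip v u hv hu
    have h2 := Gc_lip hK hτ hR hf v u hv
    have h3 := hLam v hv
    have h4 := hf.bd u hu
    have h5 := hτ.Lam_lip u v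
    have e : f v + h * Lf R K τ f v - (f u + h * Lf R K τ f u) = (f v - f u) * (1 - h * Lam τ v)
      + h * (f u * (Lam τ u - Lam τ v)) + h * (Gf K τ (cut R f) v - Gf K τ (cut R f) u) := by unfold Lf; ring
    rw [e]
    refine (abs_add_three _ _ _).trans ?_
    rw [abs_mul, abs_mul, abs_mul, abs_mul, abs_of_nonneg h0, abs_of_nonneg (lz : 0 ≤ 1 - h * Lam τ v)]
    rw [norm_sub_rev] at h5
    have a1 := mul_le_mul_of_nonneg_right h1 (lz : 0 ≤ 1 - h * Lam τ v)
    have a2 := mul_le_mul_of_nonneg_left (mul_le_mul h4 h5 (abs_nonneg _) lz) h0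
    have a3 := mul_le_mul_of_nonneg_left h2 h0
    set D := ‖v - u‖
    have hD : 0 ≤ D := norm_nonneg _
    set X := ww v + ww u with hX
    have b0 : 0 ≤ h * D * X := pz
    have b1 : h * (1 * ww u * (2 * D)) ≤ 2 * (h * D * X) := by
      have : 0 ≤ h * D * ww v := pz
      rw [hX]; nlinarith
    have b2 : h * D * X ≤ κ * a * (h * D * X) := by nlinarith
    have e1 : 1 * (D * X) * (1 - h * Lam τ v) = D * X - h * D * X * Lam τ v := by ring
    have e2 : h * (D * (X * (Lam τ v + 10 * κ * a))) = h * D * X * Lam τ v + 10 * (κ * a * (h * D * X)) := by ring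
    have e3 : (1 + 20 * κ * a * h) * (D * X) = D * X + 20 * (κ * a * (h * D * X)) := by ring
    rw [e3]
    rw [e1] at a1
    rw [e2] at a3
    linarith
lemma step2 : AR R (20 * κ * a) w3 (Lf R K τ f) := by
  have hκ := hK.one_le
  have ha := hτ.one
  have hka : a ≤ κ * a := by nlinarith
  constructor
  · intro v hv
    have h1 := hf.bd v hv
    have h2 := Gc_bd hK hτ hR hf v
    have h3 := hτ.Lam_le v
    have h4 := Lam_nonneg τ v
    have wv := ww_ge v
    unfold Lf
    refine (abs_sub _ _).trans ?_
    rw [abs_mul, abs_of_nonneg h4]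
    have a1 : |f v| * Lam τ v ≤ ww v * Lam τ v := by
      rw [one_mul] at h1; exact mul_le_mul_of_nonneg_right h1 h4
    have a2 : ww v * Lam τ v ≤ 2 * w3 v := by
      have := mul_le_mul_of_nonneg_left h3 (lz : 0 ≤ ww v)
      unfold w3; linarith
    have a3 : (1 + ‖v‖) * a ≤ w3 v * a := by
      unfold w3; have := norm_nonneg v
      gcongr; nlinarith
    have a4 : w3 v * 1 ≤ w3 v * a := by have := one_le_w3 v; gcongr
    have a5 : w3 v * a ≤ w3 v * (κ * a) := by have := one_le_w3 v; gcongr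
    rw [show 20 * κ * a * w3 v = 20 * (w3 v * (κ * a)) by ring]
    have := one_le_w3 v
    nlinarith
  · intro v u hv hu
    have wv := ww_ge v
    have wu := ww_ge u
    have h1 := hf.lip v u hv hu
    have h2 := Gc_lip hK hτ hR hf v u hv
    have h3 := hτ.Lam_le v
    have h3' := Lam_nonneg τ v
    have h4 := hf.bd u hu
    have h5 := hτ.Lam_lip u v
    have e : Lf R K τ f v - Lf R K τ f u = (Gf K τ (cut R f) v - Gf K τ (cut R f) u)
      + f u * (Lam τ u - Lam τ v) - (f v - f u) * Lam τ v := by unfold Lf; ring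
    rw [e]
    refine (abs_sub _ _).trans ((add_le_add (abs_add_le _ _) le_rfl).trans ?_)
    rw [abs_mul, abs_mul, abs_of_nonneg h3']
    rw [norm_sub_rev] at h5
    have a1 := mul_le_mul_of_nonneg_right h1 h3'
    have a2 := mul_le_mul h4 h5 (abs_nonneg _) (lz : 0 ≤ 1 * ww u)
    set D := ‖v - u‖
    have hD : 0 ≤ D := norm_nonneg _
    set X := ww v + ww u with hX
    set Y := w3 v + w3 u with hY
    have Xp : 0 ≤ X := lz
    have XY : X ≤ Y := add_le_add (ww_le_w3 v) (ww_le_w3 u)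
    have XL : X * (1 + ‖v‖) ≤ 2 * Y := by
      have nv := norm_nonneg v
      have nu := norm_nonneg u
      have c1 : ww v * (1 + ‖v‖) = w3 v := by unfold w3; ring
      have c2 : ww u * (1 + ‖v‖) ≤ Y := by
        rcases le_total ‖u‖ ‖v‖ with hl | hl
        · have : ww u ≤ ww v := by unfold ww; gcongr
          have : ww u * (1 + ‖v‖) ≤ ww v * (1 + ‖v‖) := by gcongr
          have := one_le_w3 u
          linarith
        · have : ww u * (1 + ‖v‖) ≤ ww u * (1 + ‖u‖) := by gcongr
          have c3 : ww u * (1 + ‖u‖) = w3 u := by unfold w3; ring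
          have := one_le_w3 v
          linarith
      have := one_le_w3 u
      nlinarith
    have b1 : X * Lam τ v ≤ 4 * Y := by
      have := mul_le_mul_of_nonneg_left h3 Xp
      linarith
    have b2 : X * (κ * a) ≤ Y * (κ * a) := by gcongr
    have b3 : Y ≤ Y * (κ * a) := by nlinarith
    have tot : X * (Lam τ v + 10 * κ * a) + 2 * X + X * Lam τ v ≤ 20 * (Y * (κ * a)) := by
      rw [show X * (Lam τ v + 10 * κ * a) = X * Lam τ v + 10 * (X * (κ * a)) by ring]
      linarith
    have tD := mul_le_mul_of_nonneg_left tot hD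
    have a3 : 1 * ww u * (2 * D) ≤ D * (2 * X) := by
      rw [show 1 * ww u * (2 * D) = D * (2 * ww u) by ring]
      gcongr; linarith
    calc _ ≤ D * (X * (Lam τ v + 10 * κ * a)) + D * (2 * X) + 1 * (D * X) * Lam τ v := lz
      _ = D * (X * (Lam τ v + 10 * κ * a) + 2 * X + X * Lam τ v) := by ring
      _ ≤ _ := tD
      _ = _ := by ring
end
lemma w3_int_cut (hR : 1 ≤ R) (hc : 0 ≤ c) (h : AR R c w3 f) (μ : Ms)
    [IsFiniteMeasure μ] : Integrable (cut R f) μ :=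
  Integrable.of_bound (C := c * (1 + 2 * R) ^ 3) (cut_cont hR one_le_w3 cont_w3 hc h).aestronglyMeasurable
    (Eventually.of_forall fun v => cut_sup hR hc h v)
lemma Tau_of {x μ : Ms} (hx : S2 x) (hμ : S2 μ) (ix : Integrable w3 x) (iμ : Integrable w3 μ) {a : ℝ}
    (ha : (∫ v, w3 v ∂x) + ∫ v, w3 v ∂μ ≤ a) : Tau (x + μ) a := by
  have := hx.prob
  have := hμ.prob
  refine ⟨inferInstance, ?_, hx.int1.add_measure hμ.int1, ?_, ix.add_measure iμ, ?_⟩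
  · rw [measureReal_add_apply]; simp; norm_num
  · rw [integral_add_measure hx.int1 hμ.int1]; linarith [hx.m1, hμ.m1]
  · rw [integral_add_measure ix iμ]; exact ha
lemma Q_ident (hK : GoodK B κ K)
    {x μ : Ms} (hx : S2 x) (hμ : S2 μ) {a : ℝ} (hτ : Tau (x + μ) a)
    (hR : 1 ≤ R) (hf : AR R 1 ww f) {θ : ℝ}
    (hθ : 2 * ∫ v, (1 - chi R v) * (w3 v + (1 + ‖v‖) * a) ∂(x + μ) ≤ θ) :
    QInt B (cut R f) x x - QInt B (cut R f) μ μ ≤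
      (∫ v, cut R (Lf R K (x + μ) f) v ∂x) - (∫ v, cut R (Lf R K (x + μ) f) v ∂μ) + θ := by
  have := hx.prob
  have := hμ.prob
  have := hK.markov
  have ha := hτ.one
  have hκ := hK.one_le
  set F := cut R f with hF
  have Fm : Measurable F := (cut_cont1 hR hf).measurable
  have Fb : ∀ v, |F v| ≤ 1 * (1 + 2 * R) ^ 3 := fun v => cut_sup hR zero_le_one (AR_w3 zero_le_one hf) v
  have L2 := step2 hK hτ hR hf
  set Φ : Ed → ℝ := fun v => ∫ vs, KK K F v vs ∂(x + μ) with hΦ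
  have KKi : ∀ v (ν : Ms), S2 ν → Integrable (fun vs => KK K F v vs) ν := by
    intro v ν hν
    have := hν.prob
    have hm : Measurable (fun vs => KK K F v vs) :=
      (meas_KK K Fm).comp (g := fun x : Ed × Ed => KK K F x.1 x.2) (f := fun vs => (v, vs)) measurable_prodMk_left
    refine Integrable.mono' (((integrable_const ‖v‖).add hν.int1).const_mul (4 * (1 * (1 + 2 * R) ^ 3))) hm.aestronglyMeasurable
      (Eventually.of_forall fun vs => (KK_bd Fb v vs).trans ?_)
    simp only [Pi.add_apply]
    gcongr
    exact norm_sub_le _ _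
  have eΦ : ∀ v, Φ v = (∫ vs, KK K F v vs ∂x) + ∫ vs, KK K F v vs ∂μ := fun v =>
    integral_add_measure (KKi v x hx) (KKi v μ hμ)
  have ip : ∀ {ν ρ : Ms}, S2 ν → S2 ρ → Integrable (fun v => ∫ vs, KK K F v vs ∂ρ) ν := by
    intro ν ρ hν hρ
    have := hν.prob
    have := hρ.prob
    exact (KK_int Fm Fb hν hρ).integral_prod_left
  have cross : ∫ v, ∫ vs, KK K F v vs ∂μ ∂x = ∫ v, ∫ vs, KK K F v vs ∂x ∂μ := by
    rw [integral_integral_swap (f := fun v vs => KK K F v vs) (KK_int Fm Fb hx hμ)]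
    congr 1; ext v; congr 1; ext vs; exact KK_symm hK Fm vs v
  have iΦ : ∀ {ν}, S2 ν → Integrable Φ ν := fun hν => by
    have := (ip hν hx).add (ip hν hμ)
    exact this.congr (Eventually.of_forall fun v => (eΦ v).symm)
  have e1 : QInt B F x x - QInt B F μ μ = (∫ v, Φ v ∂x) - ∫ v, Φ v ∂μ := by
    rw [QInt_eq hK, QInt_eq hK]
    simp only [eΦ]
    rw [integral_add (ip hx hx) (ip hx hμ), integral_add (ip hμ hx) (ip hμ hμ), cross]
    ring
  have e2 : ∀ v, Φ v = Gf K (x + μ) F v - F v * Lam (x + μ) v := by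
    intro v
    unfold Lam Gf
    rw [← integral_const_mul, ← integral_sub (G_int hK hτ Fm (cut_bd1 hR hf) v) ((hτ.iL v).const_mul _)]
    refine integral_congr_ae (Eventually.of_forall fun vs => ?_)
    have : ∀ σ, Df F v vs σ = Hf F v vs σ - F v := fun σ => by unfold Df Hf; ring
    simp only [KK, this]
    rw [integral_sub (H_int hK Fm (cut_bd1 hR hf) v vs) (integrable_const _)]
    simp; ring
  have e3 : ∀ v, Φ v = cut R (Lf R K (x + μ) f) v + (1 - chi R v) * Gf K (x + μ) F v := by
    intro v; rw [e2 v]; unfold Lf; simp only [hF, cut]; ring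
  have ic : ∀ {ν}, S2 ν → Integrable (cut R (Lf R K (x + μ) f)) ν := fun hν => by
    have := hν.prob
    exact w3_int_cut hR pz L2 _
  have ir : ∀ {ν}, S2 ν → Integrable (fun v => (1 - chi R v) * Gf K (x + μ) F v) ν := fun hν => by
    refine ((iΦ hν).sub (ic hν)).congr (Eventually.of_forall fun v => ?_)
    simp only [Pi.sub_apply, e3 v]; ring
  rw [e1]
  simp only [e3]
  rw [integral_add (ic hx) (ir hx), integral_add (ic hμ) (ir hμ)]
  have t1 : ∀ v, |(1 - chi R v) * Gf K (x + μ) F v| ≤ 2 * ((1 - chi R v) * (w3 v + (1 + ‖v‖) * a)) := by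
    intro v
    have c1 : 0 ≤ 1 - chi R v := by linarith [chi_le R v]
    rw [abs_mul, abs_of_nonneg c1]
    have g := Gc_bd hK hτ hR hf v
    have l := mul_le_mul_of_nonneg_left (hτ.Lam_le v) (by linarith [ww_ge v] : 0 ≤ ww v)
    have : |Gf K (x + μ) F v| ≤ 2 * (w3 v + (1 + ‖v‖) * a) := by unfold w3; linarith
    have := mul_le_mul_of_nonneg_left this c1
    linarith
  have hchi : Measurable (chi R : Fn) := by unfold chi; fun_prop
  have bt : Integrable (fun v => 2 * ((1 - chi R v) * (w3 v + (1 + ‖v‖) * a))) (x + μ) := by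
    have hfin := hτ.fin
    refine Integrable.const_mul (Integrable.bdd_mul (c := 1) (hτ.i3.add (((integrable_const 1).add hτ.i1).mul_const a)) ?_ ?_) 2
    · exact (measurable_const.sub hchi).aestronglyMeasurable
    · refine Eventually.of_forall fun v => ?_
      rw [norm_eq_abs, abs_le]; constructor <;> linarith [chi_le R v, chi_nonneg R v]
  have b1 := norm_integral_le_of_norm_le (f := fun v => (1 - chi R v) * Gf K (x + μ) F v) (bt.mono_measure (Measure.le_add_right le_rfl) : Integrable _ x) (Eventually.of_forall t1)
  have b2 := norm_integral_le_of_norm_le (f := fun v => (1 - chi R v) * Gf K (x + μ) F v) (bt.mono_measure (Measure.le_add_left le_rfl) : Integrable _ μ) (Eventually.of_forall t1)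
  rw [norm_eq_abs] at b1 b2
  rw [← integral_const_mul, integral_add_measure (bt.mono_measure (Measure.le_add_right le_rfl))
    (bt.mono_measure (Measure.le_add_left le_rfl))] at hθ
  have := abs_le.1 b1
  have := abs_le.1 b2
  linarith
end
section
structure Path (x : ℝ → Ms) : Prop where
  meas : Measurable x
  s2 : ∀ s, S2 (x s)
structure BM (c : ℝ) (F : Fn) : Prop where
  meas : Measurable F
  bd : ∀ v, |F v| ≤ c
lemma BM.nonneg (h : BM c F) : 0 ≤ c := (abs_nonneg _).trans (h.bd 0)
lemma BM.int (h : BM c F) (μ : Ms) [IsFiniteMeasure μ] : Integrable F μ :=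
  Integrable.of_bound (C := c) h.meas.aestronglyMeasurable (Eventually.of_forall h.bd)
lemma BM.add {G : Fn} (h : BM c F) (h' : BM c' G) (k : ℝ) : BM (c + |k| * c') (fun v => F v + k * G v) :=
  ⟨h.meas.add (h'.meas.const_mul k), fun v => (abs_add_le _ _).trans (by
    rw [abs_mul]; have := h.bd v; have := h'.bd v; gcongr)⟩
lemma BM.smul {G : Fn} (h' : BM c' G) (k : ℝ) : BM (|k| * c') (fun v => k * G v) :=
  ⟨(h'.meas.const_mul k), fun v => (by
    rw [abs_mul]; have := h'.bd v; gcongr)⟩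
lemma BM_cut (hR : 1 ≤ R) (hc : 0 ≤ c) (h : AR R c w3 f) : BM (c * (1 + 2 * R) ^ 3) (cut R f) :=
  ⟨(cut_cont hR one_le_w3 cont_w3 hc h).measurable, cut_sup hR hc h⟩
def Mt (B : Ed → Ms) (x : ℝ → Ms) (F : Fn) (r : ℝ) : ℝ :=
  (∫ v, F v ∂(x r)) - (∫ v, F v ∂(x 0)) - ∫ s in Ioc 0 r, QInt B F (x s) (x s)
section
variable (hK : GoodK B κ K)
include hK
lemma Path.q_meas {x : ℝ → Ms} (hx : Path x) (hF : Measurable F) :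
    Measurable (fun s => QInt B F (x s) (x s)) := by
  let k : Kernel ℝ (Ed) := ⟨x, hx.meas⟩
  have : IsMarkovKernel k := ⟨fun s => (hx.s2 s).prob⟩
  exact meas_QInt hK k hF
lemma Path.q_int {x : ℝ → Ms} (hx : Path x) (hF : BM c F) (s t : ℝ) :
    IntegrableOn (fun s => QInt B F (x s) (x s)) (Ioc s t) := by
  refine Measure.integrableOn_of_bounded (M := 8 * c) measure_Ioc_lt_top.ne (hx.q_meas hK hF.meas).aestronglyMeasurable
    (Eventually.of_forall fun s => QInt_bd hK hF.meas hF.bd (hx.s2 s) (hx.s2 s))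
lemma Mt_add {x : ℝ → Ms} (hx : Path x) {G : Fn} (hF : BM c F) (hG : BM c' G) (k r : ℝ) :
    Mt B x (fun v => F v + k * G v) r = Mt B x F r + k * Mt B x G r := by
  have := fun s => (hx.s2 s).prob
  unfold Mt
  simp only [QInt_add hK hF.meas hG.meas hF.bd hG.bd k (hx.s2 _) (hx.s2 _)]
  rw [integral_add (hF.int _) ((hG.int _).const_mul k), integral_add (hF.int _) ((hG.int _).const_mul k),
    integral_add (hx.q_int hK hF 0 r) ((hx.q_int hK hG 0 r).const_mul k)]
  simp only [integral_const_mul]; ring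
lemma Mt_smul {x : ℝ → Ms} (hx : Path x) {G : Fn} (hG : BM c' G) (k r : ℝ) :
    Mt B x (fun v => k * G v) r = k * Mt B x G r := by
  have h0 : BM 0 (fun _ : Ed => (0:ℝ)) := ⟨measurable_const, by simp⟩
  have := Mt_add hK hx h0 hG k r
  simp only [zero_add] at this
  rw [this]; simp [Mt, QInt]
end
def EE (B : Ed → Ms) (x μ : ℝ → Ms) (F : Fn) (r : ℝ) : ℝ :=
  (∫ v, F v ∂(x 0)) - (∫ v, F v ∂(μ 0)) + ∫ s in Ioc 0 r, (QInt B F (x s) (x s) - QInt B F (μ s) (μ s))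
lemma AR_smul {k : ℝ} (hk : 0 ≤ k) (h : AR R c W f) : AR R (k * c) W (fun v => k * f v) := by
  refine ⟨fun v hv => ?_, fun v u hv hu => ?_⟩
  · rw [abs_mul, abs_of_nonneg hk, mul_assoc]; exact mul_le_mul_of_nonneg_left (h.bd v hv) hk
  · rw [← mul_sub, abs_mul, abs_of_nonneg hk, mul_assoc]; exact mul_le_mul_of_nonneg_left (h.lip v u hv hu) hk
lemma AR_norm (hc : 0 < c) (h : AR R c W f) : AR R 1 W (fun v => c⁻¹ * f v) := by
  have := AR_smul (inv_nonneg.2 hc.le) h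
  rwa [inv_mul_cancel₀ hc.ne'] at this
lemma cut_smul (R k : ℝ) (f : Fn) : cut R (fun v => k * f v) = fun v => k * cut R f v := by
  ext v; unfold cut; ring
lemma cut_add (R k : ℝ) (f g : Fn) : cut R (fun v => f v + k * g v) = fun v => cut R f v + k * cut R g v := by
  ext v; unfold cut; ring
section
variable (hK : GoodK B κ K)
  {x μ : ℝ → Measure (Vd d)} (hx : Path x) (hμ : Path μ)
include hK hx hμ
lemma EE_int (hF : BM c F) (s t : ℝ) :
    IntegrableOn (fun s => QInt B F (x s) (x s) - QInt B F (μ s) (μ s)) (Ioc s t) :=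
  (hx.q_int hK hF s t).sub (hμ.q_int hK hF s t)
lemma EE_add {G : Fn} (hF : BM c F) (hG : BM c' G) (k r : ℝ) :
    EE B x μ (fun v => F v + k * G v) r = EE B x μ F r + k * EE B x μ G r := by
  have := fun s => (hx.s2 s).prob
  have := fun s => (hμ.s2 s).prob
  unfold EE
  simp only [QInt_add hK hF.meas hG.meas hF.bd hG.bd k (hx.s2 _) (hx.s2 _),
    QInt_add hK hF.meas hG.meas hF.bd hG.bd k (hμ.s2 _) (hμ.s2 _)]
  rw [integral_add (hF.int _) ((hG.int _).const_mul k), integral_add (hF.int _) ((hG.int _).const_mul k)]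
  have : ∫ s in Ioc 0 r, (QInt B F (x s) (x s) + k * QInt B G (x s) (x s) - (QInt B F (μ s) (μ s) + k * QInt B G (μ s) (μ s)))
    = ∫ s in Ioc 0 r, ((QInt B F (x s) (x s) - QInt B F (μ s) (μ s)) + k * (QInt B G (x s) (x s) - QInt B G (μ s) (μ s))) := by
    congr 1; ext s; ring
  rw [this, integral_add (EE_int hK hx hμ hF 0 r) ((EE_int hK hx hμ hG 0 r).const_mul k)]
  simp only [integral_const_mul]; ring
lemma EE_smul {G : Fn} (hG : BM c' G) (k r : ℝ) :
    EE B x μ (fun v => k * G v) r = k * EE B x μ G r := by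
  have h0 : BM 0 (fun _ : Ed => (0:ℝ)) := ⟨measurable_const, by simp⟩
  have := EE_add hK hx hμ h0 hG k r
  simp only [zero_add] at this
  rw [this]; simp [EE, QInt]
lemma EE_split (hF : BM c F) {s : ℝ} (hs : 0 ≤ s) (hst : s ≤ t) :
    EE B x μ F t = EE B x μ F s + ∫ r in Ioc s t, (QInt B F (x r) (x r) - QInt B F (μ r) (μ r)) := by
  unfold EE
  rw [← Ioc_union_Ioc_eq_Ioc hs hst, setIntegral_union _ measurableSet_Ioc (EE_int hK hx hμ hF _ _) (EE_int hK hx hμ hF _ _)]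
  · ring
  · rw [Set.disjoint_left]; rintro r ⟨_, h⟩ ⟨h', _⟩; linarith
lemma EE_diff (hF : BM c F) {s : ℝ} (hs : 0 ≤ s) (hst : s ≤ t) :
    EE B x μ F t ≤ EE B x μ F s + 16 * c * (t - s) := by
  rw [EE_split hK hx hμ hF hs hst]
  gcongr
  have := norm_setIntegral_le_of_norm_le_const (C := 16 * c) (μ := volume) (s := Ioc s t)
    (f := fun r => (QInt B F (x r) (x r) - QInt B F (μ r) (μ r))) measure_Ioc_lt_top (fun r _ => by
      have h1 := QInt_bd hK hF.meas hF.bd (hx.s2 r) (hx.s2 r)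
      have h2 := QInt_bd hK hF.meas hF.bd (hμ.s2 r) (hμ.s2 r)
      rw [norm_eq_abs]
      exact (abs_sub _ _).trans lz)
  rw [Real.volume_real_Ioc_of_le hst] at this
  exact (le_abs_self _).trans this
variable (hR : 1 ≤ R) {Ξ : ℝ}
  (hM : ∀ g, AR R 1 w3 g → ∀ r ∈ Icc 0 T, |Mt B x (cut R g) r| ≤ Ξ)
  (hsol : ∀ g, AR R 1 w3 g → ∀ r, 0 ≤ r → Mt B μ (cut R g) r = 0)
include hR hM hsol
lemma EE_eq (hc : 0 < c) (hg : AR R c w3 g) (hr : r ∈ Icc 0 T) :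
    |(∫ v, cut R g v ∂(x r)) - (∫ v, cut R g v ∂(μ r)) - EE B x μ (cut R g) r| ≤ c * Ξ := by
  have h1 := AR_norm hc hg
  have e : cut R g = fun v => c * cut R (fun v => c⁻¹ * g v) v := by
    rw [← cut_smul]; congr 1; ext v; field_simp
  have hb := BM_cut hR zero_le_one h1
  have hbg := BM_cut hR hc.le hg
  have a1 := hM _ h1 r hr
  have a2 := hsol _ h1 r hr.1
  have b1 : Mt B x (cut R g) r = c * Mt B x (cut R (fun v => c⁻¹ * g v)) r := by
    conv_lhs => rw [e]
    exact Mt_smul hK hx hb c r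
  have b2 : Mt B μ (cut R g) r = 0 := by
    conv_lhs => rw [e]
    rw [Mt_smul hK hμ hb c r, a2, mul_zero]
  have : (∫ v, cut R g v ∂(x r)) - (∫ v, cut R g v ∂(μ r)) - EE B x μ (cut R g) r = Mt B x (cut R g) r := by
    rw [← sub_zero (Mt B x (cut R g) r), ← b2]
    unfold EE Mt
    rw [integral_sub (hx.q_int hK hbg 0 r) (hμ.q_int hK hbg 0 r)]
    ring
  rw [this, b1, abs_mul, abs_of_pos hc]
  gcongr
variable {a θ : ℝ → ℝ} (a0 : ∀ s, 0 ≤ a s) (θ0 : ∀ s, 0 ≤ θ s) (ai : IntegrableOn a (Ioc 0 T)) (θi : IntegrableOn θ (Ioc 0 T))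
  (hτ : ∀ᵐ s ∂(volume.restrict (Ioc 0 T)), Tau (x s + μ s) (a s) ∧
    2 * ∫ v, (1 - chi R v) * (w3 v + (1 + ‖v‖) * a s) ∂(x s + μ s) ≤ θ s)
include a0 θ0 ai θi hτ
lemma EE_step {s h y : ℝ} (hs : 0 ≤ s) (h0 : 0 < h) (hT : s + h ≤ T) (hh : h * (4 * R + 2) ≤ 1)
    (hy : ∀ f, AR R 1 ww f → EE B x μ (cut R f) s ≤ y) (hf : AR R 1 ww f) :
    EE B x μ (cut R f) (s + h) ≤ y + (20 * κ * ∫ r in Ioc s (s + h), a r) * (y + 16 * (1 + 2 * R) ^ 3 * h + Ξ)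
      + ∫ r in Ioc s (s + h), θ r := by
  have hκ := hK.one_le
  have hf3 := AR_w3 zero_le_one hf
  have hFb := BM_cut hR zero_le_one hf3
  rw [EE_split hK hx hμ hFb hs (lz : s ≤ s + h)]
  set e := EE B x μ (cut R f) s with he
  have sub : Ioc s (s + h) ⊆ Ioc 0 T := Set.Ioc_subset_Ioc hs hT
  have key : ∀ᵐ r ∂(volume.restrict (Ioc s (s+h))), QInt B (cut R f) (x r) (x r) - QInt B (cut R f) (μ r) (μ r) ≤
      (y - e) / h + (20 * κ * (y + 16 * (1 + 2 * R) ^ 3 * h + Ξ)) * a r + θ r := by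
    filter_upwards [ae_restrict_of_ae_restrict_of_subset sub hτ, ae_restrict_mem measurableSet_Ioc] with r ⟨h1, h2⟩ hr
    have ha := h1.one
    refine (Q_ident hK (hx.s2 r) (hμ.s2 r) h1 hR hf h2).trans ?_
    set L := Lf R K (x r + μ r) f with hL
    have L2 : AR R (20 * κ * a r) w3 L := step2 hK h1 hR hf
    have L1 := step1 hK h1 hR hf h0.le hh
    rw [← hL] at L1
    have cL : 0 < 20 * κ * a r := pz
    have LB := BM_cut hR cL.le L2
    have q1 := (abs_le.1 (EE_eq hK hx hμ hR hM hsol cL L2 (r := r) ⟨by linarith [hr.1], by linarith [hr.2]⟩)).2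
    have q2 := EE_diff hK hx hμ LB hs hr.1.le
    have q3 : 16 * (20 * κ * a r * (1 + 2 * R) ^ 3) * (r - s) ≤ 16 * (20 * κ * a r * (1 + 2 * R) ^ 3) * h := by
      gcongr; linarith [hr.2]
    have cc : 0 < 1 + 20 * κ * a r * h := pz
    have n1 := AR_norm cc L1
    have q4 := hy _ n1
    rw [cut_smul, EE_smul hK hx hμ (BM_cut hR cc.le (AR_w3 cc.le L1)), cut_add, EE_add hK hx hμ hFb LB, inv_mul_le_iff₀ cc] at q4
    have q5 : EE B x μ (cut R L) s ≤ ((1 + 20 * κ * a r * h) * y - e) / h := by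
      rw [le_div_iff₀ h0]; linarith
    have q6 : ((1 + 20 * κ * a r * h) * y - e) / h = (y - e) / h + 20 * κ * a r * y := by
      field_simp; ring
    rw [q6] at q5
    linarith
  have i1 : IntegrableOn (fun r => (y - e) / h + (20 * κ * (y + 16 * (1 + 2 * R) ^ 3 * h + Ξ)) * a r + θ r) (Ioc s (s+h)) :=
    ((integrableOn_const (by simp)).add ((ai.mono_set sub).const_mul _)).add (θi.mono_set sub)
  have := integral_mono_ae (EE_int hK hx hμ hFb s (s+h)) i1 key
  have i2 : IntegrableOn (fun r => (y - e) / h + (20 * κ * (y + 16 * (1 + 2 * R) ^ 3 * h + Ξ)) * a r) (Ioc s (s+h)) :=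
    (integrableOn_const (by simp)).add ((ai.mono_set sub).const_mul _)
  rw [integral_add i2 (θi.mono_set sub),
    integral_add (integrable_const _) ((ai.mono_set sub).const_mul _), integral_const_mul, setIntegral_const,
    Real.volume_real_Ioc_of_le lz, smul_eq_mul, show (s + h - s) * ((y - e) / h) = y - e by field_simp; ring] at this
  linarith
lemma EE_iter (hT0 : 0 ≤ T) (hD : ∀ f, AR R 1 ww f → (∫ v, cut R f v ∂(x 0)) - ∫ v, cut R f v ∂(μ 0) ≤ D0)
    (hΞ : 0 ≤ Ξ) {h : ℝ} (h0 : 0 < h) (hh : h * (4 * R + 2) ≤ 1) (n : ℕ) (hn : n * h ≤ T) (f : Fn) (hf : AR R 1 ww f) :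
    EE B x μ (cut R f) (n * h) ≤ exp (20 * κ * ∫ r in Ioc 0 (n * h), a r) *
      (D0 + (20 * κ * ∫ r in Ioc 0 (n * h), a r) * (Ξ + 16 * (1 + 2 * R) ^ 3 * h) + ∫ r in Ioc 0 (n * h), θ r) := by
  have hκ := hK.one_le
  have D00 : 0 ≤ D0 := by
    have := hD (fun _ => 0) ⟨fun v _ => by simp; linarith [ww_ge v], fun v u _ _ => by
      simp; have := ww_ge v; have := ww_ge u; positivity⟩
    simpa [cut] using this
  induction n generalizing f with
  | zero => simpa [EE] using hD f hf
  | succ n ih =>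
    have hn' : n * h ≤ T := by push_cast at hn; nlinarith
    have nh : (0:ℝ) ≤ n * h := pz
    have e : ((n + 1 : ℕ) : ℝ) * h = n * h + h := by push_cast; ring
    rw [e] at hn ⊢
    have st := EE_step hK hx hμ hR hM hsol a0 θ0 ai θi hτ nh h0 hn hh (fun f hf => ih hn' f hf) hf
    have sp : ∀ g : ℝ → ℝ, IntegrableOn g (Ioc 0 T) → ∫ r in Ioc 0 (n * h + h), g r =
        (∫ r in Ioc 0 (n * h), g r) + ∫ r in Ioc (n * h) (n * h + h), g r := by
      intro g hg
      rw [← Ioc_union_Ioc_eq_Ioc nh (lz : n * h ≤ n * h + h), setIntegral_union _ measurableSet_Ioc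
        (hg.mono_set (Ioc_subset_Ioc_right hn')) (hg.mono_set (Set.Ioc_subset_Ioc nh hn))]
      rw [Set.disjoint_left]; rintro r ⟨_, h⟩ ⟨h', _⟩; linarith
    rw [sp a ai, sp θ θi]
    have p1 : 0 ≤ 20 * κ * ∫ r in Ioc 0 (n * h), a r := mul_nonneg pz (integral_nonneg a0)
    have p2 : 0 ≤ 20 * κ * ∫ r in Ioc (n*h) (n * h + h), a r := mul_nonneg pz (integral_nonneg a0)
    have p3 : 0 ≤ ∫ r in Ioc 0 (n * h), θ r := integral_nonneg θ0
    have p4 : 0 ≤ ∫ r in Ioc (n*h) (n * h + h), θ r := integral_nonneg θ0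
    rw [mul_add (20 * κ)]
    set A := 20 * κ * ∫ r in Ioc 0 (n * h), a r
    set δ := 20 * κ * ∫ r in Ioc (n*h) (n * h + h), a r
    set Θ := ∫ r in Ioc 0 (n * h), θ r
    set q := ∫ r in Ioc (n*h) (n * h + h), θ r
    have Zp : 0 ≤ Ξ + 16 * (1 + 2 * R) ^ 3 * h := pz
    set Z := Ξ + 16 * (1 + 2 * R) ^ 3 * h
    have m1 : 1 ≤ exp A := Real.one_le_exp p1
    have m2 : 1 + δ ≤ exp δ := by linarith [Real.add_one_le_exp δ]
    set Y := D0 + A * Z + Θ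
    have Yp : 0 ≤ Y := pz
    have st' : EE B x μ (cut R f) (n * h + h) ≤ exp A * Y * (1 + δ) + δ * Z + q := by
      refine st.trans (le_of_eq ?_); simp only [Z]; ring
    refine st'.trans ?_
    have k1 : δ * Z + q ≤ exp (A + δ) * (δ * Z + q) := by
      refine le_mul_of_one_le_left pz (Real.one_le_exp pz)
    have k2 : exp A * Y * (1 + δ) ≤ exp (A + δ) * Y := by
      rw [Real.exp_add]
      calc _ ≤ exp A * Y * exp δ := by gcongr
        _ = _ := by ring
    calc _ ≤ exp (A + δ) * Y + exp (A + δ) * (δ * Z + q) := lz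
      _ = _ := by simp only [Y]; ring
theorem stab (hT0 : 0 ≤ T) (hD : ∀ f, AR R 1 ww f → (∫ v, cut R f v ∂(x 0)) - ∫ v, cut R f v ∂(μ 0) ≤ D0)
    (hΞ : 0 ≤ Ξ) (ht : t ∈ Icc 0 T) (hf : AR R 1 ww f) :
    (∫ v, cut R f v ∂(x t)) - ∫ v, cut R f v ∂(μ t) ≤ exp (20 * κ * ∫ r in Ioc 0 T, a r) *
      (D0 + (20 * κ * ∫ r in Ioc 0 T, a r) * Ξ + ∫ r in Ioc 0 T, θ r) + Ξ := by
  have hκ := hK.one_le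
  have D00 : 0 ≤ D0 := by
    have := hD (fun _ => 0) ⟨fun v _ => by simp; linarith [ww_ge v], fun v u _ _ => by
      simp; have := ww_ge v; have := ww_ge u; positivity⟩
    simpa [cut] using this
  have q1 := (abs_le.1 (EE_eq hK hx hμ hR hM hsol zero_lt_one (AR_w3 zero_le_one hf) ht)).2
  suffices EE B x μ (cut R f) t ≤ exp (20 * κ * ∫ r in Ioc 0 T, a r) *
      (D0 + (20 * κ * ∫ r in Ioc 0 T, a r) * Ξ + ∫ r in Ioc 0 T, θ r) by linarith
  set A := 20 * κ * ∫ r in Ioc 0 T, a r with hA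
  set Θ := ∫ r in Ioc 0 T, θ r with hΘ
  have A0 : 0 ≤ A := mul_nonneg pz (integral_nonneg a0)
  rcases ht.1.eq_or_lt with h0 | h0
  · rw [← h0]
    have := hD f hf
    have e1 : EE B x μ (cut R f) 0 ≤ D0 := by simpa [EE] using this
    have : 0 ≤ Θ := integral_nonneg θ0
    refine e1.trans ?_
    have := Real.one_le_exp A0
    have : D0 ≤ D0 + A * Ξ + Θ := by have := mul_nonneg A0 hΞ; linarith
    nlinarith
  have lim : Tendsto (fun n : ℕ => exp A * (D0 + A * (Ξ + 16 * (1 + 2 * R) ^ 3 * (t / ((n:ℝ) + 1))) + Θ)) atTop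
      (nhds (exp A * (D0 + A * (Ξ + 16 * (1 + 2 * R) ^ 3 * 0) + Θ))) := by
    refine Tendsto.const_mul _ (Tendsto.add_const _ (Tendsto.const_add _ (Tendsto.const_mul _ (Tendsto.const_add _ (Tendsto.const_mul _ ?_)))))
    have := (tendsto_one_div_add_atTop_nhds_zero_nat (𝕜 := ℝ)).const_mul t
    simpa [div_eq_mul_inv] using this
  rw [mul_zero, add_zero] at lim
  refine ge_of_tendsto lim ?_
  filter_upwards [eventually_ge_atTop ⌈t * (4 * R + 2)⌉₊] with n hn
  have hn' : t * (4 * R + 2) ≤ n := (Nat.le_ceil _).trans (by exact_mod_cast hn)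
  have hh : t / ((n:ℝ) + 1) * (4 * R + 2) ≤ 1 := by
    rw [div_mul_eq_mul_div, div_le_one pz]; linarith
  have e : ((n + 1 : ℕ) : ℝ) * (t / ((n:ℝ) + 1)) = t := by push_cast; field_simp
  have := EE_iter hK hx hμ hR hM hsol a0 θ0 ai θi hτ hT0 hD hΞ (h := t / ((n:ℝ) + 1)) pz hh (n + 1) (by rw [e]; exact ht.2) f hf
  rw [e] at this
  refine this.trans ?_
  have s1 : 20 * κ * ∫ r in Ioc 0 t, a r ≤ A := by
    refine mul_le_mul_of_nonneg_left (setIntegral_mono_set ai (Eventually.of_forall a0) (Ioc_subset_Ioc_right ht.2).eventuallyLE) pz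
  have s2 : ∫ r in Ioc 0 t, θ r ≤ Θ :=
    setIntegral_mono_set θi (Eventually.of_forall θ0) (Ioc_subset_Ioc_right ht.2).eventuallyLE
  have s3 : 0 ≤ 20 * κ * ∫ r in Ioc 0 t, a r := mul_nonneg pz (integral_nonneg a0)
  have s4 : 0 ≤ ∫ r in Ioc 0 t, θ r := integral_nonneg θ0
  have : 0 ≤ t / ((n:ℝ) + 1) := pz
  gcongr
end
end
section
def Gv (c : ℝ) (g : Fn) (ν : Ms) : ℝ := min c (∫⁻ v, ofReal (g v) ∂ν).toReal
lemma Gv_eq (hg : BM c g) (g0 : ∀ v, 0 ≤ g v) (ν : Ms) [IsProbabilityMeasure ν] :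
    Gv c g ν = ∫ v, g v ∂ν := by
  unfold Gv
  rw [← integral_eq_lintegral_of_nonneg_ae (Eventually.of_forall g0) hg.meas.aestronglyMeasurable]
  exact min_eq_right ((le_abs_self _).trans (abs_int_le (Eventually.of_forall hg.bd)))
lemma Gv_meas (hg : BM c g) : Measurable (Gv c g) :=
  measurable_const.min (Measure.measurable_lintegral hg.meas.ennreal_ofReal).ennreal_toReal
lemma Gv_bd (hg : BM c g) (ν : Ms) : |Gv c g ν| ≤ c := by
  unfold Gv
  rw [abs_of_nonneg (le_min hg.nonneg ENNReal.toReal_nonneg)]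
  exact min_le_left _ _
lemma emp_int (x : Fin N → Ed) (g : Fn) :
    ∫ v, g v ∂((N : ℝ≥0∞)⁻¹ • ∑ i, dirac (x i)) = (N:ℝ)⁻¹ * ∑ i, g (x i) := by
  rw [integral_smul_measure, integral_finsetSum_measure (fun i _ => integrable_dirac (by simp))]
  simp
lemma upd (hν : ν ∈ empiricalSphere d N) (hg : BM c g)
    (g0 : ∀ v, 0 ≤ g v) : ∀ᵐ v ∂ν, ∀ᵐ vs ∂ν, v ≠ vs → ∀ σ,
      Gv c g (collUpdate N ν v vs σ) = Gv c g ν + (N:ℝ)⁻¹ * Df g v vs σ := by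
  obtain ⟨hS, x, hx⟩ := hν
  have := hS.1
  have hN : N ≠ 0 := by
    rintro rfl
    have := hS.1.measure_univ
    rw [hx] at this; simp at this
  have hat : ∀ᵐ v ∂ν, ∃ i, v = x i := by
    rw [ae_iff, hx]
    simp only [Measure.smul_apply, Measure.coe_finsetSum, Finset.sum_apply, smul_eq_mul, mul_eq_zero, Finset.sum_eq_zero_iff]
    right
    intro i _
    rw [Measure.dirac_apply' _ ?_]
    · simp
    · have : {a | ¬∃ i, a = x i} = (Set.range x)ᶜ := by ext a; simp [eq_comm]
      rw [this]; exact (Set.finite_range x).measurableSet.compl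
  filter_upwards [hat] with v ⟨i, hi⟩
  filter_upwards [hat] with vs ⟨j, hj⟩ hne σ
  have hij : i ≠ j := by rintro rfl; exact hne (hi.trans hj.symm)
  have hle : (N : ℝ≥0∞)⁻¹ • (dirac v + dirac vs) ≤ ν := by
    rw [hx, Measure.le_iff]
    intro s hs
    simp only [Measure.smul_apply, Measure.coe_finsetSum, Finset.sum_apply, smul_eq_mul, Measure.add_apply]
    gcongr
    rw [hi, hj, ← Finset.sum_pair (f := fun k => dirac (x k) s) hij]
    exact Finset.sum_le_sum_of_subset (Finset.subset_univ _)
  have hfin : IsFiniteMeasure ((N : ℝ≥0∞)⁻¹ • (dirac v + dirac vs)) := by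
    have : IsFiniteMeasure (dirac v + dirac vs) := inferInstance
    exact Measure.smul_finite _ (by simp [hN])
  have hle' : (N : ℝ≥0∞)⁻¹ • (dirac v + dirac vs) ≤ ν + (N : ℝ≥0∞)⁻¹ • (dirac (postV v vs σ) + dirac (postVs v vs σ)) :=
    hle.trans (Measure.le_add_right le_rfl)
  have hc : collUpdate N ν v vs σ + (N : ℝ≥0∞)⁻¹ • (dirac v + dirac vs) =
      ν + (N : ℝ≥0∞)⁻¹ • (dirac (postV v vs σ) + dirac (postVs v vs σ)) := by
    unfold collUpdate; exact Measure.sub_add_cancel_of_le hle'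
  have hNt : (N:ℝ≥0∞)⁻¹ ≠ ⊤ := by simp [hN]
  have hprob : IsProbabilityMeasure (collUpdate N ν v vs σ) := by
    constructor
    have h := congrArg (fun m => m Set.univ) hc
    simp only [Measure.add_apply, Measure.smul_apply, measure_univ, smul_eq_mul] at h
    exact (ENNReal.add_left_inj (ENNReal.mul_ne_top hNt (by simp))).1 h
  have h := congrArg (fun m => ∫⁻ v, ofReal (g v) ∂m) hc
  simp only [lintegral_add_measure, lintegral_smul_measure, lintegral_dirac' _ hg.meas.ennreal_ofReal, smul_eq_mul] at h
  rw [Gv_eq hg g0, Gv_eq hg g0]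
  rw [← ofReal_integral_eq_lintegral_ofReal (hg.int _) (Eventually.of_forall g0),
    ← ofReal_integral_eq_lintegral_ofReal (hg.int _) (Eventually.of_forall g0)] at h
  have h2 := congrArg ENNReal.toReal h
  have q : ∀ y, ofReal (g y) ≠ ⊤ := fun y => ofReal_ne_top
  rw [ENNReal.toReal_add ofReal_ne_top (ENNReal.mul_ne_top hNt (ENNReal.add_ne_top.2 ⟨q _, q _⟩)),
    ENNReal.toReal_add ofReal_ne_top (ENNReal.mul_ne_top hNt (ENNReal.add_ne_top.2 ⟨q _, q _⟩)),
    ENNReal.toReal_mul, ENNReal.toReal_mul, ENNReal.toReal_add (q _) (q _), ENNReal.toReal_add (q _) (q _)] at h2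
  simp only [toReal_ofReal (g0 _), toReal_ofReal (integral_nonneg g0), ENNReal.toReal_inv, ENNReal.toReal_natCast] at h2
  unfold Df
  linarith
def KG (K : Kernel (Ed) (Ed)) (f : Fn) (v vs : Ed) : ℝ :=
  ‖v - vs‖ * ∫ σ, (Df f v vs σ) ^ 2 ∂(K (v - vs))
def Gam (K : Kernel (Ed) (Ed)) (f : Fn) (ν : Ms) : ℝ := ∫ v, ∫ vs, KG K f v vs ∂ν ∂ν
section
variable (hK : GoodK B κ K)
include hK
lemma gen1 (hν : ν ∈ empiricalSphere d N) (hg : BM c g)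
    (g0 : ∀ v, 0 ≤ g v) : kacGen B N (Gv c g) ν = QInt B g ν ν := by
  have hN : (N:ℝ) ≠ 0 := by
    obtain ⟨hS, x, hx⟩ := hν
    intro h
    have h0 : N = 0 := by exact_mod_cast h
    subst h0
    have := hS.1.measure_univ
    rw [hx] at this; simp at this
  unfold kacGen QInt
  rw [← integral_const_mul]
  refine integral_congr_ae ?_
  filter_upwards [upd hν hg g0] with v hv
  rw [← integral_const_mul]
  refine integral_congr_ae ?_
  filter_upwards [hv] with vs hvs
  by_cases h : v = vs
  · rw [hK.eqB]; simp [h]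
  · have := hvs h
    rw [← integral_const_mul]
    refine integral_congr_ae (Eventually.of_forall fun σ => ?_)
    simp only [this, Df]
    field_simp
    ring
lemma Df2_bd (hc : ∀ v, |f v| ≤ c) (v vs σ : Ed) : |Df f v vs σ ^ 2| ≤ 16 * c ^ 2 := by
  rw [abs_pow]
  calc _ ≤ (4 * c) ^ 2 := by gcongr; exact Df_bd hc v vs σ
    _ = _ := by ring
lemma KG_bd (hc : ∀ v, |f v| ≤ c) (v vs : Ed) : |KG K f v vs| ≤ 16 * c ^ 2 * ‖v - vs‖ := by
  have := hK.markov
  unfold KG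
  rw [abs_mul, abs_norm, mul_comm]
  exact mul_le_mul_of_nonneg_right (abs_int_le (Eventually.of_forall fun σ => Df2_bd hK hc v vs σ)) (norm_nonneg _)
lemma meas_KG (hf : Measurable f) : Measurable (fun x : Ed × Ed => KG K f x.1 x.2) := by
  have := hK.markov
  unfold KG
  exact (mz : Measurable fun x : Ed × Ed => ‖x.1 - x.2‖).mul
    (meas_intK K (F := fun x => Df f x.1.1 x.1.2 x.2 ^ 2) ((meas_Df hf).pow_const 2))
lemma KG_int (hf : BM c f) {μ : Ms} (hμ : S2 μ) (hν : S2 ν) :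
    Integrable (fun x : Ed × Ed => KG K f x.1 x.2) (μ.prod ν) := by
  have := hμ.prob
  have := hν.prob
  refine int_prod_of_bd (meas_KG hK hf.meas) (hμ.int1.const_mul (16 * c ^ 2)) (hν.int1.const_mul (16 * c ^ 2)) fun v vs => ?_
  refine (KG_bd hK hf.bd v vs).trans ?_
  rw [← mul_add]; gcongr; exact norm_sub_le _ _
lemma gen2 (hν : ν ∈ empiricalSphere d N) (hg : BM c g)
    (g0 : ∀ v, 0 ≤ g v) : kacGen B N (fun ν => Gv c g ν ^ 2) ν = 2 * Gv c g ν * QInt B g ν ν + (N:ℝ)⁻¹ * Gam K g ν := by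
  have hS := S2_of_mem hν.1
  have := hS.prob
  have := hK.markov
  have hN : (N:ℝ) ≠ 0 := by
    obtain ⟨hS, x, hx⟩ := hν
    intro h
    have h0 : N = 0 := by exact_mod_cast h
    subst h0
    have := hS.1.measure_univ
    rw [hx] at this; simp at this
  have i1 := KK_int (K := K) hg.meas hg.bd hS hS
  have i2 := KG_int hK hg hS hS
  rw [QInt_eq hK]
  unfold kacGen Gam
  rw [← integral_const_mul, ← integral_const_mul, ← integral_const_mul,
    ← integral_add (i1.integral_prod_left.const_mul _) (i2.integral_prod_left.const_mul _)]
  refine integral_congr_ae ?_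
  filter_upwards [upd hν hg g0, i1.prod_right_ae, i2.prod_right_ae] with v hv j1 j2
  rw [← integral_const_mul, ← integral_const_mul, ← integral_const_mul,
    ← integral_add (j1.const_mul _) (j2.const_mul _)]
  refine integral_congr_ae ?_
  filter_upwards [hv] with vs hvs
  by_cases h : v = vs
  · rw [hK.eqB]; simp [h, KK, KG]
  · have hh := hvs h
    simp only [hh, hK.eqB, integral_smul_measure, toReal_ofReal (norm_nonneg _), smul_eq_mul, KK, KG]
    have m1 : Measurable (fun σ => Df g v vs σ) := meas_Df' hg.meas v vs
    have d1 : Integrable (fun σ => Df g v vs σ) (K (v - vs)) :=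
      Integrable.of_bound (C := 4 * c) m1.aestronglyMeasurable (Eventually.of_forall fun σ => Df_bd hg.bd v vs σ)
    have d2 : Integrable (fun σ => Df g v vs σ ^ 2) (K (v - vs)) :=
      Integrable.of_bound (C := 16 * c ^ 2) (m1.pow_const 2).aestronglyMeasurable (Eventually.of_forall fun σ => Df2_bd hK hg.bd v vs σ)
    have : ∀ σ, (Gv c g ν + (N:ℝ)⁻¹ * Df g v vs σ) ^ 2 - Gv c g ν ^ 2 = (2 * Gv c g ν * (N:ℝ)⁻¹) * Df g v vs σ + ((N:ℝ)⁻¹)^2 * Df g v vs σ ^ 2 := fun σ => by ring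
    simp only [this]
    rw [integral_add (d1.const_mul _) (d2.const_mul _), integral_const_mul, integral_const_mul]
    field_simp
end
end
section
lemma bint {X : Type*} [MeasurableSpace X] {μ : Measure X} [IsFiniteMeasure μ] {f : X → ℝ} (c : ℝ) (hf : Measurable f)
    (hc : ∀ x, |f x| ≤ c) : Integrable f μ := Integrable.of_bound (C := c) hf.aestronglyMeasurable (Eventually.of_forall hc)
lemma isub {X : Type*} [MeasurableSpace X] {μ : Measure X} {f g : X → ℝ} (hf : Integrable f μ) (hg : Integrable g μ) :
    Integrable (fun x => f x - g x) μ := hf.sub hg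
lemma tri {μ : Measure ℝ} [IsFiniteMeasure μ] [NullSingletonClass μ] {q : ℝ → ℝ} (hq : Measurable q) (hc : ∀ s, |q s| ≤ c) :
    2 * ∫ s, q s * ∫ r, (if s < r then q r else 0) ∂μ ∂μ = (∫ s, q s ∂μ) ^ 2 := by
  have c0 : 0 ≤ c := (abs_nonneg _).trans (hc 0)
  have iq : Integrable q μ := bint c hq hc
  let F : ℝ → ℝ → ℝ := fun s r => if s < r then q s * q r else 0
  have mF : Measurable (Function.uncurry F) := by
    refine Measurable.ite (measurableSet_lt measurable_fst measurable_snd) ?_ measurable_const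
    exact (hq.comp measurable_fst).mul (hq.comp measurable_snd)
  have bF : ∀ x, |Function.uncurry F x| ≤ c * c := by
    rintro ⟨s, r⟩
    simp only [Function.uncurry, F]
    split_ifs
    · rw [abs_mul]; have := hc s; have := hc r; gcongr
    · simp; positivity
  have iF : Integrable (Function.uncurry F) (μ.prod μ) := bint _ mF bF
  have e1 : ∫ s, q s * ∫ r, (if s < r then q r else 0) ∂μ ∂μ = ∫ s, ∫ r, F s r ∂μ ∂μ := by
    congr 1; ext s; rw [← integral_const_mul]; congr 1; ext r; simp only [F]; split_ifs <;> simp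
  have e2 : ∫ s, ∫ r, F s r ∂μ ∂μ = ∫ s, ∫ r, F r s ∂μ ∂μ := integral_integral_swap iF
  have iF' : Integrable (fun z : ℝ × ℝ => F z.2 z.1) (μ.prod μ) := iF.swap
  rw [e1, two_mul]
  nth_rw 2 [e2]
  have j1 : Integrable (fun s => ∫ r, F s r ∂μ) μ := iF.integral_prod_left
  have j2 : Integrable (fun s => ∫ r, F r s ∂μ) μ := iF'.integral_prod_left
  rw [← integral_add j1 j2, sq, ← integral_mul_const]
  refine integral_congr_ae (Eventually.of_forall fun s => ?_)
  have a1 : Integrable (fun r => F s r) μ := bint (c*c) (mF.comp measurable_prodMk_left) fun r => bF (s, r)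
  have a2 : Integrable (fun r => F r s) μ := bint (c*c) (mF.comp measurable_prodMk_right) fun r => bF (r, s)
  simp only [Function.uncurry]
  rw [← integral_add a1 a2, ← integral_const_mul]
  have : ∀ᵐ r ∂μ, r ≠ s := by
    rw [ae_iff]; simp
  refine integral_congr_ae ?_
  filter_upwards [this] with r hr
  simp only [F]
  rcases lt_or_gt_of_ne hr with h | h
  · rw [if_neg h.not_gt, if_pos h]; ring
  · rw [if_pos h, if_neg h.not_gt]; ring
section
variable {Ω : Type*} [m : MeasurableSpace Ω] {P : Measure Ω} [IsProbabilityMeasure P] {𝓕 : Filtration ℝ m}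
lemma mart_orth {M : ℝ → Ω → ℝ} (hM : Martingale M 𝓕 P) {A : Set Ω} (hA : MeasurableSet[𝓕 0] A) {s : ℝ} (hs : 0 ≤ s)
    (hst : s ≤ t) {ξ : Ω → ℝ} (hξ : Measurable[𝓕 s] ξ) (hc : ∀ ω, |ξ ω| ≤ c) :
    ∫ ω in A, ξ ω * (M t ω - M s ω) ∂P = 0 := by
  have hA' : MeasurableSet[𝓕 s] A := 𝓕.mono hs _ hA
  rw [← integral_indicator (𝓕.le 0 _ hA)]
  have e : (A.indicator fun ω => ξ ω * (M t ω - M s ω)) = (A.indicator ξ) * (M t - M s) := by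
    ext ω; by_cases h : ω ∈ A <;> simp [h]
  rw [e]
  have sm : StronglyMeasurable[𝓕 s] (A.indicator ξ) := hξ.stronglyMeasurable.indicator hA'
  have i1 : Integrable (M t - M s) P := (hM.integrable t).sub (hM.integrable s)
  have c0 : 0 ≤ c := (abs_nonneg _).trans (hc (Classical.choice (nonempty_of_isProbabilityMeasure P)))
  have i2 : Integrable ((A.indicator ξ) * (M t - M s)) P := by
    refine Integrable.bdd_mul (c := c) i1 (sm.mono (𝓕.le s)).aestronglyMeasurable (Eventually.of_forall fun ω => ?_)
    by_cases h : ω ∈ A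
    · simpa [h] using hc ω
    · simpa [h] using c0
  rw [← integral_condExp (𝓕.le s)]
  have h1 := condExp_mul_of_stronglyMeasurable_left sm i2 i1
  have h2 : P[M t - M s | 𝓕 s] =ᵐ[P] 0 := by
    have a := condExp_sub (hM.integrable t) (hM.integrable s) (𝓕 s)
    have b := hM.2 s t hst
    have c := hM.2 s s le_rfl
    filter_upwards [a, b, c] with ω a b c
    rw [a, Pi.sub_apply, b, c]; simp
  rw [integral_congr_ae h1]
  refine (integral_congr_ae (g := fun _ => (0:ℝ)) ?_).trans (by simp)
  filter_upwards [h2] with ω h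
  simp [h]
variable {G Q Γ : ℝ → Ω → ℝ} (mG : Measurable fun q : ℝ × Ω => G q.1 q.2) (mQ : Measurable fun q : ℝ × Ω => Q q.1 q.2)
  (mΓ : Measurable fun q : ℝ × Ω => Γ q.1 q.2)
  (aG : ∀ s, Measurable[𝓕 s] (G s)) (aQ : ∀ s, Measurable[𝓕 s] (Q s))
  (bG : ∀ s ω, |G s ω| ≤ c) (bQ : ∀ s ω, |Q s ω| ≤ c) (bΓ : ∀ s ω, |Γ s ω| ≤ c)
  (hM1 : Martingale (fun t ω => G t ω - ∫ s in Ioc 0 t, Q s ω) 𝓕 P)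
  (hM2 : Martingale (fun t ω => G t ω ^ 2 - ∫ s in Ioc 0 t, (2 * G s ω * Q s ω + Γ s ω)) 𝓕 P)
include mG mQ mΓ aG aQ bG bQ bΓ hM1 hM2
lemma mart_var {A : Set Ω} (hA : MeasurableSet[𝓕 0] A) (hT : 0 ≤ T) :
    ∫ ω in A, (G T ω - G 0 ω - ∫ s in Ioc 0 T, Q s ω) ^ 2 ∂P = ∫ ω in A, (∫ s in Ioc 0 T, Γ s ω) ∂P := by
  have c0 : 0 ≤ c := (abs_nonneg _).trans (bG 0 (Classical.choice (nonempty_of_isProbabilityMeasure P)))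
  set τ : Measure ℝ := volume.restrict (Ioc 0 T) with hτ
  have τT : τ.real Set.univ = T := by simp [hτ, Measure.real, hT]
  have gm : ∀ s, Measurable (G s) := fun s => (aG s).mono (𝓕.le s) le_rfl
  have pm : ∀ {H : ℝ → Ω → ℝ}, (Measurable fun q : ℝ × Ω => H q.1 q.2) → Measurable fun ω => ∫ s, H s ω ∂τ := fun {H} hH =>
    (StronglyMeasurable.integral_prod_left (μ := τ) (f := H) hH.stronglyMeasurable).measurable
  have pb : ∀ {H : ℝ → Ω → ℝ} {b : ℝ}, (∀ s ω, |H s ω| ≤ b) → ∀ ω, |∫ s, H s ω ∂τ| ≤ b * T := fun {H b} hb ω => by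
    have := norm_integral_le_of_norm_le_const (μ := τ) (f := fun s => H s ω) (C := b) (Eventually.of_forall fun s => hb s ω)
    rwa [τT] at this
  have bGQ : ∀ s ω, |G s ω * Q s ω| ≤ c * c := fun s ω => by
    rw [abs_mul]; have := bG s ω; have := bQ s ω; gcongr
  let I : Ω → ℝ := fun ω => ∫ s, Q s ω ∂τ
  let Y : Ω → ℝ := fun ω => ∫ s, G s ω * Q s ω ∂τ
  let Z : Ω → ℝ := fun ω => ∫ s, Γ s ω ∂τ
  have mI : Measurable I := pm mQ
  have mY : Measurable Y := pm (H := fun s ω => G s ω * Q s ω) (mG.mul mQ)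
  have mZ : Measurable Z := pm mΓ
  have bI : ∀ ω, |I ω| ≤ c * T := pb bQ
  have bY : ∀ ω, |Y ω| ≤ c * c * T := pb bGQ
  have bZ : ∀ ω, |Z ω| ≤ c * T := pb bΓ
  have iI : Integrable I (P.restrict A) := bint _ mI bI
  have iY : Integrable Y (P.restrict A) := bint _ mY bY
  have iZ : Integrable Z (P.restrict A) := bint _ mZ bZ
  have mulb : ∀ {f g : Ω → ℝ} {a b : ℝ}, (∀ ω, |f ω| ≤ a) → (∀ ω, |g ω| ≤ b) → ∀ ω, |f ω * g ω| ≤ a * b := by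
    intro f g a b hf hg ω
    rw [abs_mul]
    exact mul_le_mul (hf ω) (hg ω) (abs_nonneg _) ((abs_nonneg _).trans (hf ω))
  have iprod : ∀ {f g : Ω → ℝ} {a b : ℝ}, Measurable f → Measurable g → (∀ ω, |f ω| ≤ a) → (∀ ω, |g ω| ≤ b) →
      Integrable (fun ω => f ω * g ω) (P.restrict A) := fun {f g a b} hf hg ha hb => bint (a * b) (hf.mul hg) (mulb ha hb)
  have iGG := iprod (gm T) (gm T) (bG T) (bG T)
  have iG00 := iprod (gm 0) (gm 0) (bG 0) (bG 0)
  have iG0T := iprod (gm 0) (gm T) (bG 0) (bG T)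
  have iGI := iprod (gm T) mI (bG T) bI
  have iG0I := iprod (gm 0) mI (bG 0) bI
  have iII := iprod mI mI bI bI
  have τ0 : ∀ f : ℝ → ℝ, ∫ s in Ioc (0:ℝ) 0, f s = 0 := fun f => by simp
  have h1 : (∫ ω in A, G T ω * G T ω ∂P) - (∫ ω in A, G 0 ω * G 0 ω ∂P) - 2 * (∫ ω in A, Y ω ∂P) - ∫ ω in A, Z ω ∂P = 0 := by
    have := mart_orth hM2 hA le_rfl hT (ξ := fun _ => 1) measurable_const (c := 1) (by simp)
    rw [← integral_const_mul, ← integral_sub iGG iG00, ← integral_sub (isub iGG iG00) (iY.const_mul 2),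
      ← integral_sub (isub (isub iGG iG00) (iY.const_mul 2)) iZ]
    refine Eq.trans ?_ this
    refine integral_congr_ae (Eventually.of_forall fun ω => ?_)
    simp only [τ0]
    have : ∫ s in Ioc 0 T, (2 * G s ω * Q s ω + Γ s ω) = 2 * Y ω + Z ω := by
      have k1 : Integrable (fun s => Γ s ω) τ := bint c (mΓ.comp (g := fun q : ℝ × Ω => Γ q.1 q.2) measurable_prodMk_right) fun s => bΓ s ω
      have k2 : Integrable (fun s => G s ω * Q s ω) τ := bint (c*c) ((mG.mul mQ).comp (g := fun q : ℝ × Ω => G q.1 q.2 * Q q.1 q.2) measurable_prodMk_right) fun s => bGQ s ω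
      rw [← integral_const_mul, ← integral_add (k2.const_mul 2) k1]
      simp only [mul_assoc]; rfl
    rw [this]; ring
  have h2 : (∫ ω in A, G 0 ω * G T ω ∂P) - (∫ ω in A, G 0 ω * G 0 ω ∂P) - (∫ ω in A, G 0 ω * I ω ∂P) = 0 := by
    have := mart_orth hM1 hA le_rfl hT (aG 0) (bG 0)
    rw [← integral_sub iG0T iG00, ← integral_sub (isub iG0T iG00) iG0I]
    refine Eq.trans ?_ this
    refine integral_congr_ae (Eventually.of_forall fun ω => ?_)
    simp only [τ0]
    show _ = G 0 ω * ((G T ω - I ω) - (G 0 ω - 0))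
    ring
  let J : ℝ → Ω → ℝ := fun s ω => ∫ r, (if s < r then Q r ω else 0) ∂τ
  have mJ : Measurable fun q : ℝ × Ω => J q.1 q.2 := by
    refine (StronglyMeasurable.integral_prod_right (ν := τ) (f := fun (q : ℝ × Ω) r => if q.1 < r then Q r q.2 else 0) ?_).measurable
    refine (Measurable.ite (measurableSet_lt mz mz) ?_ measurable_const).stronglyMeasurable
    exact mQ.comp (g := fun q : ℝ × Ω => Q q.1 q.2) (f := fun x : (ℝ × Ω) × ℝ => (x.2, x.1.2)) mz
  have bJ : ∀ s ω, |J s ω| ≤ c * T := fun s ω => by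
    refine pb (H := fun r ω => if s < r then Q r ω else 0) (fun r ω => ?_) ω
    split_ifs
    · exact bQ r ω
    · simpa using c0
  have h3 : ∀ s ∈ Ioc 0 T, ∫ ω in A, Q s ω * (G T ω - G s ω - J s ω) ∂P = 0 := by
    intro s hs
    rw [← mart_orth hM1 hA hs.1.le hs.2 (aQ s) (bQ s)]
    refine integral_congr_ae (Eventually.of_forall fun ω => ?_)
    have iq : ∀ t, IntegrableOn (fun r => Q r ω) (Ioc 0 t) := fun t => bint c (mQ.comp measurable_prodMk_right) fun s => bQ s ω
    have e : J s ω = (∫ r in Ioc 0 T, Q r ω) - ∫ r in Ioc 0 s, Q r ω := by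
      rw [← Ioc_union_Ioc_eq_Ioc hs.1.le hs.2, setIntegral_union (by
        rw [Set.disjoint_left]; rintro r ⟨_, h⟩ ⟨h', _⟩; linarith) measurableSet_Ioc (iq s) ((iq T).mono_set (Set.Ioc_subset_Ioc_left hs.1.le))]
      rw [add_sub_cancel_left]
      have : ∀ r, (if s < r then Q r ω else 0) = (Set.Ioi s).indicator (fun r => Q r ω) r := fun r => by
        simp [Set.indicator]
      simp only [J, this]
      rw [integral_indicator measurableSet_Ioi, hτ, Measure.restrict_restrict measurableSet_Ioi]
      congr 2
      ext r; simp only [Set.mem_inter_iff, Set.mem_Ioi, Set.mem_Ioc]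
      constructor
      · rintro ⟨a, b, c⟩; exact ⟨a, c⟩
      · rintro ⟨a, c⟩; exact ⟨a, hs.1.trans a, c⟩
    simp only [e]; ring
  have h4 : (∫ ω in A, G T ω * I ω ∂P) - (∫ ω in A, Y ω ∂P) - 2⁻¹ * ∫ ω in A, I ω * I ω ∂P = 0 := by
    have sw := integral_integral_swap (μ := τ) (ν := P.restrict A) (f := fun s ω => Q s ω * (G T ω - G s ω - J s ω)) (by
      refine bint (c * (c + c + c * T)) (mQ.mul (((gm T).comp measurable_snd).sub mG |>.sub mJ)) ?_
      rintro ⟨s, ω⟩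
      simp only [Function.uncurry]
      rw [abs_mul]
      have := bQ s ω; have := bG s ω; have := bG T ω; have := bJ s ω
      gcongr
      exact (abs_sub _ _).trans (add_le_add ((abs_sub _ _).trans (by gcongr)) (by assumption)))
    rw [integral_congr_ae (g := fun _ => (0:ℝ)) (by
      filter_upwards [ae_restrict_mem measurableSet_Ioc] with s hs using h3 s hs)] at sw
    rw [integral_zero] at sw
    rw [sw, ← integral_const_mul, ← integral_sub iGI iY, ← integral_sub (isub iGI iY) (iII.const_mul _)]
    refine integral_congr_ae (Eventually.of_forall fun ω => ?_)
    simp only [Pi.sub_apply]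
    have mq : Measurable fun s => Q s ω := mQ.comp (g := fun q : ℝ × Ω => Q q.1 q.2) measurable_prodMk_right
    have mg : Measurable fun s => G s ω := mG.comp (g := fun q : ℝ × Ω => G q.1 q.2) measurable_prodMk_right
    have mj : Measurable fun s => J s ω := mJ.comp (g := fun q : ℝ × Ω => J q.1 q.2) measurable_prodMk_right
    have tr := tri (μ := τ) mq (fun s => bQ s ω)
    have i1 : Integrable (fun s => G T ω * Q s ω) τ := (bint c mq fun s => bQ s ω).const_mul _
    have i2 : Integrable (fun s => G s ω * Q s ω) τ := bint (c*c) (mg.mul mq) fun s => bGQ s ω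
    have i3 : Integrable (fun s => Q s ω * J s ω) τ := bint (c*(c*T)) (mq.mul mj) fun s => by
      rw [abs_mul]; have := bQ s ω; have := bJ s ω; gcongr
    have : ∫ s, Q s ω * (G T ω - G s ω - J s ω) ∂τ = G T ω * I ω - Y ω - ∫ s, Q s ω * J s ω ∂τ := by
      rw [← integral_const_mul, ← integral_sub i1 i2, ← integral_sub (isub i1 i2) i3]
      refine integral_congr_ae (Eventually.of_forall fun s => ?_)
      simp only [Pi.sub_apply]; ring
    rw [this]
    simp only [I, J] at tr ⊢
    linarith
  have e : ∀ ω, (G T ω - G 0 ω - ∫ s in Ioc 0 T, Q s ω) ^ 2 = G T ω * G T ω - G 0 ω * G 0 ω - 2 * (G 0 ω * G T ω - G 0 ω * G 0 ω - G 0 ω * I ω)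
      - 2 * (G T ω * I ω) + I ω * I ω := fun ω => by
    show (G T ω - G 0 ω - I ω)^2 = _
    ring
  refine (integral_congr_ae (Eventually.of_forall e)).trans ?_
  rw [integral_add (isub (isub (isub iGG iG00) ((isub (isub iG0T iG00) iG0I).const_mul 2)) (iGI.const_mul 2)) iII,
    integral_sub (isub (isub iGG iG00) ((isub (isub iG0T iG00) iG0I).const_mul 2)) (iGI.const_mul 2),
    integral_sub (isub iGG iG00) ((isub (isub iG0T iG00) iG0I).const_mul 2), integral_const_mul, integral_const_mul]
  have s1 : ∫ ω in A, (G 0 ω * G T ω - G 0 ω * G 0 ω - G 0 ω * I ω) ∂P = 0 := by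
    rw [integral_sub (isub iG0T iG00) iG0I, integral_sub iG0T iG00]
    exact h2
  have s2 : ∫ ω in A, (G T ω * G T ω - G 0 ω * G 0 ω) ∂P = (∫ ω in A, G T ω * G T ω ∂P) - (∫ ω in A, G 0 ω * G 0 ω ∂P) := integral_sub iGG iG00
  rw [s1, s2]
  linarith
end
end
section
def dyad {Ω : Type*} (Z : ℝ → Ω → ℝ) (T lam : ℝ) (n : ℕ) : Set Ω :=
  {ω | ∃ i ∈ range (2 ^ n + 1), lam ≤ Z (T * i / 2 ^ n) ω}
section
variable {Ω : Type*} [m : MeasurableSpace Ω] {P : Measure Ω} [IsProbabilityMeasure P] {𝓕 : Filtration ℝ m}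
lemma dyad_meas {Z : ℝ → Ω → ℝ} (hT : 0 ≤ T) (ad : ∀ t, 0 ≤ t → Measurable[𝓕 t] (Z t)) (n : ℕ) :
    MeasurableSet (dyad Z T lam n) := by
  have : dyad Z T lam n = ⋃ i ∈ range (2 ^ n + 1), {ω | lam ≤ Z (T * i / 2 ^ n) ω} := by
    ext ω; simp [dyad]
  rw [this]
  refine Finset.measurableSet_biUnion _ fun i _ => ?_
  exact measurableSet_le measurable_const ((ad _ pz).mono (𝓕.le _) le_rfl)
lemma doob {Z : ℝ → Ω → ℝ} (hT : 0 ≤ T) (Z0 : ∀ t ω, 0 ≤ Z t ω) (ad : ∀ t, 0 ≤ t → Measurable[𝓕 t] (Z t))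
    (ig : ∀ t, 0 ≤ t → Integrable (Z t) P)
    (sub : ∀ s t, 0 ≤ s → s ≤ t → ∀ E, MeasurableSet[𝓕 s] E → ∫ ω in E, Z s ω ∂P ≤ ∫ ω in E, Z t ω ∂P)
    {A : Set Ω} (hA : MeasurableSet[𝓕 0] A) (hl : 0 < lam) :
    P (A ∩ ⋃ n, dyad Z T lam n) ≤ ofReal (lam⁻¹ * ∫ ω in A, Z T ω ∂P) := by
  have hA' : MeasurableSet A := 𝓕.le 0 _ hA
  rw [Set.inter_comm, ← Measure.restrict_apply (MeasurableSet.iUnion fun n => dyad_meas hT ad n)]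
  have mono : Monotone (dyad Z T lam) := by
    refine monotone_nat_of_le_succ fun n ω => ?_
    rintro ⟨i, hi, h⟩
    refine ⟨2 * i, ?_, ?_⟩
    · simp only [mem_range] at hi ⊢; rw [pow_succ]; omega
    · convert h using 2; push_cast; rw [pow_succ]; field_simp
  rw [mono.measure_iUnion]
  refine iSup_le fun n => ?_
  let ι : ℕ → ℝ := fun i => T * i / 2 ^ n
  have ι0 : ∀ i, 0 ≤ ι i := fun i => by simp only [ι]; positivity
  have ιm : Monotone ι := fun i j hij => by
    have : (i:ℝ) ≤ j := by exact_mod_cast hij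
    simp only [ι]; gcongr
  let 𝒢 : Filtration ℕ m := ⟨fun i => 𝓕 (ι i), fun i j h => 𝓕.mono (ιm h), fun i => 𝓕.le _⟩
  have hs : Submartingale (fun i => Z (ι i)) 𝒢 (P.restrict A) := by
    refine submartingale_of_setIntegral_le_succ (fun i => (ad _ (ι0 i)).stronglyMeasurable) (fun i => (ig _ (ι0 i)).restrict) fun i s hs => ?_
    have hs' : MeasurableSet[𝓕 (ι i)] s := hs
    rw [Measure.restrict_restrict (𝓕.le _ _ hs')]
    exact sub _ _ (ι0 i) (ιm (Nat.le_succ i)) _ (hs'.inter (𝓕.mono (ι0 i) _ hA))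
  have mx := maximal_ineq hs (fun i ω => Z0 _ ω) (ε := lam.toNNReal) (2 ^ n)
  simp only [Real.coe_toNNReal _ hl.le] at mx
  have e : {ω | lam ≤ (range (2 ^ n + 1)).sup' Finset.nonempty_range_add_one fun k => Z (ι k) ω} = dyad Z T lam n := by
    ext ω; simp only [Set.mem_setOf_eq, Finset.le_sup'_iff, dyad, ι]
  rw [e] at mx
  have ιT : ι (2 ^ n) = T := by simp only [ι]; push_cast; field_simp
  rw [ιT] at mx
  have : ∫ ω in dyad Z T lam n, Z T ω ∂P.restrict A ≤ ∫ ω in A, Z T ω ∂P :=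
    setIntegral_le_integral (ig T hT).restrict (Eventually.of_forall fun ω => Z0 T ω)
  have mx2 := mx.trans (ofReal_le_ofReal this)
  rw [ENNReal.ofReal_mul pz, ENNReal.ofReal_inv_of_pos hl]
  rw [mul_comm, ← div_eq_mul_inv, ENNReal.le_div_iff_mul_le (Or.inl (by simpa using hl)) (Or.inl ofReal_ne_top), mul_comm]
  exact mx2
lemma mart_abs_sub {M : ℝ → Ω → ℝ} (hM : Martingale M 𝓕 P) {M0 : Ω → ℝ} (h0 : Measurable[𝓕 0] M0) (i0 : Integrable M0 P)
    {s : ℝ} (hs : 0 ≤ s)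
    (hst : s ≤ t) {E : Set Ω} (hE : MeasurableSet[𝓕 s] E) :
    ∫ ω in E, |M s ω - M0 ω| ∂P ≤ ∫ ω in E, |M t ω - M0 ω| ∂P := by
  have ms : Measurable[𝓕 s] fun ω => M s ω - M0 ω := (hM.1 s).measurable.sub (h0.mono (𝓕.mono hs) le_rfl)
  let ξ : Ω → ℝ := fun ω => if 0 ≤ M s ω - M0 ω then 1 else -1
  have mξ : Measurable[𝓕 s] ξ := Measurable.ite (ms measurableSet_Ici : MeasurableSet[𝓕 s] {ω | 0 ≤ M s ω - M0 ω}) measurable_const measurable_const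
  have bξ : ∀ ω, |ξ ω| ≤ 1 := fun ω => by simp only [ξ]; split_ifs <;> simp
  have o := mart_orth hM (A := Set.univ) MeasurableSet.univ hs hst (ξ := E.indicator ξ) (mξ.indicator hE) (c := 1) (fun ω => by
    by_cases h : ω ∈ E <;> simp [h, bξ])
  have e : ∀ ω, E.indicator ξ ω * (M t ω - M s ω) = E.indicator (fun ω => ξ ω * (M t ω - M s ω)) ω := fun ω => by
    by_cases h : ω ∈ E <;> simp [h]
  simp only [e, Measure.restrict_univ] at o
  have hE' := 𝓕.le s _ hE
  rw [integral_indicator hE'] at o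
  have is : Integrable (fun ω => M s ω - M0 ω) (P.restrict E) := ((hM.integrable s).sub i0).restrict
  have it : Integrable (fun ω => M t ω - M0 ω) (P.restrict E) := ((hM.integrable t).sub i0).restrict
  have mξ' : AEStronglyMeasurable ξ (P.restrict E) := (mξ.mono (𝓕.le s) le_rfl).aestronglyMeasurable
  have i1 : Integrable (fun ω => ξ ω * (M s ω - M0 ω)) (P.restrict E) := Integrable.bdd_mul (c := 1) is mξ' (Eventually.of_forall bξ)
  have i2 : Integrable (fun ω => ξ ω * (M t ω - M0 ω)) (P.restrict E) := Integrable.bdd_mul (c := 1) it mξ' (Eventually.of_forall bξ)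
  have e1 : ∫ ω in E, |M s ω - M0 ω| ∂P = ∫ ω in E, ξ ω * (M s ω - M0 ω) ∂P := by
    refine integral_congr_ae (Eventually.of_forall fun ω => ?_)
    simp only [ξ]; split_ifs with h
    · simp [abs_of_nonneg h]
    · rw [abs_of_nonpos lz]; ring
  have e2 : ∫ ω in E, ξ ω * (M t ω - M0 ω) ∂P = ∫ ω in E, ξ ω * (M s ω - M0 ω) ∂P := by
    rw [← sub_eq_zero, ← integral_sub i2 i1]
    refine Eq.trans (integral_congr_ae (Eventually.of_forall fun ω => ?_)) o
    simp only; ring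
  rw [e1, ← e2]
  refine integral_mono i2 it.abs fun ω => ?_
  refine (le_abs_self _).trans ?_
  rw [abs_mul]
  exact mul_le_of_le_one_left (abs_nonneg _) (bξ ω)
end
lemma meas_sumabs {X : Type*} [MeasurableSpace X] {ι : Type*} (s : Finset ι) (c : ι → ℝ) {f : ι → X → ℝ} (hf : ∀ i, Measurable (f i)) :
    Measurable (fun x => ∑ i ∈ s, c i * |f i x|) := measurable_fun_sum _ fun i _ => (hf i).abs.const_mul _
lemma meas_Qf (hK : GoodK B κ K) {X : Type*} [MeasurableSpace X]
    {f : X → Ms} (hf : Measurable f) (h2 : ∀ x, S2 (f x)) (hg : Measurable g) :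
    Measurable (fun x => QInt B g (f x) (f x)) := by
  let k : Kernel X (Ed) := ⟨f, hf⟩
  have : IsMarkovKernel k := ⟨fun q => (h2 q).prob⟩
  exact meas_QInt hK k hg
section
variable (hK : GoodK B κ K)
variable {Ω : Type*} [m : MeasurableSpace Ω] {P : Measure Ω} [IsProbabilityMeasure P] {𝓕 : Filtration ℝ m}
  {μp : ℝ → Ω → Measure (Vd d)} (hk : IsKacProcess B N P 𝓕 μp)
include hk
lemma kac_S2 (s : ℝ) (ω : Ω) : S2 (μp s ω) := S2_of_mem (hk.mem s ω).1
lemma kac_path (ω : Ω) : Path (fun s => μp s ω) := ⟨(path_meas2 hk).comp (measurable_id.prodMk measurable_const), fun s => kac_S2 hk s ω⟩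
include hK
lemma kac_M (hg : BM c g) (g0 : ∀ v, 0 ≤ g v) :
    Martingale (fun t ω => Gv c g (μp t ω) - ∫ s in Ioc 0 t, QInt B g (μp s ω) (μp s ω)) 𝓕 P := by
  have := hk.martingale (Gv c g) (Gv_meas hg) ⟨c, Gv_bd hg⟩
  simp only [gen1 hK (hk.mem _ _) hg g0] at this
  exact this
lemma kac_M2 (hg : BM c g) (g0 : ∀ v, 0 ≤ g v) :
    Martingale (fun t ω => Gv c g (μp t ω) ^ 2 - ∫ s in Ioc 0 t, (2 * Gv c g (μp s ω) * QInt B g (μp s ω) (μp s ω) +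
      (N:ℝ)⁻¹ * Gam K g (μp s ω))) 𝓕 P := by
  have := hk.martingale (fun ν => Gv c g ν ^ 2) ((Gv_meas hg).pow_const 2) ⟨c ^ 2, fun ν => by
    rw [abs_pow]; have := Gv_bd hg ν; gcongr⟩
  simp only [gen2 hK (hk.mem _ _) hg g0] at this
  exact this
lemma kac_measQ (hg : Measurable g) : Measurable (fun q : ℝ × Ω => QInt B g (μp q.1 q.2) (μp q.1 q.2)) := by
  let k : Kernel (ℝ × Ω) (Ed) := ⟨_, path_meas2 hk⟩
  have : IsMarkovKernel k := ⟨fun q => (kac_S2 hk q.1 q.2).prob⟩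
  exact meas_QInt hK k hg
lemma kac_measF {F : Ed × Ed → ℝ} (hF : Measurable F) : Measurable (fun q : ℝ × Ω => ∫ v, ∫ vs, F (v, vs) ∂(μp q.1 q.2) ∂(μp q.1 q.2)) := by
  let k : Kernel (ℝ × Ω) (Ed) := ⟨_, path_meas2 hk⟩
  have : IsMarkovKernel k := ⟨fun q => (kac_S2 hk q.1 q.2).prob⟩
  exact meas_QQ k hF
lemma kac_measG (hg : Measurable g) : Measurable (fun q : ℝ × Ω => Gam K g (μp q.1 q.2)) :=
  kac_measF hK hk (meas_KG hK hg)
lemma kac_adQ (hg : Measurable g) (s : ℝ) : Measurable[𝓕 s] (fun ω => QInt B g (μp s ω) (μp s ω)) :=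
  @meas_Qf _ _ _ _ _ hK Ω (𝓕 s) _ (path_meas hk s) (kac_S2 hk s) hg
lemma Gam_bd (hg : BM c g) (hν : S2 ν) : |Gam K g ν| ≤ 32 * c ^ 2 := by
  have := hν.prob
  have i := KG_int hK hg hν hν
  have e : Gam K g ν = ∫ x, KG K g x.1 x.2 ∂(ν.prod ν) := (integral_prod _ i).symm
  rw [e]
  refine (abs_integral_le_integral_abs).trans ?_
  have j : Integrable (fun x : Ed × Ed => ‖x.1‖ + ‖x.2‖) (ν.prod ν) := (hν.int1.comp_fst ν).add (hν.int1.comp_snd ν)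
  have : ∫ x, |KG K g x.1 x.2| ∂(ν.prod ν) ≤ ∫ x, 16 * c ^ 2 * (‖x.1‖ + ‖x.2‖) ∂(ν.prod ν) := by
    refine integral_mono i.abs (j.const_mul _) fun x => (KG_bd hK hg.bd x.1 x.2).trans ?_
    have := norm_sub_le x.1 x.2; gcongr
  refine this.trans ?_
  rw [integral_const_mul, integral_add (hν.int1.comp_fst ν) (hν.int1.comp_snd ν)]
  have h1 : ∫ x : Ed × Ed, ‖x.1‖ ∂(ν.prod ν) = ∫ v, ‖v‖ ∂ν := by simpa using integral_fun_fst (μ := ν) (ν := ν) (fun v : Ed => ‖v‖)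
  have h2 : ∫ x : Ed × Ed, ‖x.2‖ ∂(ν.prod ν) = ∫ v, ‖v‖ ∂ν := by simpa using integral_fun_snd (μ := ν) (ν := ν) (fun v : Ed => ‖v‖)
  rw [h1, h2]
  nlinarith [hν.m1, sq_nonneg c]
lemma kac_Mt (hg : BM c g) (g0 : ∀ v, 0 ≤ g v) (t : ℝ) (ω : Ω) :
    Mt B (fun s => μp s ω) g t = Gv c g (μp t ω) - Gv c g (μp 0 ω) - ∫ s in Ioc 0 t, QInt B g (μp s ω) (μp s ω) := by
  have := (kac_S2 hk t ω).prob
  have := (kac_S2 hk 0 ω).prob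
  rw [Gv_eq hg g0, Gv_eq hg g0]; rfl
lemma kac_var (hg : BM c g) (g0 : ∀ v, 0 ≤ g v) {A : Set Ω} (hA : MeasurableSet[𝓕 0] A) (hT : 0 ≤ T) :
    ∫ ω in A, (Mt B (fun s => μp s ω) g T) ^ 2 ∂P = ∫ ω in A, (∫ s in Ioc 0 T, (N:ℝ)⁻¹ * Gam K g (μp s ω)) ∂P := by
  simp only [kac_Mt hK hk hg g0]
  have c0 := hg.nonneg
  have h1 : 0 ≤ (N:ℝ)⁻¹ * (32 * c ^ 2) := pz
  refine mart_var (c := c + 8 * c + (N:ℝ)⁻¹ * (32 * c ^ 2)) (G := fun s ω => Gv c g (μp s ω)) (Q := fun s ω => QInt B g (μp s ω) (μp s ω))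
    (Γ := fun s ω => (N:ℝ)⁻¹ * Gam K g (μp s ω)) ((Gv_meas hg).comp (path_meas2 hk)) (kac_measQ hK hk hg.meas)
    ((kac_measG hK hk hg.meas).const_mul _) (fun s => (Gv_meas hg).comp (path_meas hk s)) (kac_adQ hK hk hg.meas)
    (fun s ω => (Gv_bd hg _).trans lz) (fun s ω => (QInt_bd hK hg.meas hg.bd (kac_S2 hk s ω) (kac_S2 hk s ω)).trans lz)
    (fun s ω => ?_) (kac_M hK hk hg g0) (kac_M2 hK hk hg g0) hA hT
  rw [abs_mul, abs_of_nonneg (pz : 0 ≤ (N:ℝ)⁻¹)]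
  have := Gam_bd hK hk hg (kac_S2 hk s ω)
  have := mul_le_mul_of_nonneg_left this (pz : 0 ≤ (N:ℝ)⁻¹)
  linarith
lemma Mt_bd (hg : BM c g) (t : ℝ) (ht : 0 ≤ t) (ω : Ω) :
    |Mt B (fun s => μp s ω) g t| ≤ 2 * c + 8 * c * t := by
  have := (kac_S2 hk t ω).prob
  have := (kac_S2 hk 0 ω).prob
  have a1 := abs_int_le (μ := μp t ω) (Eventually.of_forall hg.bd)
  have a2 := abs_int_le (μ := μp 0 ω) (Eventually.of_forall hg.bd)
  have a3 : |∫ s in Ioc 0 t, QInt B g (μp s ω) (μp s ω)| ≤ 8 * c * t := by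
    have := norm_setIntegral_le_of_norm_le_const (μ := volume) (s := Ioc 0 t) (f := fun s => QInt B g (μp s ω) (μp s ω)) (C := 8 * c)
      (by simp) (fun s _ => QInt_bd hK hg.meas hg.bd (kac_S2 hk s ω) (kac_S2 hk s ω))
    simpa [Measure.real, ht] using this
  unfold Mt
  rw [abs_le] at *
  constructor <;> linarith [a1.1, a1.2, a2.1, a2.2, a3.1, a3.2]
lemma kac_adM (hg : BM c g) (g0 : ∀ v, 0 ≤ g v) (t : ℝ) (ht : 0 ≤ t) :
    Measurable[𝓕 t] (fun ω => Mt B (fun s => μp s ω) g t) := by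
  simp only [kac_Mt hK hk hg g0]
  have := ((kac_M hK hk hg g0).1 t).measurable
  have h2 : Measurable[𝓕 t] fun ω => Gv c g (μp 0 ω) := ((Gv_meas hg).comp (path_meas hk 0)).mono (𝓕.mono ht) le_rfl
  convert this.sub h2 using 2
  simp only [Pi.sub_apply]; ring
lemma kac_doob {ι : Type*} (s : Finset ι) {c : ι → ℝ} (c0 : ∀ i, 0 ≤ c i) {g : ι → Ed → ℝ} (hg : ∀ i, BM b (g i)) (g0 : ∀ i v, 0 ≤ g i v)
    {A : Set Ω} (hA : MeasurableSet[𝓕 0] A) (hT : 0 ≤ T) (hl : 0 < lam) :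
    P (A ∩ ⋃ n, dyad (fun t ω => ∑ i ∈ s, c i * |Mt B (fun s => μp s ω) (g i) t|) T lam n) ≤
      ofReal (lam⁻¹ * ∑ i ∈ s, c i * √((N:ℝ)⁻¹ * ∫ ω in A, (∫ s in Ioc 0 T, Gam K (g i) (μp s ω)) ∂P)) := by
  have mM : ∀ i t, 0 ≤ t → Measurable[𝓕 t] (fun ω => Mt B (fun s => μp s ω) (g i) t) := fun i t ht => kac_adM hK hk (hg i) (g0 i) t ht
  have iM : ∀ i t, 0 ≤ t → ∀ E, Integrable (fun ω => |Mt B (fun s => μp s ω) (g i) t|) (P.restrict E) := fun i t ht E =>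
    (bint (2 * b + 8 * b * t) ((mM i t ht).mono (𝓕.le t) le_rfl) (fun ω => Mt_bd hK hk (hg i) t ht ω)).abs
  refine (doob hT (fun t ω => sum_nonneg fun i _ => mul_nonneg (c0 i) (abs_nonneg _)) ?_ ?_ ?_ hA hl).trans ?_
  · intro t ht
    exact @meas_sumabs Ω (𝓕 t) _ s c _ (fun i => mM i t ht)
  · intro t ht
    refine integrable_finset_sum _ fun i _ => ?_
    have := iM i t ht Set.univ
    rw [Measure.restrict_univ] at this
    exact this.const_mul _
  · intro u t hu hut E hE
    rw [integral_finset_sum _ fun i _ => (iM i u hu E).const_mul _, integral_finset_sum _ fun i _ => (iM i t (hu.trans hut) E).const_mul _]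
    refine sum_le_sum fun i _ => ?_
    rw [integral_const_mul, integral_const_mul]
    refine mul_le_mul_of_nonneg_left ?_ (c0 i)
    have := mart_abs_sub (kac_M hK hk (hg i) (g0 i)) (M0 := fun ω => Gv b (g i) (μp 0 ω)) ((Gv_meas (hg i)).comp (path_meas hk 0))
      (bint b (((Gv_meas (hg i)).comp (path_meas hk 0)).mono (𝓕.le 0) le_rfl) fun ω => Gv_bd (hg i) _) hu hut hE
    simp only [kac_Mt hK hk (hg i) (g0 i)]
    have e : ∀ r ω, Gv b (g i) (μp r ω) - Gv b (g i) (μp 0 ω) - (∫ s in Ioc 0 r, QInt B (g i) (μp s ω) (μp s ω)) =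
      Gv b (g i) (μp r ω) - (∫ s in Ioc 0 r, QInt B (g i) (μp s ω) (μp s ω)) - Gv b (g i) (μp 0 ω) := fun r ω => by ring
    simp only [e]
    exact this
  · refine ofReal_le_ofReal ?_
    gcongr
    rw [integral_finset_sum _ fun i _ => (iM i T hT A).const_mul _]
    refine sum_le_sum fun i _ => ?_
    rw [integral_const_mul]
    refine mul_le_mul_of_nonneg_left ?_ (c0 i)
    refine le_sqrt_of_sq_le ?_
    have v := kac_var hK hk (hg i) (g0 i) hA hT
    simp only [integral_const_mul] at v
    rw [← v]
    set X := fun ω => |Mt B (fun s => μp s ω) (g i) T| with hX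
    have iX : Integrable X (P.restrict A) := iM i T hT A
    have iX2 : Integrable (fun ω => X ω ^ 2) (P.restrict A) := by
      have := bint (μ := P.restrict A) ((2 * b + 8 * b * T) ^ 2) (((mM i T hT).mono (𝓕.le T) le_rfl).abs.pow_const 2) (fun ω => by
        have := Mt_bd hK hk (hg i) T hT ω
        rw [abs_pow, abs_abs]; gcongr)
      exact this
    have e : ∫ ω in A, Mt B (fun s => μp s ω) (g i) T ^ 2 ∂P = ∫ ω in A, X ω ^ 2 ∂P := by simp [hX, sq_abs]
    rw [e]
    set y := ∫ ω in A, X ω ∂P with hy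
    have : 0 ≤ ∫ ω in A, (X ω - y) ^ 2 ∂P := integral_nonneg fun ω => sq_nonneg _
    have e2 : ∀ ω, (X ω - y) ^ 2 = X ω ^ 2 - 2 * y * X ω + y ^ 2 := fun ω => by ring
    simp only [e2] at this
    rw [integral_add (isub iX2 (iX.const_mul _)) (integrable_const _), integral_sub iX2 (iX.const_mul _), integral_const_mul, ← hy, integral_const] at this
    have hP : (P.restrict A).real Set.univ ≤ 1 := by
      simp only [Measure.real, Measure.restrict_apply MeasurableSet.univ, Set.univ_inter]
      exact ENNReal.toReal_le_of_le_ofReal nz (by simpa using prob_le_one)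
    simp only [smul_eq_mul] at this
    nlinarith [sq_nonneg y]
end
end
section
def Ph (q L x : ℝ) : ℝ := if x ≤ L then x ^ q else L ^ q + q * L ^ (q - 1) * (x - L)
lemma tang {q L x : ℝ} (hq : 1 ≤ q) (hL : 0 < L) (hx : 0 ≤ x) : L ^ q + q * L ^ (q - 1) * (x - L) ≤ x ^ q := by
  have h := one_add_mul_self_le_rpow_one_add (s := x / L - 1) (by have : 0 ≤ x / L := pz
                                                                  linarith) hq
  have e : (1 + (x / L - 1)) ^ q = x ^ q / L ^ q := by rw [add_sub_cancel, Real.div_rpow hx hL.le]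
  rw [e, le_div_iff₀ pz] at h
  have e2 : L ^ (q - 1) = L ^ q / L := Real.rpow_sub_one hL.ne' q
  rw [e2]
  calc _ = (1 + q * (x / L - 1)) * L ^ q := by field_simp
    _ ≤ _ := h
lemma Ph_le {q L x : ℝ} (hq : 1 ≤ q) (hL : 0 < L) (hx : 0 ≤ x) : Ph q L x ≤ x ^ q := by
  unfold Ph; split_ifs
  · exact le_rfl
  · exact tang hq hL hx
lemma Ph_ge {q L x : ℝ} (hq : 1 ≤ q) (hL : 0 < L) (hx : 0 ≤ x) : L ^ q + q * L ^ (q - 1) * (x - L) ≤ Ph q L x := by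
  unfold Ph; split_ifs
  · exact tang hq hL hx
  · exact le_rfl
lemma Ph_nn {q L x : ℝ} (hq : 1 ≤ q) (hL : 0 < L) (hx : 0 ≤ x) : 0 ≤ Ph q L x := by
  unfold Ph; split_ifs with h
  · positivity
  · have : 0 < x - L := lz
    positivity
lemma Ph_sup {q L s S : ℝ} (hq : 1 ≤ q) (hL : 0 < L) (hs : 0 ≤ s) (hsS : s ≤ S) (hS : L < S) : S * Ph q L s ≤ s * Ph q L S := by
  have e2 : L ^ q = L ^ (q - 1) * L := by rw [← rpow_add_one hL.ne']; simp
  have l0 : 0 < L ^ (q - 1) := pz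
  unfold Ph; rw [if_neg hS.not_ge]; split_ifs with h
  · rcases hs.eq_or_lt with rfl | hs
    · simp [Real.zero_rpow (lz : q ≠ 0)]
    have e3 : s ^ q = s ^ (q - 1) * s := by rw [← rpow_add_one hs.ne']; simp
    have e4 : s ^ (q - 1) ≤ L ^ (q - 1) := rpow_le_rpow hs.le h lz
    have : S * s ^ (q - 1) ≤ L ^ q + q * L ^ (q - 1) * (S - L) := by
      rw [e2]
      have := mul_le_mul_of_nonneg_left e4 (lz : 0 ≤ S)
      nlinarith [mul_nonneg l0.le (lz : 0 ≤ S - L)]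
    rw [e3]; nlinarith
  · rw [e2]
    nlinarith [mul_nonneg (mul_nonneg (mul_nonneg l0.le hL.le) (lz : 0 ≤ q - 1)) (lz : 0 ≤ S - s)]
def gR (p R : ℝ) (v : Ed) : ℝ :=
  Ph (p/2) (R^2) (‖v‖^2) - ((R^2) ^ (p/2) + (p/2) * (R^2) ^ (p/2 - 1) * (‖v‖^2 - R^2))
section
variable (hp : 2 < p) (hR : 0 < R)
include hp hR
lemma gR_nn (v : Ed) : 0 ≤ gR p R v := sub_nonneg.2 (Ph_ge lz pz pz)
lemma gR_BM : BM ((R^2) ^ (p/2) + (p/2) * (R^2) ^ (p/2 - 1) * R^2) (gR (d := d) p R) := by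
  have h1 : 0 ≤ (R^2) ^ (p/2) := pz
  have h2 : 0 ≤ (p/2) * (R^2) ^ (p/2 - 1) := pz
  constructor
  · unfold gR Ph
    refine Measurable.sub (Measurable.ite ?_ mz mz) mz
    exact measurableSet_le mz measurable_const
  · intro v
    rw [abs_of_nonneg (gR_nn hp hR v)]
    unfold gR Ph
    split_ifs with h
    · have : (‖v‖^2) ^ (p/2) ≤ (R^2) ^ (p/2) := rpow_le_rpow pz h lz
      nlinarith [mul_nonneg h2 (sq_nonneg ‖v‖)]
    · rw [sub_self]; positivity
lemma gR_supp (v : Ed) (hv : R < ‖v‖) : gR p R v = 0 := by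
  unfold gR Ph; rw [if_neg, sub_self]
  rw [not_le]; gcongr
lemma Df_gR {vs σ : Ed} (hσ : ‖σ‖ = 1) : Df (gR p R) v vs σ =
    Ph (p/2) (R^2) (‖postV v vs σ‖^2) + Ph (p/2) (R^2) (‖postVs v vs σ‖^2) - Ph (p/2) (R^2) (‖v‖^2) - Ph (p/2) (R^2) (‖vs‖^2) := by
  have := energy v vs σ hσ
  unfold Df gR
  linear_combination (-(p/2) * (R^2) ^ (p/2 - 1)) * this
end
lemma sqp {x : ℝ} (hx : 0 ≤ x) : (x ^ 2) ^ (p/2) = x ^ p := by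
  rw [← rpow_natCast, ← rpow_mul hx]; congr 1; push_cast; ring
def pw (p R x : ℝ) : ℝ := if x ≤ R then x ^ (p + 1) else 0
lemma pw_nn {x : ℝ} (hx : 0 ≤ x) : 0 ≤ pw p R x := by unfold pw; split_ifs <;> positivity
lemma pw_le {x : ℝ} (hx : 0 ≤ x) : pw p R x ≤ x ^ (p+1) := by unfold pw; split_ifs; exact le_rfl; positivity
set_option maxHeartbeats 1000000 in
lemma povz (hK : GoodK B κ K) (hp : 2 < p) :
    ∃ c C : ℝ, 0 < c ∧ 0 < C ∧ ∀ R, 0 < R → ∀ v vs : Ed, KK K (gR p R) v vs ≤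
      -c * (pw p R ‖v‖ + pw p R ‖vs‖) + C * (‖v‖ ^ (p-1) * ‖vs‖ ^ 2 + ‖vs‖ ^ (p-1) * ‖v‖ ^ 2) := by
  obtain ⟨η, δ, η0, η1, δ0, hpov⟩ := hK.pov p hp
  have := hK.markov
  have C1 : 0 < η⁻¹ ^ 2 * (2 * 2 ^ (p/2) * 2 + 2 * (δ/4)) := pz
  refine ⟨δ/4, η⁻¹ ^ 2 * (2 * 2 ^ (p/2) * 2 + 2 * (δ/4)) + p + δ/4, pz, pz, fun R hR => ?_⟩
  have key : ∀ v vs : Ed, ‖vs‖ ≤ ‖v‖ → KK K (gR p R) v vs ≤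
      -(δ/4) * (pw p R ‖v‖ + pw p R ‖vs‖) + (η⁻¹ ^ 2 * (2 * 2 ^ (p/2) * 2 + 2 * (δ/4)) + p + δ/4) * (‖v‖ ^ (p-1) * ‖vs‖ ^ 2) := by
    intro v vs hba
    set a := ‖v‖ with ha
    set b := ‖vs‖ with hb
    have a0 : 0 ≤ a := norm_nonneg _
    have b0 : 0 ≤ b := norm_nonneg _
    have n2 : ‖v - vs‖ ≤ 2 * a := (norm_sub_le _ _).trans lz
    have n0 : 0 ≤ ‖v - vs‖ := norm_nonneg _
    have hb1 : b ^ (p + 1) ≤ a ^ (p - 1) * b ^ 2 := by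
      rcases b0.eq_or_lt with h | h
      · rw [← h, Real.zero_rpow lz]; positivity
      · have : b ^ (p+1) = b ^ (p-1) * b ^ 2 := by
          rw [← rpow_natCast b 2, ← rpow_add h]; congr 1; push_cast; ring
        rw [this]; have := rpow_le_rpow b0 hba (lz : 0 ≤ p - 1); gcongr
    have hX : 0 ≤ a ^ (p - 1) * b ^ 2 := pz
    have hpb := pw_le (p := p) (R := R) b0
    have iDf : Integrable (fun σ => Df (gR p R) v vs σ) (K (v - vs)) :=
      bint _ (meas_Df' (gR_BM hp hR).meas v vs) (Df_bd (gR_BM hp hR).bd v vs)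
    have hint : ∀ Y : ℝ, (∀ σ, ‖σ‖ = 1 → Df (gR p R) v vs σ ≤ Y) → ∫ σ, Df (gR p R) v vs σ ∂(K (v - vs)) ≤ Y := fun Y hY => by
      have := integral_mono_ae iDf (integrable_const Y) (by filter_upwards [hK.sph (v - vs)] with σ hσ using hY σ hσ)
      simpa using this
    have hL : 0 < R ^ 2 := pz
    have hq : 1 ≤ p/2 := lz
    rcases lt_or_ge R a with hRa | hRa
    · -- case A
      have hpa : pw p R a = 0 := by unfold pw; rw [if_neg hRa.not_ge]
      have hL2 : R ^ 2 < a ^ 2 := by gcongr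
      have h1 : ∫ σ, Df (gR p R) v vs σ ∂(K (v - vs)) ≤ (p/2) * (R^2) ^ (p/2 - 1) * b ^ 2 := hint _ fun σ hσ => by
        rw [Df_gR hp hR hσ]
        have en := energy v vs σ hσ
        rw [← ha, ← hb] at en
        set x' := ‖postV v vs σ‖ ^ 2
        set y' := ‖postVs v vs σ‖ ^ 2
        have hx' : 0 ≤ x' := sq_nonneg _
        have hy' : 0 ≤ y' := sq_nonneg _
        have S0 : R ^ 2 < a ^ 2 + b ^ 2 := by nlinarith
        have s1 := Ph_sup hq hL hx' (lz : x' ≤ a ^ 2 + b ^ 2) S0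
        have s2 := Ph_sup hq hL hy' (lz : y' ≤ a ^ 2 + b ^ 2) S0
        have s3 : Ph (p/2) (R^2) x' + Ph (p/2) (R^2) y' ≤ Ph (p/2) (R^2) (a^2+b^2) := by
          have : 0 < a ^ 2 + b ^ 2 := lz
          have e : (a^2+b^2) * (Ph (p/2) (R^2) x' + Ph (p/2) (R^2) y') ≤ (a^2+b^2) * Ph (p/2) (R^2) (a^2+b^2) := by
            calc _ ≤ (x' + y') * Ph (p/2) (R^2) (a^2+b^2) := lz
              _ = _ := by rw [en]
          exact le_of_mul_le_mul_left e this
        have s4 : Ph (p/2) (R^2) (a^2+b^2) - Ph (p/2) (R^2) (a^2) = (p/2) * (R^2) ^ (p/2 - 1) * b ^ 2 := by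
          unfold Ph; rw [if_neg S0.not_ge, if_neg hL2.not_ge]; ring
        have := Ph_nn hq hL (sq_nonneg b)
        linarith
      have h2 : (R^2) ^ (p/2 - 1) * a ≤ a ^ (p - 1) := by
        have e : (R^2) ^ (p/2 - 1) = R ^ (p - 2) := by
          rw [show p/2 - 1 = (p-2)/2 by ring, sqp hR.le]
        rw [e]
        have ap : 0 < a := hR.trans hRa
        have e2 : a ^ (p-1) = a ^ (p-2) * a := by rw [← rpow_add_one ap.ne']; congr 1; ring
        rw [e2]
        have := rpow_le_rpow hR.le hRa.le (lz : 0 ≤ p - 2); gcongr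
      have h3 : KK K (gR p R) v vs ≤ p * (a ^ (p - 1) * b ^ 2) := by
        unfold KK
        calc _ ≤ ‖v - vs‖ * ((p/2) * (R^2) ^ (p/2 - 1) * b ^ 2) := by gcongr
          _ ≤ 2 * a * ((p/2) * (R^2) ^ (p/2 - 1) * b ^ 2) := by gcongr
          _ = p * (((R^2) ^ (p/2 - 1) * a) * b ^ 2) := by ring
          _ ≤ _ := by gcongr
      rw [hpa]
      have := mul_nonneg C1.le hX
      have m1 := mul_le_mul_of_nonneg_left (hpb.trans hb1) (pz : 0 ≤ δ/4)
      linarith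
    have hpa : pw p R a ≤ a ^ (p+1) := pw_le a0
    have ha1 : a ^ (p+1) = a ^ p * a := by
      rw [Real.rpow_add_one' a0 lz]
    rcases le_or_gt (η * a) b with hη | hη
    · -- case B
      have h1 : ∫ σ, Df (gR p R) v vs σ ∂(K (v - vs)) ≤ 2 * 2 ^ (p/2) * a ^ p := hint _ fun σ hσ => by
        rw [Df_gR hp hR hσ]
        have en := energy v vs σ hσ
        rw [← ha, ← hb] at en
        set x' := ‖postV v vs σ‖ ^ 2
        set y' := ‖postVs v vs σ‖ ^ 2
        have hx' : 0 ≤ x' := sq_nonneg _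
        have hy' : 0 ≤ y' := sq_nonneg _
        have hb2 : b ^ 2 ≤ a ^ 2 := by gcongr
        have s1 := (Ph_le hq hL hx').trans (rpow_le_rpow hx' (lz : x' ≤ 2 * a ^ 2) lz)
        have s2 := (Ph_le hq hL hy').trans (rpow_le_rpow hy' (lz : y' ≤ 2 * a ^ 2) lz)
        rw [mul_rpow nz pz, sqp a0] at s1 s2
        have := Ph_nn hq hL (sq_nonneg b)
        have := Ph_nn hq hL (sq_nonneg a)
        linarith
      have h2 : a ^ (p+1) ≤ η⁻¹ ^ 2 * (a ^ (p-1) * b ^ 2) := by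
        have e : a ^ (p+1) = a ^ (p-1) * a ^ 2 := by
          rcases a0.eq_or_lt with h | h
          · rw [← h, Real.zero_rpow lz]; simp
          · rw [← rpow_natCast a 2, ← rpow_add h]; congr 1; push_cast; ring
        have e2 : a ^ 2 ≤ η⁻¹ ^ 2 * b ^ 2 := by
          rw [← mul_pow]; gcongr
          rw [inv_mul_eq_div, le_div_iff₀ η0]; linarith
        rw [e]
        calc _ ≤ a ^ (p-1) * (η⁻¹ ^ 2 * b ^ 2) := by gcongr
          _ = _ := by ring
      have h3 : KK K (gR p R) v vs ≤ 2 * 2 ^ (p/2) * 2 * a ^ (p+1) := by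
        unfold KK
        calc _ ≤ ‖v - vs‖ * (2 * 2 ^ (p/2) * a ^ p) := by gcongr
          _ ≤ 2 * a * (2 * 2 ^ (p/2) * a ^ p) := by gcongr
          _ = _ := by rw [ha1]; ring
      have h4 : b ^ (p+1) ≤ a ^ (p+1) := rpow_le_rpow b0 hba lz
      have h5 : (2 * 2 ^ (p/2) * 2 + 2 * (δ/4)) * a ^ (p+1) ≤ (2 * 2 ^ (p/2) * 2 + 2 * (δ/4)) * (η⁻¹ ^ 2 * (a ^ (p-1) * b ^ 2)) := by gcongr
      have m1 := mul_le_mul_of_nonneg_left (hpb.trans h4) (pz : 0 ≤ δ/4)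
      have m2 := mul_le_mul_of_nonneg_left hpa (pz : 0 ≤ δ/4)
      have m3 := mul_nonneg (lz : 0 ≤ p) hX
      have m4 := mul_nonneg δ0.le hX
      linarith
    · -- case C
      have ap : 0 < a := lt_of_le_of_ne a0 fun h => by
        rw [← h] at hη hba; simp only [mul_zero] at hη; linarith
      have hne : v - vs ≠ 0 := by
        intro h; have : v = vs := sub_eq_zero.1 h
        have : a = b := by rw [ha, hb, this]
        rw [← this] at hη
        have := mul_le_mul_of_nonneg_right η1 a0
        linarith
      have nn : 3/4 * a ≤ ‖v - vs‖ := by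
        have := norm_sub_norm_le v vs
        rw [← ha, ← hb] at this
        have := mul_le_mul_of_nonneg_right η1 a0
        linarith
      set u := ‖v - vs‖⁻¹ • (v - vs) with hu
      have eu : ‖v - vs‖ • u = v - vs := by rw [hu, smul_smul, mul_inv_cancel₀ (norm_ne_zero_iff.2 hne), one_smul]
      have hu1 : ‖u‖ = 1 := norm_unit hne
      have n3 : ‖v - vs‖ ≤ (1 + η) * a := (norm_sub_le _ _).trans (by rw [← ha, ← hb]; linarith)
      have pb : ∀ τ : Ed, ‖τ‖ = 1 → ‖tw⁻¹ • (v + vs) + (tw⁻¹ * ‖v - vs‖) • τ‖ ≤ a * (‖u + τ‖ / 2 + 2 * η) := by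
        intro τ hτ
        have e : tw⁻¹ • (v + vs) + (tw⁻¹ * ‖v - vs‖) • τ = (tw⁻¹ * ‖v - vs‖) • (u + τ) + vs := by
          rw [smul_add _ u τ, mul_smul tw⁻¹ _ u, eu]; module
        rw [e]
        refine (norm_add_le _ _).trans ?_
        rw [norm_smul, norm_of_nonneg pz, ← hb]
        have k : ‖u + τ‖ ≤ 2 := (norm_add_le _ _).trans (by rw [hu1, hτ]; norm_num)
        have k2 : ‖v - vs‖ * ‖u + τ‖ ≤ (1 + η) * a * ‖u + τ‖ := by gcongr
        have k3 := mul_le_mul_of_nonneg_left k (pz : 0 ≤ η * a)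
        linarith
      let S : Ed → ℝ := fun σ => (‖u + σ‖ / 2 + 2 * η) ^ p + (‖u - σ‖ / 2 + 2 * η) ^ p
      have iS : Integrable S (K (v - vs)) := by
        refine Integrable.of_bound (C := 2 * (1 + 2 * η) ^ p) (by
          refine Measurable.aestronglyMeasurable ?_
          simp only [S]; fun_prop) ?_
        filter_upwards [hK.sph (v - vs)] with σ hσ
        have k : ‖u + σ‖ ≤ 2 := (norm_add_le _ _).trans (by rw [hu1, hσ]; norm_num)
        have k' : ‖u - σ‖ ≤ 2 := (norm_sub_le _ _).trans (by rw [hu1, hσ]; norm_num)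
        have z1 : (‖u + σ‖ / 2 + 2 * η) ^ p ≤ (1 + 2 * η) ^ p := rpow_le_rpow pz lz lz
        have z2 : (‖u - σ‖ / 2 + 2 * η) ^ p ≤ (1 + 2 * η) ^ p := rpow_le_rpow pz lz lz
        rw [norm_of_nonneg (by simp only [S]; positivity)]
        simp only [S]; linarith
      have h1 : ∫ σ, Df (gR p R) v vs σ ∂(K (v - vs)) ≤ -δ * a ^ p := by
        have : ∫ σ, Df (gR p R) v vs σ ∂(K (v - vs)) ≤ ∫ σ, (a ^ p * S σ - a ^ p) ∂(K (v - vs)) := by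
          refine integral_mono_ae iDf ((iS.const_mul _).sub (integrable_const _)) ?_
          filter_upwards [hK.sph (v - vs)] with σ hσ
          rw [Df_gR hp hR hσ]
          have p1 : ‖postV v vs σ‖ ≤ a * (‖u + σ‖ / 2 + 2 * η) := pb σ hσ
          have p2 : ‖postVs v vs σ‖ ≤ a * (‖u - σ‖ / 2 + 2 * η) := by
            have := pb (-σ) (by rwa [norm_neg])
            rw [smul_neg, ← sub_eq_add_neg, ← sub_eq_add_neg] at this
            exact this
          have q1 := (Ph_le hq hL (sq_nonneg ‖postV v vs σ‖))
          have q2 := (Ph_le hq hL (sq_nonneg ‖postVs v vs σ‖))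
          rw [sqp (norm_nonneg _)] at q1 q2
          have r1 := q1.trans (rpow_le_rpow (norm_nonneg _) p1 lz)
          have r2 := q2.trans (rpow_le_rpow (norm_nonneg _) p2 lz)
          rw [mul_rpow a0 pz] at r1 r2
          have r3 : Ph (p/2) (R^2) (a^2) = a ^ p := by
            unfold Ph; rw [if_pos (by gcongr), sqp a0]
          have := Ph_nn hq hL (sq_nonneg b)
          rw [← ha, ← hb, r3]
          simp only [S]; linarith
        refine this.trans ?_
        rw [integral_sub (iS.const_mul _) (integrable_const _), integral_const_mul]
        have := hpov (v - vs) hne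
        have := mul_le_mul_of_nonneg_left this (pz : 0 ≤ a ^ p)
        simp only [integral_const, probReal_univ, smul_eq_mul, one_mul]
        simp only [S]; linarith
      have h3 : KK K (gR p R) v vs ≤ -(3/4 * δ) * a ^ (p+1) := by
        unfold KK
        have : 0 ≤ δ * a ^ p := pz
        rw [ha1]
        have m1 := mul_le_mul_of_nonneg_left h1 n0
        have m2 := mul_le_mul_of_nonneg_right nn this
        linarith
      have h4 : b ^ (p+1) ≤ a ^ (p+1) := rpow_le_rpow b0 hba lz
      have h5 : 0 ≤ (η⁻¹ ^ 2 * (2 * 2 ^ (p/2) * 2 + 2 * (δ/4)) + p + δ/4) * (a ^ (p-1) * b ^ 2) := pz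
      have h6 : 0 ≤ δ * a ^ (p+1) := pz
      have m1 := mul_le_mul_of_nonneg_left (hpb.trans h4) (pz : 0 ≤ δ/4)
      have m2 := mul_le_mul_of_nonneg_left hpa (pz : 0 ≤ δ/4)
      linarith
  intro v vs
  have hC : 0 ≤ (η⁻¹ ^ 2 * (2 * 2 ^ (p/2) * 2 + 2 * (δ/4)) + p + δ/4) := pz
  rcases le_total ‖vs‖ ‖v‖ with h | h
  · refine (key v vs h).trans ?_
    have : 0 ≤ ‖vs‖ ^ (p-1) * ‖v‖ ^ 2 := pz
    gcongr; linarith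
  · rw [KK_symm hK (gR_BM hp hR).meas]
    refine (key vs v h).trans ?_
    rw [add_comm (pw p R ‖vs‖)]
    have : 0 ≤ ‖v‖ ^ (p-1) * ‖vs‖ ^ 2 := pz
    gcongr; linarith
end
section
lemma iadd {X : Type*} [MeasurableSpace X] {μ : Measure X} {f g : X → ℝ} (hf : Integrable f μ) (hg : Integrable g μ) :
    Integrable (fun x => f x + g x) μ := hf.add hg
lemma imul {X : Type*} [MeasurableSpace X] {μ : Measure X} {f : X → ℝ} (c : ℝ) (hf : Integrable f μ) :
    Integrable (fun x => c * f x) μ := hf.const_mul c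
lemma meas_pw : Measurable (fun v : Ed => pw p R ‖v‖) := by
  unfold pw
  exact Measurable.ite (measurableSet_le measurable_norm measurable_const) (measurable_norm.pow_const _) measurable_const
lemma pw_bd (hp : 2 < p) (hR : 0 < R) (v : Ed) : |pw p R ‖v‖| ≤ R ^ (p+1) := by
  rw [abs_of_nonneg (pw_nn (norm_nonneg _))]
  unfold pw
  split_ifs with h
  · exact rpow_le_rpow (norm_nonneg _) h lz
  · positivity
lemma pow_le_add {q x : ℝ} (hp : 0 ≤ p) (hpq : p ≤ q) (hx : 0 ≤ x) : x ^ p ≤ 1 + x ^ q := by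
  rcases le_total x 1 with h | h
  · have := Real.rpow_le_one hx h hp
    have := Real.rpow_nonneg hx q
    linarith
  · have := Real.rpow_le_rpow_of_exponent_le h hpq
    linarith
lemma int_pow_le {q : ℝ} (hp : 0 ≤ p) (hpq : p ≤ q) [IsFiniteMeasure ν]
    (hi : Integrable (fun v => ‖v‖ ^ q) ν) : Integrable (fun v => ‖v‖ ^ p) ν := by
  refine Integrable.mono' ((integrable_const 1).add hi) ((measurable_norm.pow_const _).aestronglyMeasurable) (Eventually.of_forall fun v => ?_)
  rw [norm_of_nonneg pz]
  exact pow_le_add hp hpq (norm_nonneg v)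
lemma gR_diff (hp : 2 < p) (hR : 0 < R) {x y : Ms} (hx : S2 x) (hy : S2 y)
    (hi : Integrable (fun v => ‖v‖ ^ p) x) : ∫ v, gR p R v ∂x - ∫ v, gR p R v ∂y ≤ Mo p x := by
  have := hx.prob; have := hy.prob
  set k := (R^2) ^ (p/2) - (p/2) * (R^2) ^ (p/2 - 1) * R ^ 2 with hk
  set l := (p/2) * (R^2) ^ (p/2 - 1) with hl
  have key : ∀ ν : Ms, S2 ν → ∫ v, (gR p R v + (k + l * ‖v‖ ^ 2)) ∂ν = ∫ v, gR p R v ∂ν + (k + l) := by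
    intro ν h
    have := h.prob
    rw [integral_add ((gR_BM hp hR).int ν) (iadd (integrable_const _) (h.int.const_mul _)), integral_add (integrable_const _) (h.int.const_mul _),
      integral_const_mul, h.one]
    simp
  have e : ∀ v : Ed, gR p R v + (k + l * ‖v‖ ^ 2) = Ph (p/2) (R^2) (‖v‖^2) := by
    intro v; unfold gR; rw [hk, hl]; ring
  have h1 : ∫ v, (gR p R v + (k + l * ‖v‖ ^ 2)) ∂x ≤ Mo p x := by
    refine integral_mono (((gR_BM hp hR).int x).add ((integrable_const _).add (hx.int.const_mul _))) hi fun v => ?_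
    simp only [e]
    rw [← sqp (norm_nonneg v)]
    exact Ph_le lz pz pz
  have h2 : 0 ≤ ∫ v, (gR p R v + (k + l * ‖v‖ ^ 2)) ∂y := by
    refine integral_nonneg fun v => ?_
    simp only [e]
    exact Ph_nn lz pz pz
  rw [key x hx] at h1
  rw [key y hy] at h2
  linarith
structure Pov (K : Kernel (Ed) (Ed)) (p c C : ℝ) : Prop where
  c0 : 0 < c
  C0 : 0 < C
  h : ∀ R, 0 < R → ∀ v vs : Ed, KK K (gR p R) v vs ≤
      -c * (pw p R ‖v‖ + pw p R ‖vs‖) + C * (‖v‖ ^ (p-1) * ‖vs‖ ^ 2 + ‖vs‖ ^ (p-1) * ‖v‖ ^ 2)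
variable (hK : GoodK B κ K) {C : ℝ} (hp : 2 < p)
  (hpv : Pov K p c C)
include hK hp hpv
lemma pov_Q (hR : 0 < R) (h : S2 ν) (hi : Integrable (fun v => ‖v‖ ^ (p-1)) ν) :
    QInt B (gR p R) ν ν ≤ -c * (2 * ∫ v, pw p R ‖v‖ ∂ν) + C * (2 * Mo (p-1) ν) := by
  have := h.prob; have := hK.markov
  have ip : Integrable (fun v : Ed => pw p R ‖v‖) ν := bint _ meas_pw (pw_bd hp hR)
  rw [QInt_prod hK (gR_BM hp hR).meas (gR_BM hp hR).bd h h]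
  have i1 : Integrable (fun x : Ed × Ed => pw p R ‖x.1‖) (ν.prod ν) := ip.comp_fst ν
  have i2 : Integrable (fun x : Ed × Ed => pw p R ‖x.2‖) (ν.prod ν) := ip.comp_snd ν
  have i3 : Integrable (fun x : Ed × Ed => ‖x.1‖ ^ (p-1) * ‖x.2‖ ^ 2) (ν.prod ν) := hi.mul_prod h.int
  have i4 : Integrable (fun x : Ed × Ed => ‖x.2‖ ^ (p-1) * ‖x.1‖ ^ 2) (ν.prod ν) := by
    simpa [mul_comm] using h.int.mul_prod hi
  have := integral_mono (KK_int (gR_BM hp hR).meas (gR_BM hp hR).bd h h)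
    (iadd (imul (-c) (iadd i1 i2)) (imul C (iadd i3 i4))) (fun x => hpv.h R hR x.1 x.2)
  refine this.trans (le_of_eq ?_)
  rw [integral_add (imul (-c) (iadd i1 i2)) (imul C (iadd i3 i4)), integral_const_mul, integral_const_mul]
  rw [integral_add i1 i2, integral_add i3 i4, integral_fun_fst (fun v : Ed => pw p R ‖v‖), integral_fun_snd (fun v : Ed => pw p R ‖v‖),
    integral_prod_mul (fun v : Ed => ‖v‖ ^ (p-1)) (fun v : Ed => ‖v‖ ^ 2)]
  have e : ∫ z : Ed × Ed, ‖z.2‖ ^ (p - 1) * ‖z.1‖ ^ 2 ∂ν.prod ν = (Mo 2 ν) * Mo (p-1) ν := by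
    rw [← integral_prod_mul]
    simp only [mul_comm]
  rw [e, h.one]
  simp
  ring
lemma pov_path (hR : 0 < R) {x : ℝ → Ms} (hx : Path x) (hi : Integrable (fun v => ‖v‖ ^ p) (x 0))
    {D : ℝ} (hT : 0 ≤ T) (h1 : ∀ s ∈ Ioc 0 T, Integrable (fun v => ‖v‖ ^ (p-1)) (x s))
    (h2 : ∀ s ∈ Ioc 0 T, C * (2 * Mo (p-1) (x s)) ≤ c * (∫ v, pw p R ‖v‖ ∂(x s)) + D) :
    c * ∫ s in Ioc 0 T, (∫ v, pw p R ‖v‖ ∂(x s)) ≤ D * T + Mo p (x 0) + Mt B x (gR p R) T := by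
  have i1 := hx.q_int hK (gR_BM (d := d) hp hR) 0 T
  have hm : Measurable fun s => ∫ v, pw p R ‖v‖ ∂(x s) := by
    have : IsMarkovKernel (⟨x, hx.meas⟩ : Kernel ℝ (Ed)) := ⟨fun s => (hx.s2 s).prob⟩
    exact (StronglyMeasurable.integral_kernel (κ := ⟨x, hx.meas⟩) (meas_pw (d := d)).stronglyMeasurable).measurable
  have i2 : IntegrableOn (fun s => ∫ v, pw p R ‖v‖ ∂(x s)) (Ioc 0 T) := by
    refine bint (R ^ (p+1)) hm fun s => ?_
    have := (hx.s2 s).prob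
    exact abs_int_le (Eventually.of_forall (pw_bd hp hR))
  have h3 : ∫ s in Ioc 0 T, (c * (∫ v, pw p R ‖v‖ ∂(x s)) - D) ≤ ∫ s in Ioc 0 T, -QInt B (gR p R) (x s) (x s) := by
    refine setIntegral_mono_on ((i2.const_mul c).sub (integrable_const _)) i1.neg measurableSet_Ioc fun s hs => ?_
    have := pov_Q hK hp hpv hR (hx.s2 s) (h1 s hs)
    have := h2 s hs
    linarith
  rw [integral_sub (i2.const_mul c) (integrable_const _), integral_const_mul, integral_neg] at h3
  simp [hT] at h3
  have h4 := gR_diff hp hR (hx.s2 0) (hx.s2 T) hi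
  unfold Mt
  linarith
end
section
lemma momentL_eq (hp : 0 ≤ p) (ν : Ms) : momentL p ν = ∫⁻ v, ofReal (‖v‖ ^ p) ∂ν := by
  unfold momentL
  congr 1; ext v
  rw [← ENNReal.ofReal_rpow_of_nonneg (norm_nonneg v) hp, ofReal_norm_eq_enorm]; rfl
lemma mom_int (hp : 0 ≤ p) {M : ℝ≥0∞} (hM : M ≠ ⊤) (h : momentL p ν ≤ M) :
    Integrable (fun v => ‖v‖ ^ p) ν ∧ Mo p ν ≤ M.toReal := by
  rw [momentL_eq hp] at h
  have h0 : ∀ v : Ed, 0 ≤ ‖v‖ ^ p := fun v => by positivity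
  have hm : AEStronglyMeasurable (fun v : Ed => ‖v‖ ^ p) ν := (measurable_norm.pow_const _).aestronglyMeasurable
  refine ⟨⟨hm, ?_⟩, ?_⟩
  · rw [hasFiniteIntegral_iff_ofReal (Eventually.of_forall h0)]
    exact h.trans_lt (lt_top_iff_ne_top.2 hM)
  · rw [integral_eq_lintegral_of_nonneg_ae (Eventually.of_forall h0) hm]
    exact ENNReal.toReal_mono hM h
def solP (μ : ℝ → Ms) (s : ℝ) : Ms := μ (max s 0)
lemma meas_int_path {x : ℝ → Ms} (hx : Path x) (hf : Measurable f) : Measurable fun s => ∫ v, f v ∂(x s) := by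
  have : IsMarkovKernel (⟨x, hx.meas⟩ : Kernel ℝ (Ed)) := ⟨fun s => (hx.s2 s).prob⟩
  exact (StronglyMeasurable.integral_kernel (κ := ⟨x, hx.meas⟩) hf.stronglyMeasurable).measurable
variable (hK : GoodK B κ K) {C : ℝ} (hp : 2 < p)
  (hpv : Pov K p c C)
lemma sol_Mt {μ : ℝ → Ms} (hsol : IsBoltzmannSolution B μ) (hF : BM b F)
    (hs : HasCompactSupport F) (hr : 0 ≤ r) : Mt B (solP μ) F r = 0 := by
  have := hsol.2 F hF.meas ⟨b, hF.bd⟩ hs r hr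
  unfold Mt solP
  rw [max_eq_left hr, max_self, this]
  have e : ∫ s in Ioc 0 r, QInt B F (μ (max s 0)) (μ (max s 0)) = ∫ s in Ioc 0 r, QInt B F (μ s) (μ s) :=
    setIntegral_congr_fun measurableSet_Ioc (fun s hs => by simp only [max_eq_left hs.1.le])
  rw [e]
  ring
include hK
lemma sol_path {μ : ℝ → Ms} (hsol : IsBoltzmannSolution B μ) : Path (solP μ) :=
  ⟨sol_meas hK hsol, fun s => S2_of_mem (hsol.1 _ (le_max_right _ _))⟩
include hp hpv
lemma pov_sol {μ : ℝ → Ms} (hsol : IsBoltzmannSolution B μ) (hb : LocBddMomentFrom p 0 μ) (hT : 0 ≤ T) :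
    (∀ᵐ s ∂(volume.restrict (Ioc 0 T)), Integrable (fun v => ‖v‖ ^ (p+1)) (solP μ s)) ∧
      IntegrableOn (fun s => Mo (p+1) (solP μ s)) (Ioc 0 T) := by
  obtain ⟨M, hM, hb⟩ := hb T hT
  have hx := sol_path hK hsol
  have hb1 : ∀ s ∈ Icc 0 T, Integrable (fun v => ‖v‖ ^ p) (solP μ s) ∧ Mo p (solP μ s) ≤ M.toReal := by
    intro s hs
    refine mom_int lz hM ?_
    unfold solP
    rw [max_eq_left hs.1]
    exact hb s hs
  have hb2 : ∀ s ∈ Icc 0 T, Integrable (fun v => ‖v‖ ^ (p-1)) (solP μ s) ∧ Mo (p-1) (solP μ s) ≤ 1 + M.toReal := by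
    intro s hs
    have := (hx.s2 s).prob
    have h1 := int_pow_le (p := p - 1) (q := p) lz lz (hb1 s hs).1
    refine ⟨h1, ?_⟩
    have := integral_mono h1 (iadd (integrable_const 1) (hb1 s hs).1) (fun v => pow_le_add lz lz (norm_nonneg v))
    rw [integral_add (integrable_const 1) (hb1 s hs).1] at this
    simp at this
    linarith [(hb1 s hs).2]
  have hT0 : (0:ℝ) ∈ Icc 0 T := ⟨le_rfl, hT⟩
  set D := C * (2 * (1 + M.toReal)) * T + M.toReal with hD
  have h0 : ∀ v : Ed, 0 ≤ ‖v‖ ^ (p+1) := fun v => by positivity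
  have key : ∀ n : ℕ, ∫⁻ s in Ioc 0 T, ∫⁻ v, ofReal (pw p (n+1) ‖v‖) ∂(solP μ s) ≤ ofReal (D / c) := by
    intro n
    have hR : (0:ℝ) < n + 1 := pz
    have hc0 := hpv.c0
    have hC0 := hpv.C0
    have h1 := pov_path hK hp hpv hR hx (hb1 0 hT0).1 hT (D := C * (2 * (1 + M.toReal))) (fun s hs => (hb2 s ⟨hs.1.le, hs.2⟩).1) (fun s hs => by
      have h1 : 0 ≤ ∫ v, pw p (n+1) ‖v‖ ∂(solP μ s) := integral_nonneg fun v => pw_nn (norm_nonneg _)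
      have h2 := mul_nonneg hc0.le h1
      have := mul_le_mul_of_nonneg_left (hb2 s ⟨hs.1.le, hs.2⟩).2 hC0.le
      linarith)
    rw [sol_Mt hsol (gR_BM hp hR) (HasCompactSupport.intro (isCompact_closedBall 0 (n+1:ℝ)) (fun v hv => gR_supp hp hR v (by simpa using hv))) hT] at h1
    have h2 : ∫ s in Ioc 0 T, (∫ v, pw p (n+1) ‖v‖ ∂(solP μ s)) ≤ D / c := by
      rw [le_div_iff₀ hc0, hD]
      linarith [(hb1 0 hT0).2]
    refine le_trans (le_of_eq ?_) (ofReal_le_ofReal h2)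
    have hm := meas_int_path hx (meas_pw (d := d) (p := p) (R := n+1))
    have e : ∀ s, ∫⁻ v, ofReal (pw p (n+1) ‖v‖) ∂(solP μ s) = ofReal (∫ v, pw p (n+1) ‖v‖ ∂(solP μ s)) := by
      intro s
      have := (hx.s2 s).prob
      exact (ofReal_integral_eq_lintegral_ofReal (bint _ meas_pw (pw_bd hp hR)) (Eventually.of_forall fun v => pw_nn (norm_nonneg _))).symm
    simp only [e]
    refine (ofReal_integral_eq_lintegral_ofReal (bint ((n+1:ℝ) ^ (p+1)) hm fun s => ?_) (Eventually.of_forall fun s => integral_nonneg fun v => pw_nn (norm_nonneg _))).symm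
    have := (hx.s2 s).prob
    exact abs_int_le (Eventually.of_forall (pw_bd hp hR))
  have hmono : ∀ v : Ed, Monotone (fun n : ℕ => ofReal (pw p (n+1) ‖v‖)) := by
    intro v n k hnk
    refine ofReal_le_ofReal ?_
    unfold pw
    have : (n:ℝ) ≤ k := by exact_mod_cast hnk
    split_ifs with h1 h2
    · exact le_rfl
    · linarith
    · positivity
    · exact le_rfl
  have hsup : ∀ v : Ed, ofReal (‖v‖ ^ (p+1)) = ⨆ n : ℕ, ofReal (pw p (n+1) ‖v‖) := by
    intro v
    apply le_antisymm
    · obtain ⟨n, hn⟩ := exists_nat_ge ‖v‖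
      refine le_trans (le_of_eq ?_) (le_iSup _ n)
      rw [pw, if_pos lz]
    · exact iSup_le fun n => ofReal_le_ofReal (pw_le (norm_nonneg _))
  have hml : Measurable fun s => ∫⁻ v, ofReal (‖v‖ ^ (p+1)) ∂(solP μ s) :=
    (Measure.measurable_lintegral (measurable_norm.pow_const _).ennreal_ofReal).comp hx.meas
  have hfin : ∫⁻ s in Ioc 0 T, ∫⁻ v, ofReal (‖v‖ ^ (p+1)) ∂(solP μ s) ≠ ⊤ := by
    have : ∫⁻ s in Ioc 0 T, ∫⁻ v, ofReal (‖v‖ ^ (p+1)) ∂(solP μ s) ≤ ofReal (D / c) := by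
      simp only [hsup]
      have e1 : ∀ s, ∫⁻ v, ⨆ n : ℕ, ofReal (pw p (n+1) ‖v‖) ∂(solP μ s) = ⨆ n : ℕ, ∫⁻ v, ofReal (pw p (n+1) ‖v‖) ∂(solP μ s) :=
        fun s => lintegral_iSup (fun n => meas_pw.ennreal_ofReal) (fun n k h v => hmono v h)
      simp only [e1]
      have e2 := lintegral_iSup (μ := volume.restrict (Ioc 0 T)) (f := fun (n : ℕ) s => ∫⁻ v, ofReal (pw p (n+1) ‖v‖) ∂(solP μ s))
        (fun n => (Measure.measurable_lintegral meas_pw.ennreal_ofReal).comp hx.meas)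
        (fun n k h s => lintegral_mono fun v => hmono v h)
      rw [e2]
      exact iSup_le key
    exact (this.trans_lt ENNReal.ofReal_lt_top).ne
  have hmv : ∀ s, AEStronglyMeasurable (fun v : Ed => ‖v‖ ^ (p+1)) (solP μ s) := fun s => (measurable_norm.pow_const _).aestronglyMeasurable
  constructor
  · filter_upwards [ae_lt_top hml hfin] with s hs
    exact ⟨hmv s, by rwa [hasFiniteIntegral_iff_ofReal (Eventually.of_forall h0)]⟩
  · refine (integrable_toReal_of_lintegral_ne_top hml.aemeasurable hfin).congr (Eventually.of_forall fun s => ?_)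
    simp only
    rw [integral_eq_lintegral_of_nonneg_ae (Eventually.of_forall h0) (hmv s)]
end
section
lemma emp_pos (hν : ν ∈ empiricalSphere d N) : 0 < N := by
  rcases Nat.eq_zero_or_pos N with h | h
  · subst h
    obtain ⟨⟨h1, h2⟩, x, hx⟩ := hν
    have := h1.measure_univ
    rw [hx] at this
    simp at this
  · exact h
lemma emp_intg (hν : ν ∈ empiricalSphere d N) (hf : Measurable f) : Integrable f ν := by
  have hN := emp_pos hν
  obtain ⟨⟨h1, h2⟩, x, hx⟩ := hν
  rw [hx]
  refine Integrable.smul_measure ?_ (by simp [hN.ne'])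
  rw [integrable_finset_sum_measure]
  intro i _
  exact integrable_dirac' hf.stronglyMeasurable (by simp)
lemma emp_supp (hν : ν ∈ empiricalSphere d N) : ∀ᵐ v ∂ν, ‖v‖ ≤ √N := by
  have hN := emp_pos hν
  have h1 := (S2_of_mem hν.1).one
  obtain ⟨_, x, hx⟩ := hν
  rw [hx, emp_int] at h1
  have hN' : (0:ℝ) < N := by exact_mod_cast hN
  have h2 : ∀ i, ‖x i‖ ≤ √N := by
    intro i
    apply le_sqrt_of_sq_le
    have h3 : ∑ i, ‖x i‖ ^ 2 = N := by field_simp at h1; linarith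
    rw [← h3]
    exact Finset.single_le_sum (f := fun i => ‖x i‖ ^ 2) (fun i _ => by positivity) (Finset.mem_univ i)
  rw [hx, ae_iff, Measure.smul_apply, Measure.finset_sum_apply]
  have hms : MeasurableSet {a : Ed | ¬ ‖a‖ ≤ √N} := (measurableSet_le measurable_norm measurable_const).compl
  simp [Measure.dirac_apply' _ hms, h2]
lemma pov_D {C : ℝ} (hp : 2 < p) (c0 : 0 < c) (C0 : 0 < C) : ∃ D : ℝ, 0 ≤ D ∧ ∀ x : ℝ, 0 ≤ x → C * (2 * x ^ (p-1)) ≤ c * x ^ (p+1) + D := by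
  refine ⟨C * (2 * (√(2*C/c)) ^ (p-1)), pz, fun x hx => ?_⟩
  have h1 : 0 ≤ x ^ (p-1) := pz
  rcases le_total x (√(2*C/c)) with h | h
  · have := rpow_le_rpow hx h (show (0:ℝ) ≤ p - 1 by linarith)
    have h2 : 0 ≤ x ^ (p+1) := pz
    have := mul_le_mul_of_nonneg_left this C0.le
    have := mul_nonneg c0.le h2
    linarith
  · have h3 : 2*C/c ≤ x^2 := by
      have := Real.sqrt_le_left hx |>.1 h; exact this
    rw [div_le_iff₀ c0] at h3
    have e : x ^ (p+1) = x ^ (p-1) * x ^ 2 := by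
      rw [← rpow_natCast x 2, ← Real.rpow_add_of_nonneg hx lz nz]
      congr 1; push_cast; ring
    rw [e]
    have := mul_le_mul_of_nonneg_left h3 h1
    have h4 : 0 ≤ C * (2 * (√(2*C/c)) ^ (p-1)) := pz
    linarith
lemma meas_tI {Ω : Type*} [MeasurableSpace Ω] {g : ℝ × Ω → ℝ} (hg : Measurable g) (T : ℝ) : Measurable (fun ω => ∫ s in Ioc 0 T, g (s, ω)) :=
  (StronglyMeasurable.integral_prod_right' (ν := volume.restrict (Ioc 0 T)) (hg.comp measurable_swap).stronglyMeasurable).measurable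
variable (hK : GoodK B κ K)
variable {Ω : Type*} [m : MeasurableSpace Ω] {P : Measure Ω} [IsProbabilityMeasure P] {𝓕 : Filtration ℝ m}
  {μp : ℝ → Ω → Measure (Vd d)} (hk : IsKacProcess B N P 𝓕 μp)
include hk
lemma kac_measf (hf : Measurable f) : Measurable (fun q : ℝ × Ω => ∫ v, f v ∂(μp q.1 q.2)) := by
  have h2 : ∀ q : ℝ × Ω, IsProbabilityMeasure (μp q.1 q.2) := fun q => (kac_S2 hk q.1 q.2).prob
  have : IsMarkovKernel (⟨_, path_meas2 hk⟩ : Kernel (ℝ × Ω) (Ed)) := ⟨h2⟩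
  exact (StronglyMeasurable.integral_kernel (κ := ⟨_, path_meas2 hk⟩) hf.stronglyMeasurable).measurable
lemma kac_N : 0 < N := by
  have := P.nonempty_of_neZero
  exact emp_pos (hk.mem 0 (Classical.arbitrary Ω))
lemma kac_intbd (hb : ∀ v, ‖v‖ ≤ √N → |f v| ≤ b) (s : ℝ) (ω : Ω) : |∫ v, f v ∂(μp s ω)| ≤ b := by
  have := (kac_S2 hk s ω).prob
  exact abs_int_le (by filter_upwards [emp_supp (hk.mem s ω)] with v hv using hb v hv)
lemma kac_I (hf : Measurable f) (hb : ∀ v, ‖v‖ ≤ √N → |f v| ≤ b) (T : ℝ) (ω : Ω) :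
    IntegrableOn (fun s => ∫ v, f v ∂(μp s ω)) (Ioc 0 T) :=
  bint b ((kac_measf hk hf).comp (measurable_id.prodMk measurable_const)) (fun s => kac_intbd hk hb s ω)
lemma kac_J (hf : Measurable f) (hb : ∀ v, ‖v‖ ≤ √N → |f v| ≤ b) (hT : 0 ≤ T) :
    Integrable (fun ω => ∫ s in Ioc 0 T, ∫ v, f v ∂(μp s ω)) P := by
  refine bint (b * T) (meas_tI (kac_measf hk hf) T) fun ω => ?_
  have := norm_setIntegral_le_of_norm_le_const (f := fun s => ∫ v, f v ∂(μp s ω)) (s := Ioc 0 T) (μ := volume) (C := b) (by simp)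
    (fun s _ => kac_intbd hk hb s ω)
  simpa [Measure.real, hT] using this
include hK
lemma pov_kac {C D M : ℝ} (hp : 2 < p) (hpv : Pov K p c C) (D0 : 0 ≤ D) (hD : ∀ x : ℝ, 0 ≤ x → C * (2 * x ^ (p-1)) ≤ c * x ^ (p+1) + D)
    (hM : 0 ≤ M) {A : Set Ω} (hA : MeasurableSet[𝓕 0] A) (hAM : ∀ ω ∈ A, Mo p (μp 0 ω) ≤ M) (hT : 0 ≤ T) :
    c * ∫ ω in A, (∫ s in Ioc 0 T, Mo (p+1) (μp s ω)) ∂P ≤ D * T + M := by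
  have hA' : MeasurableSet A := 𝓕.le 0 A hA
  have hN := kac_N hk
  have hR : 0 < √(N:ℝ) := pz
  have hpw : ∀ s ω, ∫ v, pw p (√N) ‖v‖ ∂(μp s ω) = Mo (p+1) (μp s ω) := by
    intro s ω
    refine integral_congr_ae ?_
    filter_upwards [emp_supp (hk.mem s ω)] with v hv
    rw [pw, if_pos hv]
  have mp : ∀ q : ℝ, Measurable (fun v : Ed => ‖v‖ ^ q) := fun q => measurable_norm.pow_const _
  have h1 : ∀ ω ∈ A, c * ∫ s in Ioc 0 T, (Mo (p+1) (μp s ω)) ≤ D * T + M + Mt B (fun s => μp s ω) (gR p √N) T := by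
    intro ω hω
    have := pov_path hK hp hpv hR (kac_path hk ω) (emp_intg (hk.mem 0 ω) (mp p)) hT (D := D) (fun s _ => emp_intg (hk.mem s ω) (mp _)) (fun s _ => by
      have := (kac_S2 hk s ω).prob
      simp only [hpw]
      have i1 := emp_intg (hk.mem s ω) (mp (p-1))
      have i2 := emp_intg (hk.mem s ω) (mp (p+1))
      have := integral_mono (imul C (imul 2 i1)) (iadd (imul c i2) (integrable_const D)) (fun v => hD ‖v‖ (norm_nonneg v))
      rw [integral_add (imul c i2) (integrable_const D), integral_const_mul, integral_const_mul, integral_const_mul] at this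
      simpa using this)
    simp only [hpw] at this
    linarith [hAM ω hω]
  have g0 := gR_nn (d := d) hp hR
  have gb := gR_BM (d := d) hp hR
  have iM : Integrable (fun ω => Mt B (fun s => μp s ω) (gR p √N) T) P :=
    bint _ ((kac_adM hK hk gb g0 T hT).mono (𝓕.le T) le_rfl) (fun ω => Mt_bd hK hk gb T hT ω)
  have h2 : ∫ ω in A, Mt B (fun s => μp s ω) (gR p √N) T ∂P = 0 := by
    have := mart_orth (kac_M hK hk gb g0) hA le_rfl hT (ξ := fun _ => 1) measurable_const (c := 1) (by simp)
    refine Eq.trans ?_ this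
    refine integral_congr_ae (Eventually.of_forall fun ω => ?_)
    simp only [kac_Mt hK hk gb g0]
    simp; ring
  have i3 : Integrable (fun ω => ∫ s in Ioc 0 T, Mo (p+1) (μp s ω)) P := by
    refine kac_J hk (mp (p+1)) (b := (√N) ^ (p+1)) (fun v hv => ?_) hT
    rw [abs_of_nonneg pz]
    exact rpow_le_rpow (norm_nonneg _) hv lz
  have h3 := setIntegral_mono_on (i3.const_mul c).integrableOn (iadd (integrable_const (D * T + M)) iM).integrableOn hA' h1
  rw [integral_const_mul, integral_add (integrable_const _).integrableOn iM.integrableOn, h2] at h3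
  refine h3.trans ?_
  simp only [integral_const, add_zero, smul_eq_mul]
  have h5 : (P.restrict A).real Set.univ ≤ 1 := by
    rw [measureReal_restrict_apply_univ]
    exact measureReal_le_one
  have h6 : 0 ≤ D * T + M := pz
  have := mul_le_mul_of_nonneg_right h5 h6
  linarith
end
section
def Ann (d j : ℕ) : Set (Vd d) := {v | ‖v‖ ≤ 2 ^ j ∧ ∀ i < j, tw ^ i < ‖v‖}
def an (j : ℕ) (v : Ed) : ℝ := (Ann d j).indicator 1 v
def ci (j k : ℕ) (v : Ed) : Fin d → ℤ := fun i => ⌊tw ^ k * v i / 2 ^ j⌋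
def Zk (d k : ℕ) : Finset (Fin d → ℤ) := Fintype.piFinset fun _ => Finset.Icc (-2 ^ k) (2 ^ k)
open Classical in
def cl (j k : ℕ) (z : Fin d → ℤ) (v : Ed) : ℝ := if v ∈ Ann d j ∧ ci j k v = z then 1 else 0
open Classical in
def rep (j k : ℕ) (z : Fin d → ℤ) : Ed := if h : ∃ v, v ∈ Ann d j ∧ ci j k v = z then h.choose else 0
lemma rep_spec (hv : v ∈ Ann d j) : rep j k (ci j k v) ∈ Ann d j ∧ ci j k (rep j k (ci j k v)) = ci j k v := by
  have h : ∃ u, u ∈ Ann d j ∧ ci j k u = ci j k v := ⟨v, hv, rfl⟩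
  unfold rep
  rw [dif_pos h]
  exact h.choose_spec
lemma meas_Ann (j : ℕ) : MeasurableSet (Ann d j) := by
  unfold Ann
  have h2 : MeasurableSet {v : Ed | ∀ i < j, tw ^ i < ‖v‖} := by
    have : {v : Ed | ∀ i < j, tw ^ i < ‖v‖} = ⋂ i ∈ range j, {v : Ed | tw ^ i < ‖v‖} := by ext; simp
    rw [this]
    exact Finset.measurableSet_biInter _ fun i _ => measurableSet_lt measurable_const measurable_norm
  exact (measurableSet_le measurable_norm measurable_const).inter h2
lemma meas_ci (j k : ℕ) : Measurable (ci (d := d) j k) := by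
  refine measurable_pi_lambda _ fun i => Int.measurable_floor.comp ?_
  have : Measurable fun v : Ed => v i := mz
  exact (this.const_mul _).div_const _
lemma meas_cl (j k : ℕ) (z : Fin d → ℤ) : Measurable (cl (d := d) j k z) :=
  Measurable.ite ((meas_Ann j).inter (meas_ci j k (measurableSet_singleton z))) measurable_const measurable_const
lemma cl_nn (j k : ℕ) (z : Fin d → ℤ) (v : Ed) : 0 ≤ cl j k z v := by unfold cl; split_ifs <;> norm_num
lemma cl_BM (j k : ℕ) (z : Fin d → ℤ) : BM 1 (cl (d := d) j k z) :=
  ⟨meas_cl j k z, fun v => by unfold cl; split_ifs <;> norm_num⟩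
lemma an_BM (j : ℕ) : BM 1 (an (d := d) j) :=
  ⟨measurable_one.indicator (meas_Ann j), fun v => by by_cases h : v ∈ Ann d j <;> simp [an, h]⟩
lemma an_nn (j : ℕ) (v : Ed) : 0 ≤ an j v := by by_cases h : v ∈ Ann d j <;> simp [an, h]
lemma Zk_card (k : ℕ) : ((Zk d k).card : ℝ) ≤ (3 * 2 ^ k) ^ d := by
  unfold Zk
  simp only [Fintype.card_piFinset, Int.card_Icc, Finset.prod_const, Finset.card_univ, Fintype.card_fin]
  push_cast
  gcongr
  have : (((2:ℤ) ^ k + 1 - -2 ^ k).toNat : ℝ) = 2 ^ k + 1 + 2 ^ k := by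
    have : ((2:ℤ) ^ k + 1 - -2 ^ k).toNat = 2 ^ k + 1 + 2 ^ k := by
      have : ((2:ℤ) ^ k + 1 - -2 ^ k) = ((2 ^ k + 1 + 2 ^ k : ℕ) : ℤ) := by push_cast; ring
      rw [this, Int.toNat_natCast]
    rw [this]; push_cast; ring
  rw [this]
  have : (1:ℝ) ≤ 2 ^ k := one_le_pow₀ nz
  linarith
lemma ci_mem (hv : v ∈ Ann d j) : ci j k v ∈ Zk d k := by
  unfold Zk
  rw [Fintype.mem_piFinset]
  intro i
  have h1 : |v i| ≤ 2 ^ j := (PiLp.norm_apply_le v i).trans hv.1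
  rw [abs_le] at h1
  have h2 : (0:ℝ) < 2 ^ k := pz
  have h3 : (0:ℝ) < 2 ^ j := pz
  rw [Finset.mem_Icc]
  unfold ci
  constructor
  · rw [Int.le_floor]
    push_cast
    rw [le_div_iff₀ h3]
    nlinarith
  · rw [← Int.cast_le (R := ℝ)]
    refine (Int.floor_le _).trans ?_
    push_cast
    rw [div_le_iff₀ h3]
    nlinarith
lemma ci_nest (h : ci j (k+1) v = ci j (k+1) u) : ci j k v = ci j k u := by
  have key : ∀ w : Ed, ∀ i, ci j k w i = ci j (k+1) w i / 2 := by
    intro w i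
    unfold ci
    have e : tw ^ k * w i / 2 ^ j = (tw ^ (k+1) * w i / 2 ^ j) / ((2:ℕ):ℝ) := by push_cast; rw [pow_succ]; ring
    rw [e, Int.floor_div_natCast]; norm_num
  ext i
  rw [key, key, h]
lemma ci_diam (h : ci j k v = ci j k u) : ‖v - u‖ ≤ d * (2 ^ j / 2 ^ k) := by
  have h1 : ∀ i, |(v - u) i| ≤ 2 ^ j / 2 ^ k := by
    intro i
    have := Int.abs_sub_lt_one_of_floor_eq_floor (congrFun h i)
    have e : tw ^ k * v i / 2 ^ j - tw ^ k * u i / 2 ^ j = (v - u) i * (2 ^ k / 2 ^ j) := by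
      simp; ring
    rw [e, abs_mul, abs_of_pos (show (0:ℝ) < 2 ^ k / 2 ^ j by positivity)] at this
    rw [le_div_iff₀ pz]
    have h3 : (0:ℝ) < 2 ^ j := pz
    rw [← mul_div_assoc, div_lt_one h3] at this
    exact this.le
  have h0 : (0:ℝ) ≤ 2 ^ j / 2 ^ k := pz
  rw [EuclideanSpace.norm_eq]
  apply Real.sqrt_le_iff.2 ⟨pz, ?_⟩
  have : ∑ i, ‖(v - u) i‖ ^ 2 ≤ ∑ i : Fin d, (tw ^ j / 2 ^ k) ^ 2 :=
    sum_le_sum fun i _ => by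
      rw [norm_eq_abs]
      exact pow_le_pow_left₀ (abs_nonneg _) (h1 i) 2
  refine this.trans ?_
  simp only [Finset.sum_const, Finset.card_univ, Fintype.card_fin, nsmul_eq_mul]
  rw [mul_pow]
  refine mul_le_mul_of_nonneg_right ?_ pz
  rcases Nat.eq_zero_or_pos d with h | h
  · subst h; simp
  · have : (1:ℝ) ≤ d := by exact_mod_cast h
    nlinarith
structure LinF (m : (Fn) → ℝ) : Prop where
  add : ∀ (F G : Fn) (b b' : ℝ), BM b F → BM b' G → ∀ k, m (fun v => F v + k * G v) = m F + k * m G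
lemma LinF.zero {m : (Fn) → ℝ} (h : LinF m) : m (fun _ => 0) = 0 := by
  have h0 : BM 0 (fun _ : Ed => (0:ℝ)) := ⟨measurable_const, by simp⟩
  have := h.add _ _ 0 0 h0 h0 1
  simp at this
  exact this
lemma LinF.sum {m : (Fn) → ℝ} (h : LinF m) {ι : Type*} (s : Finset ι) {F : ι → Ed → ℝ} (hF : ∀ i, BM b (F i)) (a : ι → ℝ) :
    BM (∑ i ∈ s, |a i| * b) (fun v => ∑ i ∈ s, a i * F i v) ∧ m (fun v => ∑ i ∈ s, a i * F i v) = ∑ i ∈ s, a i * m (F i) := by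
  classical
  induction s using Finset.induction_on with
  | empty => simp [h.zero]; exact ⟨measurable_const, by simp⟩
  | insert i s hi ih =>
    simp only [Finset.sum_insert hi]
    constructor
    · have := ih.1.add (hF i) (a i)
      simpa only [add_comm] using this
    · have := h.add _ _ _ _ ih.1 (hF i) (a i)
      rw [ih.2] at this
      rw [add_comm (a i * m (F i)), ← this]
      simp only [add_comm]
variable {m : (Vd d → ℝ) → ℝ} (hm : LinF m)
include hm
lemma pc {a : ℝ} (h0 : ∀ v, v ∉ Ann d j → F v = 0)
    (h1 : ∀ v u, v ∈ Ann d j → u ∈ Ann d j → ci j k v = ci j k u → F v = F u) (h2 : ∀ v, |F v| ≤ a) :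
    BM a F ∧ |m F| ≤ a * ∑ z ∈ Zk d k, |m (cl j k z)| := by
  classical
  have e : F = fun v => ∑ z ∈ Zk d k, F (rep j k z) * cl j k z v := by
    ext v
    by_cases hv : v ∈ Ann d j
    · rw [Finset.sum_eq_single (ci j k v)]
      · obtain ⟨r1, r2⟩ := rep_spec (k := k) hv
        rw [cl, if_pos ⟨hv, rfl⟩, mul_one]
        exact h1 _ _ hv r1 r2.symm
      · intro z _ hz
        rw [cl, if_neg (fun h => hz h.2.symm), mul_zero]
      · intro h; exact absurd (ci_mem hv) h
    · rw [h0 v hv]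
      symm
      exact Finset.sum_eq_zero fun z _ => by rw [cl, if_neg (fun h => hv h.1), mul_zero]
  obtain ⟨s1, s2⟩ := hm.sum (Zk d k) (fun z => cl_BM j k z) (fun z => F (rep j k z))
  rw [← e] at s1 s2
  refine ⟨⟨s1.meas, h2⟩, ?_⟩
  rw [s2, mul_sum]
  refine (abs_sum_le_sum_abs _ _).trans (sum_le_sum fun z _ => ?_)
  rw [abs_mul]
  exact mul_le_mul_of_nonneg_right (h2 _) (abs_nonneg _)
open Classical in
omit hm in
def hk (j k : ℕ) (h : Fn) (v : Ed) : ℝ := if v ∈ Ann d j then h (rep j k (ci j k v)) else 0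
lemma chain0 {h : Fn} (hd : 1 ≤ d) (b0 : 0 ≤ b) (hb : ∀ v ∈ Ann d j, |h v| ≤ b)
    (hL : ∀ v ∈ Ann d j, ∀ u ∈ Ann d j, |h v - h u| ≤ b / 2 ^ j * ‖v - u‖) (k : ℕ) :
    BM b (hk j k h) ∧ |m (hk j k h)| ≤ ∑ i ∈ range (k+1), (2 * d * b / 2 ^ i) * ∑ z ∈ Zk d i, |m (cl j i z)| := by
  have hd' : (1:ℝ) ≤ d := by exact_mod_cast hd
  have bd : ∀ k v, |hk j k h v| ≤ b := by
    intro k v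
    unfold hk
    split_ifs with hv
    · exact hb _ (rep_spec hv).1
    · simpa using b0
  have p0 : ∀ k, ∀ v u, v ∈ Ann d j → u ∈ Ann d j → ci j k v = ci j k u → hk j k h v = hk j k h u := by
    intro k v u hv hu huv
    unfold hk
    rw [if_pos hv, if_pos hu, huv]
  have z0 : ∀ k, ∀ v, v ∉ Ann d j → hk j k h v = 0 := by
    intro k v hv; unfold hk; rw [if_neg hv]
  induction k with
  | zero =>
    obtain ⟨q1, q2⟩ := pc hm (z0 0) (p0 0) (bd 0)
    refine ⟨q1, q2.trans ?_⟩
    simp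
    refine mul_le_mul_of_nonneg_right ?_ (sum_nonneg fun _ _ => abs_nonneg _)
    nlinarith
  | succ k ih =>
    obtain ⟨q1, q2⟩ := pc hm (z0 (k+1)) (p0 (k+1)) (bd (k+1))
    refine ⟨q1, ?_⟩
    have q3 := pc hm (j := j) (k := k+1) (F := fun v => hk j (k+1) h v + (-1) * hk j k h v) (a := 2 * d * b / 2 ^ (k+1))
      (fun v hv => by simp only [z0 _ v hv]; ring)
      (fun v u hv hu huv => by simp only [p0 (k+1) v u hv hu huv, p0 k v u hv hu (ci_nest huv)])
      (fun v => by
        by_cases hv : v ∈ Ann d j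
        · obtain ⟨r1, r2⟩ := rep_spec (k := k+1) hv
          obtain ⟨r3, r4⟩ := rep_spec (k := k) hv
          have h5 := hL _ r1 _ r3
          have h6 := ci_diam ((ci_nest r2).trans r4.symm)
          have e : hk j (k+1) h v + (-1) * hk j k h v = h (rep j (k+1) (ci j (k+1) v)) - h (rep j k (ci j k v)) := by
            unfold hk; rw [if_pos hv, if_pos hv]; ring
          rw [e]
          refine h5.trans ((mul_le_mul_of_nonneg_left h6 pz).trans (le_of_eq ?_))
          rw [pow_succ]
          field_simp
        · simp only [z0 _ v hv]; simp; positivity)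
    rw [hm.add _ _ _ _ q1 ih.1 (-1)] at q3
    rw [Finset.sum_range_succ]
    have : m (hk j (k+1) h) = m (hk j k h) + (m (hk j (k+1) h) + -1 * m (hk j k h)) := by ring
    rw [this]
    exact (abs_add_le _ _).trans (add_le_add ih.2 q3.2)
lemma chain1 {h : Fn} {ρ : ℝ} (hd : 1 ≤ d) (b0 : 0 ≤ b) (hmh : Measurable h) (hb : ∀ v ∈ Ann d j, |h v| ≤ b)
    (hL : ∀ v ∈ Ann d j, ∀ u ∈ Ann d j, |h v - h u| ≤ b / 2 ^ j * ‖v - u‖)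
    (hρ : ∀ F c, 0 ≤ c → Measurable F → (∀ v, |F v| ≤ c * an j v) → |m F| ≤ c * (|m (an j)| + ρ)) (k : ℕ) :
    |m ((Ann d j).indicator h)| ≤ (∑ i ∈ range (k+1), (3 * d * b / 2 ^ i) * ∑ z ∈ Zk d i, |m (cl j i z)|) + d * b / 2 ^ k * ρ := by
  obtain ⟨c1, c2⟩ := chain0 hm hd b0 hb hL k
  have hA : |m (an j)| ≤ 1 * ∑ z ∈ Zk d 0, |m (cl j 0 z)| :=
    (pc hm (j := j) (k := 0) (F := an j) (fun v hv => by simp [an, hv]) (fun v u hv hu _ => by simp [an, hv, hu]) (an_BM j).bd).2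
  have i1 : BM b ((Ann d j).indicator h) := ⟨hmh.indicator (meas_Ann j), fun v => by
    by_cases hv : v ∈ Ann d j
    · simpa [hv] using hb v hv
    · simpa [hv] using b0⟩
  have h3 := hρ (fun v => (Ann d j).indicator h v + (-1) * hk j k h v) (d * b / 2 ^ k) pz (i1.add c1 (-1)).meas (fun v => by
    by_cases hv : v ∈ Ann d j
    · obtain ⟨r1, r2⟩ := rep_spec (k := k) hv
      have h5 := hL _ hv _ r1
      have h6 := ci_diam r2.symm
      simp only [hk, hv, an, indicator_of_mem, if_true]
      have e : h v + (-1) * h (rep j k (ci j k v)) = h v - h (rep j k (ci j k v)) := by ring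
      rw [e]
      refine h5.trans ((mul_le_mul_of_nonneg_left h6 pz).trans (le_of_eq ?_))
      simp
      field_simp
    · simp [hk, hv, an])
  rw [hm.add _ _ _ _ i1 c1 (-1)] at h3
  have e : m ((Ann d j).indicator h) = m (hk j k h) + (m ((Ann d j).indicator h) + -1 * m (hk j k h)) := by ring
  have h4 : |m ((Ann d j).indicator h)| ≤ |m (hk j k h)| + |m ((Ann d j).indicator h) + -1 * m (hk j k h)| := by
    conv_lhs => rw [e]
    exact abs_add_le _ _
  have h5 : d * b / 2 ^ k * |m (an j)| ≤ ∑ i ∈ range (k+1), (d * b / 2 ^ i) * ∑ z ∈ Zk d i, |m (cl j i z)| := by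
    have p : ∀ i, 0 ≤ (d * b / 2 ^ i) * ∑ z ∈ Zk d i, |m (cl j i z)| := fun i => mul_nonneg pz (sum_nonneg fun _ _ => abs_nonneg _)
    refine le_trans ?_ (Finset.single_le_sum (fun i _ => p i) (mem_range.2 (Nat.succ_pos k)))
    rw [one_mul] at hA
    refine mul_le_mul ?_ hA (abs_nonneg _) pz
    exact div_le_div_of_nonneg_left pz pz (by simpa using one_le_pow₀ (nz : (1:ℝ) ≤ 2))
  have e2 : (∑ i ∈ range (k+1), (3 * d * b / 2 ^ i) * ∑ z ∈ Zk d i, |m (cl j i z)|) =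
      (∑ i ∈ range (k+1), (2 * d * b / 2 ^ i) * ∑ z ∈ Zk d i, |m (cl j i z)|) + ∑ i ∈ range (k+1), (d * b / 2 ^ i) * ∑ z ∈ Zk d i, |m (cl j i z)| := by
    rw [← sum_add_distrib]
    exact Finset.sum_congr rfl fun i _ => by ring
  rw [e2]
  linarith
end
section
lemma ann_sum {J : ℕ} (hF : ∀ v, tw ^ J ≤ ‖v‖ → F v = 0) (v : Ed) :
    F v = ∑ j ∈ range (J+1), (1:ℝ) * (Ann d j).indicator F v := by
  simp only [one_mul]
  by_cases h0 : F v = 0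
  · rw [h0]; symm
    refine Finset.sum_eq_zero fun j _ => ?_
    by_cases hv : v ∈ Ann d j <;> simp [hv, h0]
  · have h1 : ‖v‖ < 2 ^ J := not_le.1 fun h => h0 (hF v h)
    classical
    have hex : ∃ j : ℕ, ‖v‖ ≤ 2 ^ j := ⟨J, h1.le⟩
    have hj := Nat.find_spec hex
    have hm : v ∈ Ann d (Nat.find hex) := ⟨hj, fun i hi => not_le.1 (Nat.find_min hex hi)⟩
    rw [Finset.sum_eq_single (Nat.find hex)]
    · simp [hm]
    · intro j _ hne
      apply indicator_of_notMem
      intro hv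
      rcases lt_or_gt_of_ne hne with h | h
      · exact absurd hv.1 (not_le.2 (hm.2 j h))
      · exact absurd hj (not_le.2 (hv.2 _ h))
    · intro h
      exact absurd (mem_range.2 (Nat.lt_succ_of_le (Nat.find_min' hex h1.le))) h
lemma w3_ann (hv : v ∈ Ann d j) : w3 v ≤ 4 * 8 ^ j := by
  have h1 := hv.1
  have h2 : (1:ℝ) ≤ 2 ^ j := one_le_pow₀ nz
  have h3 : (1 + ‖v‖) * (1 + ‖v‖ ^ 2) ≤ (2 * 2 ^ j) * (2 * (2 ^ j) ^ 2) := by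
    have : ‖v‖ ^ 2 ≤ (2 ^ j) ^ 2 := pow_le_pow_left₀ (norm_nonneg _) h1 2
    have : (1:ℝ) ≤ (2 ^ j) ^ 2 := one_le_pow₀ h2
    apply mul_le_mul <;> first | positivity | linarith
  refine h3.trans (le_of_eq ?_)
  rw [← pow_mul, mul_comm j 2, pow_mul, show (8:ℝ) = 2 * 2 ^ 2 by norm_num, mul_pow]
  ring
def ZZ (d J K : ℕ) (m : (Vd d → ℝ) → ℝ) : ℝ :=
  ∑ j ∈ range (J+2), ∑ i ∈ range (K+1), (48 * d * 16 ^ j / 2 ^ i) * ∑ z ∈ Zk d i, |m (cl j i z)|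
lemma chain2 {m : (Fn) → ℝ} (hm : LinF m) (hd : 1 ≤ d) {ρ : ℕ → ℝ}
    (hρ : ∀ j F c, 0 ≤ c → Measurable F → (∀ v, |F v| ≤ c * an j v) → |m F| ≤ c * (|m (an j)| + ρ j)) (J K : ℕ) (hg : AR (2 ^ J) 1 w3 g) : |m (cut (2 ^ J) g)| ≤ ZZ d J K m + ∑ j ∈ range (J+2), 16 * d * 16 ^ j / 2 ^ K * ρ j := by
  have hR : (1:ℝ) ≤ 2 ^ J := one_le_pow₀ nz
  have hc := cut_cont hR one_le_w3 cont_w3 zero_le_one hg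
  have hz : ∀ v : Ed, tw ^ (J+1) ≤ ‖v‖ → cut (2 ^ J) g v = 0 := fun v hv => cut_zero hR g (by rw [pow_succ] at hv; linarith)
  have hBM := BM_cut hR zero_le_one hg
  have e : cut (2 ^ J) g = fun v => ∑ j ∈ range (J+2), (1:ℝ) * (Ann d j).indicator (cut (2 ^ J) g) v := funext fun v => ann_sum hz v
  have hi : ∀ j, BM (1 * (1 + 2 * 2 ^ J) ^ 3) ((Ann d j).indicator (cut (2 ^ J) g)) := fun j => ⟨hBM.meas.indicator (meas_Ann j), fun v => by
    by_cases hv : v ∈ Ann d j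
    · simpa [hv] using hBM.bd v
    · simp [hv]; positivity⟩
  have h1 := (hm.sum (range (J+2)) hi (fun _ => 1)).2
  rw [← e] at h1
  rw [h1, ZZ, ← sum_add_distrib]
  refine (abs_sum_le_sum_abs _ _).trans (sum_le_sum fun j _ => ?_)
  rw [one_mul]
  have h8 : (0:ℝ) < 8 ^ j := pz
  have e16 : (16:ℝ) ^ j = 8 ^ j * 2 ^ j := by rw [← mul_pow]; norm_num
  have h2j : (1:ℝ) ≤ 2 ^ j := one_le_pow₀ nz
  have := chain1 hm (h := cut (2 ^ J) g) (b := 16 * 16 ^ j) hd pz hBM.meas (fun v hv => by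
      refine (cut_bd hR one_le_w3 zero_le_one hg v).trans ?_
      have := w3_ann hv
      rw [e16]
      nlinarith) (fun v hv u hu => by
      refine (cut_lip hR one_le_w3 zero_le_one hg v u).trans ?_
      have h1 := w3_ann hv
      have h2 := w3_ann hu
      have h3 : (1 + (tw ^ J)⁻¹) ≤ 2 := by have := inv_le_one_of_one_le₀ hR; linarith
      have e2 : 16 * (16:ℝ) ^ j / 2 ^ j * ‖v - u‖ = 1 * (‖v - u‖ * (8 * 8 ^ j)) * 2 := by
        rw [e16]; field_simp; ring
      rw [e2]
      gcongr
      linarith) (hρ j) K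
  refine this.trans (le_of_eq ?_)
  congr 1
  · refine Finset.sum_congr rfl fun i _ => ?_
    ring
  · ring
def SS (p : ℝ) (J : ℕ) : ℝ := ∑ j ∈ range (J+2), (16 * √(tw ^ (-p))) ^ j
def UU (d K : ℕ) : ℝ := ∑ i ∈ range (K+1), (√(tw ^ d) / 2) ^ i
def dj (p : ℝ) (j : ℕ) : ℝ := 2 ^ p * (tw ^ (-p)) ^ j
lemma dj_pos (p : ℝ) (j : ℕ) : 0 < dj p j := by unfold dj; positivity
lemma num1 {L n : ℝ} (hL : 0 ≤ L) (hn : 0 ≤ n) (J K : ℕ) {G : ℕ → ℕ → (Fin d → ℤ) → ℝ} (G0 : ∀ j i z, 0 ≤ G j i z)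
    (hG : ∀ j i, ∑ z ∈ Zk d i, G j i z ≤ dj p j * L) :
    ∑ j ∈ range (J+2), ∑ i ∈ range (K+1), (48 * d * 16 ^ j / 2 ^ i) * ∑ z ∈ Zk d i, √(n * G j i z) ≤
      48 * d * √(3 ^ d * 2 ^ p * L) * (SS p J * (√n * UU d K)) := by
  have key : ∀ j i, ∑ z ∈ Zk d i, √(n * G j i z) ≤ √(3 ^ d * 2 ^ p * L) * √n * ((√(tw ^ d)) ^ i * √(tw ^ (-p)) ^ j) := by
    intro j i
    have h1 := Real.sum_sqrt_mul_sqrt_le (Zk d i) (f := fun _ => 1) (g := fun z => n * G j i z) (fun _ => zero_le_one) (fun z => mul_nonneg hn (G0 j i z))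
    simp only [Real.sqrt_one, one_mul, Finset.sum_const, nsmul_eq_mul, mul_one] at h1
    refine h1.trans ?_
    rw [← mul_sum, ← sqrt_mul pz]
    have e : √(3 ^ d * 2 ^ p * L) * √n * ((√(tw ^ d)) ^ i * √(tw ^ (-p)) ^ j) = √((3 * 2 ^ i) ^ d * (n * (dj p j * L))) := by
      have sp : ∀ (x : ℝ) (k : ℕ), 0 ≤ x → √x ^ k = √(x ^ k) := fun x k hx => by
        rw [eq_comm, Real.sqrt_eq_iff_mul_self_eq pz pz, ← mul_pow, Real.mul_self_sqrt hx]
      rw [sp _ _ pz, sp _ _ pz, ← sqrt_mul pz, ← sqrt_mul pz, ← sqrt_mul pz]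
      congr 1
      unfold dj
      rw [mul_pow, ← pow_mul, ← pow_mul, mul_comm i d]
      ring
    rw [e]
    apply Real.sqrt_le_sqrt
    have := Zk_card (d := d) i
    have := hG j i
    have : 0 ≤ ∑ z ∈ Zk d i, G j i z := sum_nonneg fun z _ => G0 j i z
    gcongr
  unfold SS UU
  rw [Finset.sum_mul, mul_sum]
  refine sum_le_sum fun j _ => ?_
  rw [mul_sum, mul_sum, mul_sum]
  refine sum_le_sum fun i _ => ?_
  refine (mul_le_mul_of_nonneg_left (key j i) pz).trans (le_of_eq ?_)
  rw [div_pow, mul_pow]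
  ring
lemma num2 {L : ℝ} (hp : 0 ≤ p) (hL : 0 ≤ L) (J K : ℕ) :
    ∑ j ∈ range (J+2), 16 * d * 16 ^ j / 2 ^ K * (dj p j * L) ≤ 16 * d * 2 ^ p * L * (SS p J * (1 / 2 ^ K)) := by
  unfold SS
  rw [Finset.sum_mul, mul_sum]
  refine sum_le_sum fun j _ => ?_
  have h1 : tw ^ (-p) ≤ √(tw ^ (-p)) := by
    apply le_sqrt_of_sq_le
    have h0 : (0:ℝ) ≤ 2 ^ (-p) := pz
    have : tw ^ (-p) ≤ 1 := Real.rpow_le_one_of_one_le_of_nonpos nz lz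
    nlinarith
  have h2 : (tw ^ (-p)) ^ j ≤ √(tw ^ (-p)) ^ j := pow_le_pow_left₀ pz h1 j
  unfold dj
  rw [mul_pow]
  have e1 : 16 * (d:ℝ) * 16 ^ j / 2 ^ K * (2 ^ p * (2 ^ (-p)) ^ j * L) = (16 * d * 16 ^ j / 2 ^ K * 2 ^ p * L) * (2 ^ (-p)) ^ j := by ring
  have e2 : 16 * (d:ℝ) * 2 ^ p * L * (16 ^ j * √(2 ^ (-p)) ^ j * (1 / 2 ^ K)) = (16 * d * 16 ^ j / 2 ^ K * 2 ^ p * L) * √(2 ^ (-p)) ^ j := by ring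
  rw [e1, e2]
  exact mul_le_mul_of_nonneg_left h2 pz
end
section
lemma an_le (hp : 0 ≤ p) (j : ℕ) (u : Ed) : an j u ≤ dj p j * (1 + ‖u‖ ^ p) := by
  have h0 : 0 ≤ ‖u‖ ^ p := pz
  have hj := dj_pos p j
  by_cases hu : u ∈ Ann d j
  · have e : an j u = 1 := by simp [an, hu]
    rw [e]
    rcases j with _ | j
    · have : 1 ≤ dj p 0 := by simpa [dj] using Real.one_le_rpow (nz : (1:ℝ) ≤ 2) hp
      nlinarith
    · have h1 := hu.2 j (Nat.lt_succ_self j)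
      have h2 : (tw ^ j) ^ p ≤ ‖u‖ ^ p := rpow_le_rpow pz h1.le hp
      have h3 : dj p (j+1) * (tw ^ j) ^ p = 1 := by
        unfold dj
        rw [← rpow_natCast (tw ^ (-p)), ← rpow_natCast 2 j, ← rpow_mul nz, ← rpow_mul nz,
          ← rpow_add nz, ← rpow_add nz]
        rw [show p + -p * ((j+1 : ℕ):ℝ) + j * p = 0 by push_cast; ring, Real.rpow_zero]
      nlinarith [mul_le_mul_of_nonneg_left h2 hj.le]
  · have e : an j u = 0 := by simp [an, hu]
    rw [e]; positivity
lemma cl_sum (j k : ℕ) (u : Ed) : ∑ z ∈ Zk d k, cl j k z u ≤ an j u := by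
  by_cases hu : u ∈ Ann d j
  · classical
    simp [cl, an, hu]
    split_ifs <;> norm_num
  · simp [cl, an, hu]
def Wp (p : ℝ) (v vs : Ed) : ℝ := 1 + 2 ^ (p+2) * (‖v‖ ^ (p+1) + ‖vs‖ ^ (p+1))
lemma Wp_ge (hp : 0 ≤ p) (v vs : Ed) : ‖v - vs‖ * (1 + (‖v‖ + ‖vs‖) ^ p) ≤ Wp p v vs := by
  set X := ‖v‖ + ‖vs‖
  have hX : 0 ≤ X := pz
  have h1 : ‖v - vs‖ ≤ X := norm_sub_le _ _
  refine (mul_le_mul_of_nonneg_right h1 pz).trans ?_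
  have h2 : X ^ (1:ℝ) ≤ 1 + X ^ (p+1) := pow_le_add zero_le_one lz hX
  have h3 : X * X ^ p = X ^ (p+1) := by rw [Real.rpow_add_one' hX lz]; ring
  have h4 : X ^ (p+1) ≤ 2 ^ (p+1) * (‖v‖ ^ (p+1) + ‖vs‖ ^ (p+1)) := by
    rcases le_total ‖v‖ ‖vs‖ with h | h
    · have : X ^ (p+1) ≤ (2 * ‖vs‖) ^ (p+1) := rpow_le_rpow hX (by simp only [X]; linarith) lz
      rw [mul_rpow nz (norm_nonneg _)] at this
      refine this.trans (mul_le_mul_of_nonneg_left (by linarith [Real.rpow_nonneg (norm_nonneg v) (p+1)]) pz)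
    · have : X ^ (p+1) ≤ (2 * ‖v‖) ^ (p+1) := rpow_le_rpow hX (by simp only [X]; linarith) lz
      rw [mul_rpow nz (norm_nonneg _)] at this
      refine this.trans (mul_le_mul_of_nonneg_left (by linarith [Real.rpow_nonneg (norm_nonneg vs) (p+1)]) pz)
  have h5 : tw ^ (p+2) = 2 ^ (p+1) * 2 := by rw [← rpow_add_one nz]; ring_nf
  rw [rpow_one] at h2
  unfold Wp
  rw [mul_add, h3, mul_one, h5]
  linarith
def PS (f : Fn) (v vs σ : Ed) : ℝ := f (postV v vs σ) + f (postVs v vs σ) + f v + f vs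
lemma PS_an (hp : 0 ≤ p) (j : ℕ) (v vs σ : Ed) (hσ : ‖σ‖ = 1) : PS (an j) v vs σ ≤ 4 * dj p j * (1 + (‖v‖ + ‖vs‖) ^ p) := by
  have en := energy v vs σ hσ
  have hb : ∀ u : Ed, ‖u‖ ≤ ‖v‖ + ‖vs‖ → an j u ≤ dj p j * (1 + (‖v‖ + ‖vs‖) ^ p) := fun u hu =>
    (an_le hp j u).trans (mul_le_mul_of_nonneg_left (by gcongr) (dj_pos p j).le)
  have n1 := norm_nonneg v
  have n2 := norm_nonneg vs
  have n12 := mul_nonneg n1 n2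
  have h1 := hb (postV v vs σ) (pow_le_pow_iff_left₀ (norm_nonneg _) pz two_ne_zero |>.1 (by nlinarith [sq_nonneg ‖postVs v vs σ‖]))
  have h2 := hb (postVs v vs σ) (pow_le_pow_iff_left₀ (norm_nonneg _) pz two_ne_zero |>.1 (by nlinarith [sq_nonneg ‖postV v vs σ‖]))
  have h3 := hb v lz
  have h4 := hb vs lz
  unfold PS; linarith
def Lp (p : ℝ) (ν : Ms) : ℝ := 1 + 2 ^ (p+3) * Mo (p+1) ν
lemma Wp_int [IsProbabilityMeasure ν] (hi : Integrable (fun v => ‖v‖ ^ (p+1)) ν) :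
    Integrable (fun x : Ed × Ed => Wp p x.1 x.2) (ν.prod ν) ∧ ∫ x, Wp p x.1 x.2 ∂(ν.prod ν) = Lp p ν := by
  have i1 : Integrable (fun x : Ed × Ed => ‖x.1‖ ^ (p+1)) (ν.prod ν) := hi.comp_fst ν
  have i2 : Integrable (fun x : Ed × Ed => ‖x.2‖ ^ (p+1)) (ν.prod ν) := hi.comp_snd ν
  have i3 := imul (tw ^ (p+2)) (iadd i1 i2)
  refine ⟨iadd (integrable_const 1) i3, ?_⟩
  unfold Wp Lp
  rw [integral_add (integrable_const 1) i3, integral_const_mul, integral_add i1 i2, integral_fun_fst (fun v : Ed => ‖v‖ ^ (p+1)),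
    integral_fun_snd (fun v : Ed => ‖v‖ ^ (p+1))]
  simp only [integral_const, probReal_univ, smul_eq_mul, one_mul]
  rw [show p + 3 = p + 2 + 1 by ring, rpow_add_one nz]; ring
variable (hK : GoodK B κ K) (hp : 0 ≤ p)
include hK hp
lemma KK_an (hc : 0 ≤ c) (hF : ∀ v, |F v| ≤ c * an j v) (v vs : Ed) :
    |KK K F v vs| ≤ c * (4 * dj p j) * Wp p v vs := by
  haveI := hK.markov
  have h1 : |∫ σ, Df F v vs σ ∂(K (v - vs))| ≤ c * (4 * dj p j * (1 + (‖v‖ + ‖vs‖) ^ p)) := by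
    apply abs_int_le
    filter_upwards [hK.sph (v - vs)] with σ hσ
    refine le_trans ?_ (mul_le_mul_of_nonneg_left (PS_an hp j v vs σ hσ) hc)
    have a1 := abs_le.1 (hF (postV v vs σ))
    have a2 := abs_le.1 (hF (postVs v vs σ))
    have a3 := abs_le.1 (hF v)
    have a4 := abs_le.1 (hF vs)
    unfold Df PS
    rw [abs_le]; constructor <;> linarith [a1.1, a1.2, a2.1, a2.2, a3.1, a3.2, a4.1, a4.2]
  unfold KK
  rw [abs_mul, abs_norm]
  have h2 := mul_le_mul_of_nonneg_left h1 (norm_nonneg (v - vs))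
  have h3 := mul_le_mul_of_nonneg_left (Wp_ge hp v vs) (by have := dj_pos p j; positivity : 0 ≤ c * (4 * dj p j))
  linarith
lemma Q_an (hc : 0 ≤ c) (hm : Measurable F) (hF : ∀ v, |F v| ≤ c * an j v) (hν : S2 ν)
    (hi : Integrable (fun v => ‖v‖ ^ (p+1)) ν) : |QInt B F ν ν| ≤ c * (4 * dj p j) * Lp p ν := by
  haveI := hν.prob
  have hb : ∀ v, |F v| ≤ c := fun v => (hF v).trans (mul_le_of_le_one_right hc ((le_abs_self _).trans ((an_BM j).bd v)))
  obtain ⟨w1, w2⟩ := Wp_int hi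
  rw [QInt_prod hK hm hb hν hν, ← w2, ← integral_const_mul]
  exact norm_integral_le_of_norm_le (f := fun x : Ed × Ed => KK K F x.1 x.2) (imul (c * (4 * dj p j)) w1) (Eventually.of_forall fun x => KK_an hK hp hc hF x.1 x.2)
lemma Gam_cl (j k : ℕ) (hν : S2 ν)
    (hi : Integrable (fun v => ‖v‖ ^ (p+1)) ν) : ∑ z ∈ Zk d k, Gam K (cl j k z) ν ≤ 16 * dj p j * Lp p ν := by
  haveI := hν.prob
  haveI := hK.markov
  obtain ⟨w1, w2⟩ := Wp_int hi
  have hs := cl_sum (d := d) j k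
  have e : ∀ z, Gam K (cl j k z) ν = ∫ x, KG K (cl j k z) x.1 x.2 ∂(ν.prod ν) := fun z =>
    (integral_prod (fun x : Ed × Ed => KG K (cl j k z) x.1 x.2) (KG_int hK (cl_BM j k z) hν hν)).symm
  simp only [e]
  rw [← integral_finsetSum _ fun z _ => KG_int hK (cl_BM j k z) hν hν, ← w2, ← integral_const_mul]
  refine integral_mono (integrable_finsetSum _ fun z _ => KG_int hK (cl_BM j k z) hν hν) (imul _ w1) fun x => ?_
  simp only
  obtain ⟨v, vs⟩ := x
  simp only [KG]
  rw [← mul_sum, ← integral_finsetSum _ fun z _ => bint _ ((meas_Df' (meas_cl j k z) v vs).pow_const 2) (fun σ => Df2_bd hK (cl_BM j k z).bd v vs σ)]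
  have h1 : |∫ σ, ∑ z ∈ Zk d k, Df (cl j k z) v vs σ ^ 2 ∂(K (v - vs))| ≤ 4 * (4 * dj p j * (1 + (‖v‖ + ‖vs‖) ^ p)) := by
    apply abs_int_le
    filter_upwards [hK.sph (v - vs)] with σ hσ
    rw [abs_of_nonneg pz]
    refine le_trans ?_ (mul_le_mul_of_nonneg_left (PS_an hp j v vs σ hσ) nz)
    have h2 : ∀ z, Df (cl j k z) v vs σ ^ 2 ≤ 4 * PS (cl j k z) v vs σ := by
      intro z
      have hc : ∀ u, cl (d := d) j k z u = 0 ∨ cl j k z u = 1 := fun u => by unfold cl; split_ifs <;> simp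
      unfold Df PS
      rcases hc (postV v vs σ) with h | h <;> rcases hc (postVs v vs σ) with h' | h' <;> rcases hc v with h3 | h3 <;>
        rcases hc vs with h4 | h4 <;> rw [h, h', h3, h4] <;> norm_num
    refine (sum_le_sum fun z _ => h2 z).trans ?_
    rw [← mul_sum]
    unfold PS
    simp only [sum_add_distrib]
    have := hs (postV v vs σ)
    have := hs (postVs v vs σ)
    have := hs v
    have := hs vs
    linarith
  have h2 := mul_le_mul_of_nonneg_left ((le_abs_self _).trans h1) (norm_nonneg (v - vs))
  have h3 := mul_le_mul_of_nonneg_left (Wp_ge hp v vs) (by have := dj_pos p j; positivity : 0 ≤ 16 * dj p j)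
  linarith
omit hp in
lemma Mt_LinF {x : ℝ → Ms} (hx : Path x) (r : ℝ) : LinF (fun F => Mt B x F r) :=
  ⟨fun _ _ _ _ hF hG k => Mt_add hK hx hF hG k r⟩
lemma Mt_rho {x : ℝ → Ms} (hx : Path x) (hi : ∀ s, Integrable (fun v => ‖v‖ ^ (p+1)) (x s)) (hL : IntegrableOn (fun s => Lp p (x s)) (Ioc 0 T)) (hr : r ≤ T) (j : ℕ) (F : Fn) (c : ℝ) (hc : 0 ≤ c) (hm : Measurable F)
    (hF : ∀ v, |F v| ≤ c * an j v) : |Mt B x F r| ≤ c * (|Mt B x (an j) r| +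
      dj p j * (2 * (1 + Mo p (x 0)) + 8 * ∫ s in Ioc 0 T, Lp p (x s))) := by
  have hb : BM c F := ⟨hm, fun v => (hF v).trans (mul_le_of_le_one_right hc ((le_abs_self _).trans ((an_BM j).bd v)))⟩
  have L0 : ∀ s, 0 ≤ Lp p (x s) := fun s => by
    have : 0 ≤ Mo (p+1) (x s) := integral_nonneg fun v => by positivity
    unfold Lp; positivity
  have q : ∀ (G : Fn) (b : ℝ), 0 ≤ b → Measurable G → (∀ v, |G v| ≤ b * an j v) →
      |∫ s in Ioc 0 r, QInt B G (x s) (x s)| ≤ b * (4 * dj p j) * ∫ s in Ioc 0 T, Lp p (x s) := by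
    intro G b hb hG hGb
    have h1 : |∫ s in Ioc 0 r, QInt B G (x s) (x s)| ≤ ∫ s in Ioc 0 r, b * (4 * dj p j) * Lp p (x s) :=
      norm_integral_le_of_norm_le (f := fun s => QInt B G (x s) (x s)) (imul (b * (4 * dj p j)) (hL.mono_set (Ioc_subset_Ioc_right hr))) (Eventually.of_forall fun s => Q_an hK hp hb hG hGb (hx.s2 s) (hi s))
    rw [integral_const_mul] at h1
    have hd := dj_pos p j
    refine h1.trans (mul_le_mul_of_nonneg_left ?_ pz)
    exact setIntegral_mono_set hL (Eventually.of_forall L0) (Ioc_subset_Ioc_right hr).eventuallyLE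
  have f : ∀ s, |∫ v, F v ∂(x s)| ≤ c * ∫ v, an j v ∂(x s) := fun s => by
    haveI := (hx.s2 s).prob
    rw [← integral_const_mul]
    exact norm_integral_le_of_norm_le (f := F) (imul c ((an_BM j).int _)) (Eventually.of_forall hF)
  have i0 : ∫ v, an j v ∂(x 0) ≤ dj p j * (1 + Mo p (x 0)) := by
    haveI := (hx.s2 0).prob
    have ip : Integrable (fun v => ‖v‖ ^ p) (x 0) := int_pow_le hp lz (hi 0)
    have : ∫ v, (1 + ‖v‖ ^ p) ∂(x 0) = 1 + Mo p (x 0) := by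
      rw [integral_add (integrable_const 1) ip]; simp
    rw [← this, ← integral_const_mul]
    exact integral_mono ((an_BM j).int _) (imul _ (iadd (integrable_const 1) ip)) fun v => an_le hp j v
  have q1 := q F c hc hm hF
  have q2 := q (an j) 1 zero_le_one (an_BM j).meas (fun v => by rw [one_mul, abs_of_nonneg (an_nn j v)])
  have f1 := f r
  have f2 := f 0
  have e : ∫ v, an j v ∂(x r) = Mt B x (an j) r + (∫ v, an j v ∂(x 0)) + ∫ s in Ioc 0 r, QInt B (an j) (x s) (x s) := by unfold Mt; ring
  have g1 : ∫ v, an j v ∂(x r) ≤ |Mt B x (an j) r| + dj p j * (1 + Mo p (x 0)) + 1 * (4 * dj p j) * ∫ s in Ioc 0 T, Lp p (x s) := by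
    rw [e]; linarith [le_abs_self (Mt B x (an j) r), le_abs_self (∫ s in Ioc 0 r, QInt B (an j) (x s) (x s))]
  have g2 := mul_le_mul_of_nonneg_left g1 hc
  have g3 := mul_le_mul_of_nonneg_left i0 hc
  have t : |Mt B x F r| ≤ |∫ v, F v ∂(x r)| + |∫ v, F v ∂(x 0)| + |∫ s in Ioc 0 r, QInt B F (x s) (x s)| := by
    unfold Mt
    exact (abs_sub _ _).trans (add_le_add_left (abs_sub _ _) _)
  refine t.trans ?_
  linarith
end
section
lemma dy_seq (hr : r ∈ Icc 0 T) : ∃ i : ℕ → ℕ, (∀ n, i n ∈ range (2 ^ n + 1)) ∧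
    Tendsto (fun n => T * i n / 2 ^ n) atTop (nhdsWithin r (Ici r)) ∧ ∀ n, T * i n / 2 ^ n ∈ Icc 0 T := by
  obtain ⟨h0, h1⟩ := hr
  rcases (h0.trans h1).eq_or_lt with hT | hT
  · have : r = 0 := le_antisymm lz h0
    subst this; rw [← hT]
    exact ⟨fun _ => 0, by simp, by simpa using tendsto_const_nhdsWithin (Set.mem_Ici.2 le_rfl), by simp⟩
  have hle : ∀ n, ⌈r / T * 2 ^ n⌉₊ ≤ 2 ^ n := fun n => by
    rw [Nat.ceil_le]; push_cast
    exact mul_le_of_le_one_left pz ((div_le_one hT).2 h1)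
  have a : ∀ n, r ≤ T * ⌈r / T * 2 ^ n⌉₊ / 2 ^ n := fun n => by
    rw [le_div_iff₀ pz]
    have := mul_le_mul_of_nonneg_left (Nat.le_ceil (r / T * 2 ^ n)) hT.le
    rwa [show T * (r / T * 2 ^ n) = r * 2 ^ n by field_simp] at this
  have b : ∀ n : ℕ, T * ⌈r / T * 2 ^ n⌉₊ / 2 ^ n ≤ r + T * (1/2) ^ n := fun n => by
    rw [div_le_iff₀ pz, add_mul, mul_assoc, ← mul_pow]
    have := mul_le_mul_of_nonneg_left (Nat.ceil_lt_add_one (pz : 0 ≤ r / T * 2 ^ n)).le hT.le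
    rw [mul_add, show T * (r / T * 2 ^ n) = r * 2 ^ n by field_simp] at this
    norm_num at this ⊢; exact this
  refine ⟨fun n => ⌈r / T * 2 ^ n⌉₊, fun n => mem_range.2 (Nat.lt_succ_of_le (hle n)), ?_, fun n => ⟨h0.trans (a n), ?_⟩⟩
  · refine tendsto_nhdsWithin_iff.2 ⟨?_, Eventually.of_forall a⟩
    refine tendsto_of_tendsto_of_tendsto_of_le_of_le tendsto_const_nhds ?_ a b
    have := ((tendsto_pow_atTop_nhds_zero_of_lt_one (nz : (0:ℝ) ≤ 1/2) nz).const_mul T).const_add r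
    simpa using this
  · rw [div_le_iff₀ pz]
    exact mul_le_mul_of_nonneg_left (by exact_mod_cast hle n) hT.le
variable (hK : GoodK B κ K)
variable {Ω : Type*} [m : MeasurableSpace Ω] {P : Measure Ω} [IsProbabilityMeasure P] {𝓕 : Filtration ℝ m}
  {μp : ℝ → Ω → Measure (Vd d)} (hk : IsKacProcess B N P 𝓕 μp)
include hk
lemma AA_cut (hR : 1 ≤ R) (hg : AR R 1 w3 g) : ∃ c, 0 < c ∧ AA c (cut R g) := by
  refine ⟨4 * (1 + 2 * R) ^ 3 + 2 * (1 + 4 * R) ^ 3, pz, ?_⟩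
  have hb := (BM_cut hR zero_le_one hg).bd
  have hw : ∀ {S : ℝ} (v : Ed), 1 ≤ S → ‖v‖ ≤ S → w3 v ≤ (1 + S) ^ 3 := fun {S} v hS hv => by
    have h2 : 1 + ‖v‖ ^ 2 ≤ (1 + S) ^ 2 := by nlinarith [norm_nonneg v]
    calc w3 v = (1 + ‖v‖) * (1 + ‖v‖ ^ 2) := rfl
      _ ≤ (1 + S) * (1 + S) ^ 2 := by gcongr
      _ = _ := by ring
  have hp : 0 ≤ (1 + 4 * R) ^ 3 := pz
  have hp' : 0 ≤ (1 + 2 * R) ^ 3 := pz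
  refine AA_of_lip (fun v => (hb v).trans lz) fun v u => ?_
  have key : ∀ v u : Ed, ‖v‖ ≤ 2 * R → |cut R g v - cut R g u| ≤ (4 * (1 + 2 * R) ^ 3 + 2 * (1 + 4 * R) ^ 3) * ‖v - u‖ := by
    intro v u hv
    by_cases hu : ‖u‖ ≤ 2 * R + 1
    · have h1 := cut_lip hR one_le_w3 zero_le_one hg v u
      have h2 := hw v lz hv
      have h3 := hw u (lz : 1 ≤ 4 * R) lz
      have h4 : (1 + R⁻¹) ≤ 2 := by have := inv_le_one_of_one_le₀ hR; linarith
      refine h1.trans ?_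
      calc 1 * (‖v - u‖ * (w3 v + w3 u)) * (1 + R⁻¹) ≤ 1 * (‖v - u‖ * ((1 + 2 * R) ^ 3 + (1 + 4 * R) ^ 3)) * 2 := by
            gcongr
        _ ≤ _ := by nlinarith [norm_nonneg (v - u), mul_nonneg (norm_nonneg (v-u)) hp']
    · have h1 := abs_le.1 (hb v)
      have h2 := abs_le.1 (hb u)
      have h3 : 1 ≤ ‖v - u‖ := by
        have := norm_sub_norm_le u v
        rw [norm_sub_rev] at this; linarith
      have : |cut R g v - cut R g u| ≤ 4 * (1 + 2 * R) ^ 3 + 2 * (1 + 4 * R) ^ 3 := by rw [abs_le]; constructor <;> linarith [h1.1, h1.2, h2.1, h2.2]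
      nlinarith
  by_cases hv : ‖v‖ ≤ 2 * R
  · exact key v u hv
  by_cases hu : ‖u‖ ≤ 2 * R
  · rw [abs_sub_comm, norm_sub_rev]; exact key u v hu
  · rw [cut_zero hR g (not_le.1 hv).le, cut_zero hR g (not_le.1 hu).le]; simp; positivity
lemma rc_AA (hc : 0 < c) (hf : AA c f) (ω : Ω) (t : ℝ) :
    ContinuousWithinAt (fun s => ∫ v, f v ∂(μp s ω)) (Ici t) t := by
  have h := (hk.rightCont ω _ (testF_of_AA hc hf) t).const_mul (3 * c)
  simp only [integral_const_mul] at h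
  refine h.congr (fun s _ => ?_) ?_ <;> field_simp
include hK
lemma Mt_rc (hR : 1 ≤ R) (hg : AR R 1 w3 g) (ω : Ω) {u : ℕ → ℝ} (hr : 0 ≤ r) (hu : Tendsto u atTop (nhdsWithin r (Ici r)))
    (huT : ∀ n, u n ∈ Icc 0 T) (hrT : r ∈ Icc 0 T) :
    Tendsto (fun n => Mt B (fun s => μp s ω) (cut R g) (u n)) atTop (nhds (Mt B (fun s => μp s ω) (cut R g) r)) := by
  obtain ⟨c, hc, hA⟩ := AA_cut hk hR hg
  have h1 := (rc_AA hk hc hA ω r).tendsto.comp hu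
  have hq : IntegrableOn (fun s => QInt B (cut R g) (μp s ω) (μp s ω)) (Icc 0 T) :=
    (integrableOn_Icc_iff_integrableOn_Ioc (by finiteness)).2 ((kac_path hk ω).q_int hK (BM_cut hR zero_le_one hg) 0 T)
  have h2 := ((intervalIntegral.continuousOn_primitive hq) r hrT).tendsto.comp
    (tendsto_nhdsWithin_iff.2 ⟨hu.mono_right nhdsWithin_le_nhds, Eventually.of_forall huT⟩)
  exact (h1.sub_const _).sub h2
omit hK in
lemma kac_L (p : ℝ) (hp : 0 ≤ p) : ∃ b, ∀ v : Ed, ‖v‖ ≤ √N → |1 + 2 ^ (p+3) * ‖v‖ ^ (p+1)| ≤ b :=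
  ⟨1 + 2 ^ (p+3) * √N ^ (p+1), fun v hv => by rw [abs_of_nonneg pz]; gcongr⟩
omit hK in
lemma kac_Lp (p : ℝ) (s : ℝ) (ω : Ω) : Lp p (μp s ω) = ∫ v, (1 + 2 ^ (p+3) * ‖v‖ ^ (p+1)) ∂(μp s ω) := by
  haveI := (kac_S2 hk s ω).prob
  have i : Integrable (fun v => tw ^ (p+3) * ‖v‖ ^ (p+1)) (μp s ω) := emp_intg (hk.mem s ω) mz
  rw [integral_add (integrable_const 1) i, integral_const_mul]; simp [Lp]
theorem kac_bad (hd : 1 ≤ d) {M L : ℝ} (hp : 0 ≤ p) (hM : 0 ≤ M) {A : Set Ω} (hA : MeasurableSet[𝓕 0] A)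
    (hAM : ∀ ω ∈ A, Mo p (μp 0 ω) ≤ M) (hT : 0 ≤ T) (hL : ∫ ω in A, (∫ s in Ioc 0 T, Lp p (μp s ω)) ∂P ≤ L) (hl : 0 < lam) (J k : ℕ) :
    ∃ S, MeasurableSet S ∧ P (A ∩ S) ≤ ofReal (lam⁻¹ * (48 * d * √(3 ^ d * 2 ^ p * (16 * L)) * (SS p J * (√(N:ℝ)⁻¹ * UU d k)))) ∧
      ∀ ω ∈ A \ S, ∀ g, AR (2 ^ J) 1 w3 g → ∀ r ∈ Icc 0 T, |Mt B (fun s => μp s ω) (cut (2 ^ J) g) r| ≤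
        lam + 16 * d * 2 ^ p * (2 * (1 + M) + 8 * ∫ s in Ioc 0 T, Lp p (μp s ω)) * (SS p J * (1 / 2 ^ k)) := by
  classical
  have hA' : MeasurableSet A := 𝓕.le 0 A hA
  obtain ⟨b, hb⟩ := kac_L hk (d := d) p hp
  have hf : Measurable fun v : Ed => 1 + tw ^ (p+3) * ‖v‖ ^ (p+1) := mz
  have iL : ∀ ω, IntegrableOn (fun s => Lp p (μp s ω)) (Ioc 0 T) := fun ω => by
    simp only [kac_Lp hk]; exact kac_I hk hf hb T ω
  have jL : Integrable (fun ω => ∫ s in Ioc 0 T, Lp p (μp s ω)) P := by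
    simp only [kac_Lp hk]; exact kac_J hk hf hb hT
  have hi : ∀ s ω, Integrable (fun v => ‖v‖ ^ (p+1)) (μp s ω) := fun s ω => emp_intg (hk.mem s ω) mz
  have L0 : ∀ s ω, 0 ≤ Lp p (μp s ω) := fun s ω => by
    have : 0 ≤ Mo (p+1) (μp s ω) := integral_nonneg fun v => by positivity
    unfold Lp; positivity
  have LL : 0 ≤ L := (integral_nonneg fun ω => integral_nonneg fun s => L0 s ω).trans hL
  let c : ((_ : ℕ × ℕ) × (Fin d → ℤ)) → ℝ := fun q => 48 * d * 16 ^ q.1.1 / 2 ^ q.1.2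
  let g : ((_ : ℕ × ℕ) × (Fin d → ℤ)) → Ed → ℝ := fun q => cl q.1.1 q.1.2 q.2
  let s : Finset ((_ : ℕ × ℕ) × (Fin d → ℤ)) := (range (J+2) ×ˢ range (k+1)).sigma (fun q => Zk d q.2)
  have es : ∀ h : (Fn) → ℝ, ∑ q ∈ s, c q * h (g q) = ∑ j ∈ range (J+2), ∑ i ∈ range (k+1),
      (48 * d * 16 ^ j / 2 ^ i) * ∑ z ∈ Zk d i, h (cl j i z) := fun h => by
    simp only [s, c, g, Finset.sum_sigma, Finset.sum_product, mul_sum]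
  have hdb := kac_doob hK hk s (c := c) (fun q => by positivity) (g := g) (b := 1) (fun q => cl_BM _ _ _) (fun q => cl_nn _ _ _) hA hT hl
  have mS : ∀ n, MeasurableSet (dyad (fun t ω => ∑ i ∈ s, c i * |Mt B (fun s => μp s ω) (g i) t|) T lam n) := fun n =>
    dyad_meas hT (𝓕 := 𝓕) (fun t ht => @meas_sumabs Ω (𝓕 t) _ s c _ fun i => (kac_adM hK hk (cl_BM _ _ _) (cl_nn _ _ _) t ht)) n
  refine ⟨_, MeasurableSet.iUnion mS, hdb.trans (ofReal_le_ofReal ?_), ?_⟩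
  · refine mul_le_mul_of_nonneg_left ?_ pz
    rw [es fun f => √((N:ℝ)⁻¹ * ∫ ω in A, (∫ s in Ioc 0 T, Gam K f (μp s ω)) ∂P)]
    have gm : ∀ j i z, Measurable (fun q : ℝ × Ω => Gam K (cl (d := d) j i z) (μp q.1 q.2)) := fun j i z => kac_measG hK hk (meas_cl j i z)
    have gb : ∀ j i z s ω, |Gam K (cl (d := d) j i z) (μp s ω)| ≤ 32 * 1 ^ 2 := fun j i z s ω => Gam_bd hK hk (cl_BM j i z) (kac_S2 hk s ω)
    have g1 : ∀ j i z ω, IntegrableOn (fun s => Gam K (cl (d := d) j i z) (μp s ω)) (Ioc 0 T) := fun j i z ω =>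
      bint _ ((gm j i z).comp (measurable_id.prodMk measurable_const)) fun s => gb j i z s ω
    have g2 : ∀ j i z, IntegrableOn (fun ω => ∫ s in Ioc 0 T, Gam K (cl (d := d) j i z) (μp s ω)) A P := fun j i z =>
      bint (32 * 1 ^ 2 * T) (meas_tI (gm j i z) T) fun ω => by
        have := norm_setIntegral_le_of_norm_le_const (f := fun s => Gam K (cl (d := d) j i z) (μp s ω)) (s := Ioc 0 T) (μ := volume) (by simp)
          (fun s _ => gb j i z s ω)
        simpa [Measure.real, hT] using this
    have g0 : ∀ j i z s ω, 0 ≤ Gam K (cl (d := d) j i z) (μp s ω) := fun j i z s ω => by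
      unfold Gam KG
      exact integral_nonneg fun v => integral_nonneg fun vs => mul_nonneg (norm_nonneg _) (integral_nonneg fun σ => sq_nonneg _)
    refine num1 pz pz J k (G := fun j i z => ∫ ω in A, (∫ s in Ioc 0 T, Gam K (cl j i z) (μp s ω)) ∂P)
      (fun j i z => integral_nonneg fun ω => integral_nonneg fun s => g0 j i z s ω) fun j i => ?_
    rw [← integral_finsetSum _ fun z _ => g2 j i z]
    have hj := dj_pos p j
    have : ∫ ω in A, ∑ z ∈ Zk d i, (∫ s in Ioc 0 T, Gam K (cl j i z) (μp s ω)) ∂P ≤ ∫ ω in A, 16 * dj p j * (∫ s in Ioc 0 T, Lp p (μp s ω)) ∂P := by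
      refine integral_mono (integrable_finsetSum _ fun z _ => g2 j i z) (imul _ jL.integrableOn) fun ω => ?_
      simp only
      rw [← integral_finsetSum _ fun z _ => g1 j i z ω, ← integral_const_mul]
      exact integral_mono (integrable_finsetSum _ fun z _ => g1 j i z ω) (imul _ (iL ω)) fun s => Gam_cl hK hp j i (kac_S2 hk s ω) (hi s ω)
    rw [integral_const_mul] at this
    have h3 := mul_le_mul_of_nonneg_left hL (pz : 0 ≤ 16 * dj p j)
    linarith
  · intro ω hω f hf r hr
    set Λ := ∫ s in Ioc 0 T, Lp p (μp s ω)
    have Λ0 : 0 ≤ Λ := integral_nonneg fun s => L0 s ω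
    obtain ⟨u, u1, u2, u3⟩ := dy_seq hr
    refine le_of_tendsto (Mt_rc hK hk (one_le_pow₀ nz) hf ω hr.1 u2 u3 hr).abs (Eventually.of_forall fun n => ?_)
    have hS : ∑ i ∈ s, c i * |Mt B (fun s => μp s ω) (g i) (T * u n / 2 ^ n)| < lam := by
      by_contra hc
      exact hω.2 (Set.mem_iUnion.2 ⟨n, u n, u1 n, not_lt.1 hc⟩)
    have hc := chain2 (Mt_LinF hK (kac_path hk ω) (T * u n / 2 ^ n)) hd (ρ := fun j => dj p j * (2 * (1 + M) + 8 * Λ))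
      (fun j F c hc hm hF => (Mt_rho hK hp (kac_path hk ω) (fun s => hi s ω) (iL ω) (u3 n).2 j F c hc hm hF).trans (by
        have := hAM ω hω.1
        have := dj_pos p j
        gcongr)) J k hf
    have h2 := num2 (d := d) (p := p) (L := 2 * (1 + M) + 8 * Λ) hp pz J k
    have h3 : ZZ d J k (fun F => Mt B (fun s => μp s ω) F (T * u n / 2 ^ n)) = ∑ i ∈ s, c i * |Mt B (fun s => μp s ω) (g i) (T * u n / 2 ^ n)| :=
      (es fun F => |Mt B (fun s => μp s ω) F (T * u n / 2 ^ n)|).symm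
    rw [h3] at hc
    linarith
end
section
lemma tail_pt {q : ℝ} (hq : q ≤ p) (hR : 1 ≤ R) (v : Ed) : (1 - chi R v) * ‖v‖ ^ q ≤ R ^ (q - p) * ‖v‖ ^ p := by
  by_cases hv : ‖v‖ ≤ R
  · rw [chi_one hR hv, sub_self, zero_mul]; positivity
  · have h0 : 0 < R := lz
    have h1 : R < ‖v‖ := not_le.1 hv
    have h2 : ‖v‖ ^ q = ‖v‖ ^ (q - p) * ‖v‖ ^ p := by rw [← rpow_add lz]; ring_nf
    have h3 : ‖v‖ ^ (q - p) ≤ R ^ (q - p) := Real.rpow_le_rpow_of_nonpos h0 h1.le lz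
    have h4 := chi_nonneg R v
    have h5 : 0 ≤ ‖v‖ ^ q := pz
    calc (1 - chi R v) * ‖v‖ ^ q ≤ 1 * ‖v‖ ^ q := by gcongr; linarith
      _ ≤ _ := by rw [one_mul, h2]; gcongr
section
variable {Ω : Type*} [m : MeasurableSpace Ω] {P : Measure Ω} [IsProbabilityMeasure P] {Vs : Fin N → Ω → Vd d}
  (hV : ∀ i, Measurable (Vs i)) (hI : iIndepFun Vs P) {μ0 : Measure (Vd d)} [IsProbabilityMeasure μ0] (hl : ∀ i, P.map (Vs i) = μ0)
include hV hl
lemma iid_E (hg : Measurable g) (i : Fin N) : ∫ ω, g (Vs i ω) ∂P = ∫ v, g v ∂μ0 := by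
  rw [← hl i, integral_map (hV i).aemeasurable hg.aestronglyMeasurable]
include hI
lemma iid_var (hN : 0 < N) (hg : BM 1 g) (g0 : ∀ v, 0 ≤ g v) :
    ∫ ω, |(∫ v, g v ∂(empMeasure Vs ω)) - ∫ v, g v ∂μ0| ∂P ≤ √((N:ℝ)⁻¹ * ∫ v, g v ∂μ0) := by
  have hN' : (0:ℝ) < N := by exact_mod_cast hN
  set a := ∫ v, g v ∂μ0
  have mX : ∀ i, Measurable (fun ω => g (Vs i ω)) := fun i => hg.meas.comp (hV i)
  have lX : ∀ i, MemLp (fun ω => g (Vs i ω)) 2 P := fun i => MemLp.of_bound (mX i).aestronglyMeasurable 1 (Eventually.of_forall fun ω => hg.bd _)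
  set Y : Ω → ℝ := fun ω => (∫ v, g v ∂(empMeasure Vs ω)) - a
  have eY : Y = fun ω => (N:ℝ)⁻¹ * (∑ i, g (Vs i ω)) - a := funext fun ω => by simp only [Y, empMeasure, emp_int (fun i => Vs i ω)]
  have mY : Measurable Y := by rw [eY]; exact ((measurable_fun_sum _ fun i _ => mX i).const_mul _).sub_const _
  have bs : ∀ ω, |∑ i, g (Vs i ω)| ≤ N := fun ω => (abs_sum_le_sum_abs _ _).trans (by
    refine (sum_le_sum fun i _ => hg.bd (Vs i ω)).trans (by simp))
  have bY : ∀ ω, |Y ω| ≤ 1 + |a| := fun ω => by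
    rw [eY]; simp only
    refine (abs_sub _ _).trans (add_le_add_left ?_ _)
    rw [abs_mul, abs_of_pos (pz : 0 < (N:ℝ)⁻¹)]
    calc (N:ℝ)⁻¹ * |∑ i, g (Vs i ω)| ≤ (N:ℝ)⁻¹ * N := by gcongr; exact bs ω
      _ = 1 := by field_simp
  have hS : Var[∑ i, (fun ω => g (Vs i ω)); P] ≤ N * a := by
    rw [IndepFun.variance_sum (fun i _ => lX i) (fun i _ j _ hij => (hI.indepFun hij).comp hg.meas hg.meas)]
    calc ∑ i, Var[fun ω => g (Vs i ω); P] ≤ ∑ i : Fin N, a := by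
          refine sum_le_sum fun i _ => (variance_le_expectation_sq (mX i).aestronglyMeasurable).trans ?_
          have ea : a = ∫ ω, g (Vs i ω) ∂P := (iid_E hV hl hg.meas i).symm
          rw [ea]
          refine integral_mono (lX i).integrable_sq ((lX i).integrable nz) fun ω => ?_
          have h1 := g0 (Vs i ω)
          have h2 := (abs_le.1 (hg.bd (Vs i ω))).2
          simp only [Pi.pow_apply]; nlinarith
      _ = _ := by simp
  have hE : ∫ ω, (∑ i, g (Vs i ω)) ∂P = N * a := by
    rw [integral_finsetSum _ fun i _ => (lX i).integrable nz]
    simp [iid_E hV hl hg.meas, a]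
  have h2 : ∫ ω, Y ω ^ 2 ∂P ≤ (N:ℝ)⁻¹ * a := by
    have e : ∫ ω, Y ω ^ 2 ∂P = (N:ℝ)⁻¹ ^ 2 * Var[∑ i, (fun ω => g (Vs i ω)); P] := by
      rw [variance_eq_integral (Finset.aemeasurable_sum _ fun i _ => (mX i).aemeasurable), ← integral_const_mul]
      congr 1; ext ω
      simp only [Finset.sum_apply, hE, eY]
      field_simp
    rw [e]
    calc (N:ℝ)⁻¹ ^ 2 * Var[∑ i, (fun ω => g (Vs i ω)); P] ≤ (N:ℝ)⁻¹ ^ 2 * (N * a) := by gcongr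
      _ = _ := by field_simp
  refine le_sqrt_of_sq_le (le_trans ?_ h2)
  have hv := variance_nonneg (fun ω => |Y ω|) P
  rw [variance_eq_sub (MemLp.of_bound mY.abs.aestronglyMeasurable (1 + |a|) (Eventually.of_forall fun ω => by simpa using bY ω))] at hv
  simp only [Pi.pow_apply, sq_abs] at hv
  linarith
theorem iid_bad (hN : 0 < N) (hd : 1 ≤ d) {Mp M1 : ℝ} (hp : 0 ≤ p) (hi : Integrable (fun v => ‖v‖ ^ p) μ0) (hMp : Mo p μ0 ≤ Mp) (hlam : 0 < lam)
    (hM1 : 0 < M1) (J k : ℕ) : ∃ E, MeasurableSet E ∧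
      P Eᶜ ≤ ofReal (lam⁻¹ * (48 * d * √(3 ^ d * 2 ^ p * (1 + Mp)) * (SS p J * (√(N:ℝ)⁻¹ * UU d k)))) + ofReal (M1⁻¹ * Mp) ∧
      ∀ ω ∈ E, (Mo p (empMeasure Vs ω) ≤ M1) ∧ ∀ g, AR (2 ^ J) 1 w3 g →
        |(∫ v, cut (2 ^ J) g v ∂(empMeasure Vs ω)) - ∫ v, cut (2 ^ J) g v ∂μ0| ≤ lam + 16 * d * 2 ^ p * (2 * (1 + Mp)) * (SS p J * (1 / 2 ^ k)) := by
  have hN' : (0:ℝ) < N := by exact_mod_cast hN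
  have Mp0 : 0 ≤ Mp := (integral_nonneg fun v => by positivity).trans hMp
  let m : Ω → (Fn) → ℝ := fun ω F => (∫ v, F v ∂(empMeasure Vs ω)) - ∫ v, F v ∂μ0
  have emp : ∀ ω (g : Fn), ∫ v, g v ∂(empMeasure Vs ω) = (N:ℝ)⁻¹ * ∑ i, g (Vs i ω) := fun ω g => emp_int (fun i => Vs i ω) g
  have me : ∀ g : Ed → ℝ, Measurable g → Measurable fun ω => ∫ v, g v ∂(empMeasure Vs ω) := fun g hg => by
    simp only [emp]; exact (measurable_fun_sum _ fun i _ => hg.comp (hV i)).const_mul _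
  have mm : ∀ g : Ed → ℝ, Measurable g → Measurable fun ω => m ω g := fun g hg => (me g hg).sub_const _
  have mZ : Measurable fun ω => ZZ d J k (m ω) := by
    unfold ZZ
    exact measurable_fun_sum _ fun j _ => measurable_fun_sum _ fun i _ => (measurable_fun_sum _ fun z _ => (mm _ (meas_cl j i z)).abs).const_mul _
  have ian : ∀ j, ∫ v, an j v ∂μ0 ≤ dj p j * (1 + Mp) := fun j => by
    have : ∫ v, (1 + ‖v‖ ^ p) ∂μ0 = 1 + Mo p μ0 := by
      rw [integral_add (integrable_const 1) hi]; simp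
    have h2 : ∫ v, an j v ∂μ0 ≤ dj p j * (1 + Mo p μ0) := by
      rw [← this, ← integral_const_mul]
      exact integral_mono ((an_BM j).int _) (imul _ (iadd (integrable_const 1) hi)) fun v => an_le hp j v
    have := dj_pos p j
    exact h2.trans (by gcongr)
  have bm : ∀ j i z ω, |m ω (cl j i z)| ≤ 2 := fun j i z ω => by
    have h1 : |∫ v, cl j i z v ∂μ0| ≤ 1 := abs_int_le (Eventually.of_forall (cl_BM j i z).bd)
    have h2 : |∫ v, cl j i z v ∂(empMeasure Vs ω)| ≤ 1 := by
      rw [emp, abs_mul, abs_of_pos pz]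
      calc (N:ℝ)⁻¹ * |∑ n, cl j i z (Vs n ω)| ≤ (N:ℝ)⁻¹ * N := by
            gcongr
            refine (abs_sum_le_sum_abs _ _).trans ((sum_le_sum fun n _ => (cl_BM j i z).bd _).trans (by simp))
        _ = 1 := by field_simp
    refine (abs_sub _ _).trans lz
  have im : ∀ j i z, Integrable (fun ω => |m ω (cl j i z)|) P := fun j i z => bint 2 (mm _ (meas_cl j i z)).abs fun ω => by simpa using bm j i z ω
  have iZ : Integrable (fun ω => ZZ d J k (m ω)) P := by
    unfold ZZ
    exact integrable_finsetSum _ fun j _ => integrable_finsetSum _ fun i _ => (integrable_finsetSum _ fun z _ => im j i z).const_mul _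
  have EZ : ∫ ω, ZZ d J k (m ω) ∂P ≤ 48 * d * √(3 ^ d * 2 ^ p * (1 + Mp)) * (SS p J * (√(N:ℝ)⁻¹ * UU d k)) := by
    unfold ZZ
    rw [integral_finsetSum _ fun j _ => integrable_finsetSum _ fun i _ => (integrable_finsetSum _ fun z _ => im j i z).const_mul _]
    refine le_trans (sum_le_sum fun j _ => ?_) (num1 (d := d) (p := p) (L := 1 + Mp) (n := (N:ℝ)⁻¹) pz pz J k
      (G := fun j i z => ∫ v, cl j i z v ∂μ0) (fun j i z => integral_nonneg fun v => cl_nn j i z v) fun j i => ?_)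
    · rw [integral_finsetSum _ fun i _ => (integrable_finsetSum _ fun z _ => im j i z).const_mul _]
      refine sum_le_sum fun i _ => ?_
      rw [integral_const_mul, integral_finsetSum _ fun z _ => im j i z]
      refine mul_le_mul_of_nonneg_left (sum_le_sum fun z _ => iid_var hV hI hl hN (cl_BM j i z) (cl_nn j i z)) pz
    · rw [← integral_finsetSum _ fun z _ => (cl_BM j i z).int μ0]
      exact (integral_mono (integrable_finsetSum _ fun z _ => (cl_BM j i z).int μ0) ((an_BM j).int μ0) fun v => cl_sum j i v).trans (ian j)
  have ip : ∀ i, Integrable (fun ω => ‖Vs i ω‖ ^ p) P := fun i => by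
    rw [← hl i] at hi
    exact (integrable_map_measure mz (hV i).aemeasurable).1 hi
  have mk : ∀ {f : Ω → ℝ} {a c : ℝ}, Measurable f → Integrable f P → (∀ ω, 0 ≤ f ω) → 0 < a → ∫ ω, f ω ∂P ≤ c → P {ω | a ≤ f ω} ≤ ofReal (a⁻¹ * c) := by
    intro f a c hf hfi f0 ha hc
    have h := mul_meas_ge_le_integral_of_nonneg (μ := P) (Eventually.of_forall f0) hfi a
    rw [← ENNReal.ofReal_toReal (measure_ne_top P {ω | a ≤ f ω})]
    refine ofReal_le_ofReal ?_
    rw [← div_eq_inv_mul, le_div_iff₀ ha, mul_comm]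
    exact h.trans hc
  refine ⟨{ω | ZZ d J k (m ω) < lam} ∩ {ω | Mo p (empMeasure Vs ω) < M1}, (measurableSet_lt mZ measurable_const).inter
    (measurableSet_lt (me _ mz) measurable_const), ?_, fun ω hω => ⟨le_of_lt hω.2, fun g hg => ?_⟩⟩
  · rw [Set.compl_inter]
    refine (measure_union_le _ _).trans (add_le_add ?_ ?_)
    · have := mk mZ iZ (fun ω => by unfold ZZ; positivity) hlam EZ
      simpa [Set.compl_setOf] using this
    · have := mk (f := fun ω => Mo p (empMeasure Vs ω)) (c := Mp) (me _ mz) (by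
          simp only [emp]; exact (integrable_finsetSum _ fun i _ => ip i).const_mul _) (fun ω => integral_nonneg fun v => by positivity) hM1 (by
          simp only [emp]
          rw [integral_const_mul, integral_finsetSum _ fun i _ => ip i]
          simp only [iid_E hV hl (g := fun v => ‖v‖ ^ p) mz]
          simp only [Finset.sum_const, Finset.card_univ, Fintype.card_fin, nsmul_eq_mul]
          rwa [inv_mul_cancel_left₀ hN'.ne'])
      simpa [Set.compl_setOf] using this
  · have hi' : ∀ F : Ed → ℝ, Measurable F → Integrable F (empMeasure Vs ω) := fun F hF => by
      unfold empMeasure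
      refine (integrable_finset_sum_measure.2 fun i _ => integrable_dirac' hF.stronglyMeasurable (by simp)).smul_measure (by simp [hN.ne'])
    have hm : LinF (m ω) := ⟨fun F G b b' hF hG c => by
      simp only [m]
      rw [integral_add (hi' F hF.meas) (imul c (hi' G hG.meas)), integral_const_mul, integral_add (hF.int μ0) (imul c (hG.int μ0)), integral_const_mul]; ring⟩
    have hc := chain2 hm hd (ρ := fun j => dj p j * (2 * (1 + Mp))) (fun j F c hc hF hb => by
      have f1 : |∫ v, F v ∂(empMeasure Vs ω)| ≤ c * ∫ v, an j v ∂(empMeasure Vs ω) := by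
        rw [← integral_const_mul]
        exact norm_integral_le_of_norm_le (f := F) (imul c (hi' _ (an_BM j).meas)) (Eventually.of_forall hb)
      have f2 : |∫ v, F v ∂μ0| ≤ c * ∫ v, an j v ∂μ0 := by
        rw [← integral_const_mul]
        exact norm_integral_le_of_norm_le (f := F) (imul c ((an_BM j).int _)) (Eventually.of_forall hb)
      have e : ∫ v, an j v ∂(empMeasure Vs ω) = m ω (an j) + ∫ v, an j v ∂μ0 := by simp only [m]; ring
      have g1 : ∫ v, an j v ∂(empMeasure Vs ω) ≤ |m ω (an j)| + dj p j * (1 + Mp) := by rw [e]; exact add_le_add (le_abs_self _) (ian j)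
      have g2 := mul_le_mul_of_nonneg_left g1 hc
      have g3 := mul_le_mul_of_nonneg_left (ian j) hc
      refine (abs_sub _ _).trans ?_
      linarith) J k hg
    have h2 := num2 (d := d) (p := p) (L := 2 * (1 + Mp)) hp pz J k
    have h3 : ZZ d J k (m ω) < lam := hω.1
    simp only [m] at hc h3
    linarith
end
end
section
lemma tail_int {M : ℝ} (hR : 1 ≤ R) (hp : 2 ≤ p) {x : Ms} (hi : Integrable (fun v => ‖v‖ ^ p) x)
    (hM : Mo p x ≤ M) (g2 : ∀ v, 1 ≤ ‖v‖ → |g v| ≤ ‖v‖ ^ 2) :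
    |∫ v, (1 - chi R v) * g v ∂x| ≤ R ^ (2 - p) * M := by
  have h := norm_integral_le_of_norm_le (f := fun v => (1 - chi R v) * g v) (imul (R ^ (2 - p)) hi) (Eventually.of_forall fun v => by
    rw [norm_eq_abs, abs_mul, abs_of_nonneg (by have := chi_le R v; linarith)]
    refine le_trans ?_ (tail_pt hp hR v)
    by_cases hv : ‖v‖ ≤ R
    · simp [chi_one hR hv]
    · rw [rpow_two]
      exact mul_le_mul_of_nonneg_left (g2 v lz) (by have := chi_le R v; linarith))
  rw [integral_const_mul] at h
  exact h.trans (by gcongr)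
lemma cut_split (hR : 1 ≤ R) (hp : 2 ≤ p) {x : Ms} [IsFiniteMeasure x] (hi : Integrable (fun v => ‖v‖ ^ p) x)
    (hm : Measurable g) (hg : AR R 1 w3 g) (g2 : ∀ v, 1 ≤ ‖v‖ → |g v| ≤ ‖v‖ ^ 2) :
    ∫ v, g v ∂x = ∫ v, cut R g v ∂x + ∫ v, (1 - chi R v) * g v ∂x := by
  have h1 := w3_int_cut hR zero_le_one hg x
  have h2 : Integrable (fun v => (1 - chi R v) * g v) x := by
    refine Integrable.mono' (imul (R ^ (2 - p)) hi) (by unfold chi; fun_prop) (Eventually.of_forall fun v => ?_)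
    rw [norm_eq_abs, abs_mul, abs_of_nonneg (by have := chi_le R v; linarith)]
    refine le_trans ?_ (tail_pt hp hR v)
    by_cases hv : ‖v‖ ≤ R
    · simp [chi_one hR hv]
    · rw [rpow_two]
      exact mul_le_mul_of_nonneg_left (g2 v lz) (by have := chi_le R v; linarith)
  rw [← integral_add h1 h2]
  congr 1; ext v; unfold cut; ring
lemma fluct {η M1 Mp : ℝ} (hR : 1 ≤ R) (hp : 2 ≤ p) {x μ : Ms} [IsFiniteMeasure x] [IsFiniteMeasure μ] (ix : Integrable (fun v => ‖v‖ ^ p) x)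
    (iμ : Integrable (fun v => ‖v‖ ^ p) μ) (hx : Mo p x ≤ M1) (hμ : Mo p μ ≤ Mp)
    (hm : Measurable g) (hg : AR R 1 w3 g) (g2 : ∀ v, 1 ≤ ‖v‖ → |g v| ≤ ‖v‖ ^ 2)
    (hη : |∫ v, cut R g v ∂x - ∫ v, cut R g v ∂μ| ≤ η) : |∫ v, g v ∂x - ∫ v, g v ∂μ| ≤ η + R ^ (2 - p) * (M1 + Mp) := by
  have h1 := tail_int hR hp ix hx g2
  have h2 := tail_int hR hp iμ hμ g2
  rw [cut_split hR hp ix hm hg g2, cut_split hR hp iμ hm hg g2]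
  rw [abs_le] at *
  constructor <;> linarith [h1.1, h1.2, h2.1, h2.2, hη.1, hη.2]
lemma a_pow {x : ℝ} (hp : 0 ≤ p) (hx : 0 ≤ x) : (1 + x) ^ p ≤ 2 ^ p * (1 + x ^ p) := by
  have h0 : 0 ≤ x ^ p := pz
  rcases le_total x 1 with h | h
  · calc (1 + x) ^ p ≤ 2 ^ p := by gcongr; linarith
      _ ≤ _ := le_mul_of_one_le_right pz lz
  · calc (1 + x) ^ p ≤ (2 * x) ^ p := by gcongr; linarith
      _ = 2 ^ p * x ^ p := mul_rpow nz hx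
      _ ≤ _ := by gcongr; linarith
lemma s_est {S δ : ℝ} (h0 : 0 ≤ δ) (h8 : δ ≤ 1/8) (hS : |S - 1| ≤ 9/8 * δ) : 0 < S ∧ |(√S)⁻¹ - 1| ≤ 2 * δ := by
  have h1 := abs_le.1 hS
  have hS0 : 0 < S := lz
  set q := √S
  have hq : 0 < q := Real.sqrt_pos.2 hS0
  have hqq : q * q = S := Real.mul_self_sqrt hS0.le
  refine ⟨hS0, ?_⟩
  have hq3 : 3/4 ≤ q := by
    refine le_sqrt_of_sq_le ?_; norm_num; linarith
  have e : q⁻¹ - 1 = (1 - S) / (q * (1 + q)) := by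
    rw [← hqq]; field_simp; ring
  rw [e, abs_div, abs_of_pos (pz : 0 < q * (1 + q)), div_le_iff₀ pz, abs_sub_comm]
  refine hS.trans ?_
  have : 21/16 ≤ q * (1 + q) := by nlinarith
  nlinarith
lemma resc_pt {δ θ : ℝ} (hR : 1 ≤ R) (h0 : 0 ≤ δ) (h8 : δ ≤ 1/8) (t0 : 0 < θ) (t1 : θ ≤ 1) (tp : 2 + θ ≤ p) (h : ‖u - v‖ ≤ 2 * δ * (1 + ‖v‖)) (hf : AR R 1 ww f) :
    |cut R f u - cut R f v| ≤ 24 * δ ^ θ * (2 ^ p * (1 + ‖v‖ ^ p)) ∧ ‖u‖ ^ p ≤ 4 ^ p * (1 + ‖v‖ ^ p) := by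
  have hp : 0 ≤ p := lz
  set a := 1 + ‖v‖ with ha
  have a1 : 1 ≤ a := by have := norm_nonneg v; linarith
  have ap : a ^ p ≤ 2 ^ p * (1 + ‖v‖ ^ p) := a_pow hp (norm_nonneg v)
  have hu : ‖u‖ ≤ 2 * a := by
    have h1 := norm_add_le v (u - v)
    rw [add_sub_cancel] at h1
    have : 2 * δ * a ≤ 2 * (1/8) * a := by gcongr
    linarith
  constructor
  · have wv : ww v ≤ a ^ 2 := by unfold ww; rw [ha]; nlinarith [norm_nonneg v]
    have wu : ww u ≤ 5 * a ^ 2 := by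
      unfold ww
      have : ‖u‖ ^ 2 ≤ (2 * a) ^ 2 := by gcongr
      nlinarith
    have b1 : |cut R f u - cut R f v| ≤ 24 * a ^ 2 * 1 := by
      have := abs_sub (cut R f u) (cut R f v)
      have h1 := cut_bd1 hR hf u
      have h2 := cut_bd1 hR hf v
      nlinarith
    have b2 : |cut R f u - cut R f v| ≤ 24 * a ^ 2 * (δ * a) := by
      refine (cut_lip hR ww_ge zero_le_one hf u v).trans ?_
      have h3 : 1 + R⁻¹ ≤ 2 := by have := inv_le_one_of_one_le₀ hR; linarith
      have h4 : (0:ℝ) < R⁻¹ := pz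
      have := ww_ge u
      have := ww_ge v
      calc 1 * (‖u - v‖ * (ww u + ww v)) * (1 + R⁻¹) ≤ 1 * ((2 * δ * a) * (5 * a ^ 2 + a ^ 2)) * 2 := by gcongr
        _ = _ := by ring
    have b3 : |cut R f u - cut R f v| ≤ 24 * a ^ 2 * (δ * a) ^ θ := by
      have hx : 0 ≤ δ * a := pz
      rcases le_total (δ * a) 1 with h1 | h1
      · refine b2.trans ?_
        gcongr
        calc δ * a = (δ * a) ^ (1:ℝ) := by simp
          _ ≤ _ := Real.rpow_le_rpow_of_exponent_ge' hx h1 t0.le t1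
      · refine b1.trans ?_
        gcongr
        exact Real.one_le_rpow h1 t0.le
    refine b3.trans ?_
    calc 24 * a ^ 2 * (δ * a) ^ θ = 24 * δ ^ θ * a ^ (2 + θ) := by
          rw [mul_rpow h0 lz, rpow_add lz, rpow_two]; ring
      _ ≤ 24 * δ ^ θ * a ^ p := by gcongr
      _ ≤ _ := by gcongr
  · calc ‖u‖ ^ p ≤ (2 * a) ^ p := by gcongr
      _ = 2 ^ p * a ^ p := mul_rpow nz lz
      _ ≤ 2 ^ p * (2 ^ p * (1 + ‖v‖ ^ p)) := by gcongr
      _ = _ := by rw [← mul_assoc, ← mul_rpow nz nz]; norm_num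
theorem resc {Ω : Type*} (hN : 0 < N) (Vs : Fin N → Ω → Ed) (μdef : Ms) (ω : Ω) {μ0 : Ms} (hμ0 : μ0 ∈ boltzmannSphere d)
    {η M1 Mp θ δ : ℝ} (hR : 1 ≤ R) (t0 : 0 < θ) (t1 : θ ≤ 1) (tp : 2 + θ ≤ p)
    (iμ : Integrable (fun v => ‖v‖ ^ p) μ0) (hμ : Mo p μ0 ≤ Mp) (hx : Mo p (empMeasure Vs ω) ≤ M1)
    (hη : ∀ g, AR R 1 w3 g → |(∫ v, cut R g v ∂(empMeasure Vs ω)) - ∫ v, cut R g v ∂μ0| ≤ η)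
    (hδ : η + R ^ (2 - p) * (M1 + Mp) ≤ δ) (h8 : δ ≤ 1/8) :
    Mo p (rescaledEmpirical Vs μdef ω) ≤ 4 ^ p * (1 + M1) ∧ ∀ f, AR R 1 ww f →
      (∫ v, cut R f v ∂(rescaledEmpirical Vs μdef ω)) - ∫ v, cut R f v ∂μ0 ≤ η + 24 * δ ^ θ * (2 ^ p * (1 + M1)) := by
  have hN' : (0:ℝ) < N := by exact_mod_cast hN
  have hp : 2 ≤ p := lz
  have := hμ0.1
  have s2 := S2_of_mem hμ0
  set x := empMeasure Vs ω with hxd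
  have emp : ∀ (g : Fn), ∫ v, g v ∂x = (N:ℝ)⁻¹ * ∑ i, g (Vs i ω) := fun g => emp_int (fun i => Vs i ω) g
  have hi' : ∀ F : Ed → ℝ, Measurable F → Integrable F x := fun F hF => by
    rw [hxd]; unfold empMeasure
    refine (integrable_finset_sum_measure.2 fun i _ => integrable_dirac' hF.stronglyMeasurable (by simp)).smul_measure (by simp [hN.ne'])
  have : IsFiniteMeasure x := by
    have h := hi' (fun _ => 1) measurable_const
    rw [integrable_const_iff] at h
    exact h.resolve_left one_ne_zero
  have ww1 : ∀ v : Ed, 1 ≤ w3 v := one_le_w3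
  set mm := sampleMean Vs ω with hm
  have hQ : |sampleQ Vs ω - 1| ≤ δ := by
    have hA : AR R 1 w3 fun v : Ed => ‖v‖ ^ 2 := AR_w3 zero_le_one ⟨fun v _ => by rw [abs_of_nonneg pz]; unfold ww; linarith, fun v u _ _ => by
      have h := ww_sub v u
      simp only [ww, add_sub_add_left_eq_sub] at h
      refine h.trans ?_
      rw [one_mul]
      refine mul_le_mul_of_nonneg_left ?_ (norm_nonneg _)
      unfold ww
      nlinarith [sq_nonneg (‖v‖ - 1), sq_nonneg (‖u‖ - 1)]⟩
    have h := fluct hR hp (hi' _ mz) iμ hx hμ (g := fun v => ‖v‖ ^ 2) mz hA (fun v _ => by rw [abs_of_nonneg pz]) (hη _ hA)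
    rw [emp, s2.one] at h
    exact h.trans hδ
  have hmm : ‖mm‖ ≤ δ := by
    by_cases hz : mm = 0
    · rw [hz, norm_zero]; exact (abs_nonneg _).trans hQ
    set e := ‖mm‖⁻¹ • mm
    have he : ‖e‖ = 1 := norm_unit hz
    have hb : ∀ v : Ed, |⟪e, v⟫| ≤ ‖v‖ := fun v => by have := abs_real_inner_le_norm e v; rwa [he, one_mul] at this
    have hA : AR R 1 w3 fun v => ⟪e, v⟫ := ⟨fun v _ => (hb v).trans (by rw [one_mul]; unfold w3; nlinarith [ww_ge v, norm_nonneg v]), fun v u _ _ => by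
      rw [← inner_sub_right, one_mul]
      exact (hb _).trans (le_mul_of_one_le_right (norm_nonneg _) (by linarith [ww1 v, ww1 u]))⟩
    have h := fluct hR hp (hi' _ mz) iμ hx hμ (g := fun v => ⟪e, v⟫) mz hA (fun v hv => (hb v).trans (by nlinarith)) (hη _ hA)
    have iid : Integrable (fun v : Ed => v) μ0 := (integrable_norm_iff mz).1 s2.int1
    have e1 : ∫ v, ⟪e, v⟫ ∂μ0 = 0 := by rw [integral_inner iid, hμ0.2.1, inner_zero_right]
    have e2 : ∫ v, ⟪e, v⟫ ∂x = ‖mm‖ := by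
      rw [emp, ← inner_sum, ← real_inner_smul_right]
      change ⟪‖mm‖⁻¹ • mm, mm⟫ = _
      rw [real_inner_smul_left, real_inner_self_eq_norm_sq]
      have : ‖mm‖ ≠ 0 := by simpa using hz
      field_simp
    rw [e1, e2, sub_zero, abs_of_nonneg (norm_nonneg _)] at h
    exact h.trans hδ
  have δ0 : 0 ≤ δ := (norm_nonneg _).trans hmm
  have hS : |sampleS Vs ω - 1| ≤ 9/8 * δ := by
    unfold sampleS
    have h1 : ‖mm‖ ^ 2 ≤ 1/8 * δ := by nlinarith [norm_nonneg mm]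
    have h2 := abs_le.1 hQ
    have h3 := sq_nonneg ‖mm‖
    rw [abs_le]; constructor <;> linarith [h2.1, h2.2]
  obtain ⟨hS0, hs⟩ := s_est δ0 h8 hS
  have er : rescaledEmpirical Vs μdef ω = (N : ℝ≥0∞)⁻¹ • ∑ i, dirac ((√(sampleS Vs ω))⁻¹ • (Vs i ω - mm)) := if_pos hS0
  have emr : ∀ (g : Fn), ∫ v, g v ∂(rescaledEmpirical Vs μdef ω) = (N:ℝ)⁻¹ * ∑ i, g ((√(sampleS Vs ω))⁻¹ • (Vs i ω - mm)) := fun g => by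
    rw [er]; exact emp_int (fun i => (√(sampleS Vs ω))⁻¹ • (Vs i ω - mm)) g
  set s := (√(sampleS Vs ω))⁻¹
  have hd : ∀ i, ‖s • (Vs i ω - mm) - Vs i ω‖ ≤ 2 * δ * (1 + ‖Vs i ω‖) := fun i => by
    have e : s • (Vs i ω - mm) - Vs i ω = (s - 1) • Vs i ω - s • mm := by module
    have s0 : 0 ≤ s := pz
    have s2 : s ≤ 2 := by linarith [(abs_le.1 hs).2]
    rw [e]
    refine (norm_sub_le _ _).trans ?_
    rw [norm_smul, norm_smul, norm_eq_abs, norm_eq_abs, abs_of_nonneg s0]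
    calc |s - 1| * ‖Vs i ω‖ + s * ‖mm‖ ≤ 2 * δ * ‖Vs i ω‖ + 2 * δ := by gcongr
      _ = _ := by ring
  have av : (N:ℝ)⁻¹ * ∑ i, (1 + ‖Vs i ω‖ ^ p) ≤ 1 + M1 := by
    rw [emp] at hx
    rw [sum_add_distrib, mul_add]
    simp only [Finset.sum_const, Finset.card_univ, Fintype.card_fin, nsmul_eq_mul, mul_one]
    rw [inv_mul_cancel₀ hN'.ne']; linarith
  have hz : AR R 1 ww (fun _ : Ed => (0:ℝ)) := ⟨fun v _ => by simpa using (zero_le_one.trans (ww_ge v)), fun v u _ _ => by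
    simp only [sub_self, abs_zero, one_mul]; have := ww_ge v; have := ww_ge u; positivity⟩
  refine ⟨?_, fun f hf => ?_⟩
  · rw [emr]
    calc (N:ℝ)⁻¹ * ∑ i, ‖s • (Vs i ω - mm)‖ ^ p ≤ (N:ℝ)⁻¹ * ∑ i, 4 ^ p * (1 + ‖Vs i ω‖ ^ p) := by
          gcongr with i; exact (resc_pt hR δ0 h8 t0 t1 tp (hd i) hz).2
      _ = 4 ^ p * ((N:ℝ)⁻¹ * ∑ i, (1 + ‖Vs i ω‖ ^ p)) := by rw [← mul_sum]; ring
      _ ≤ _ := by gcongr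
  · have h1 := (abs_le.1 (hη f (AR_w3 zero_le_one hf))).2
    have h2 : (∫ v, cut R f v ∂(rescaledEmpirical Vs μdef ω)) - ∫ v, cut R f v ∂x ≤ 24 * δ ^ θ * (2 ^ p * (1 + M1)) := by
      rw [emr, emp, ← mul_sub, ← Finset.sum_sub_distrib]
      calc (N:ℝ)⁻¹ * ∑ i, (cut R f (s • (Vs i ω - mm)) - cut R f (Vs i ω)) ≤ (N:ℝ)⁻¹ * ∑ i, 24 * δ ^ θ * 2 ^ p * (1 + ‖Vs i ω‖ ^ p) := by
            gcongr with i; have := (le_abs_self _).trans (resc_pt hR δ0 h8 t0 t1 tp (hd i) hf).1; linarith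
        _ = 24 * δ ^ θ * 2 ^ p * ((N:ℝ)⁻¹ * ∑ i, (1 + ‖Vs i ω‖ ^ p)) := by rw [← mul_sum]; ring
        _ ≤ 24 * δ ^ θ * 2 ^ p * (1 + M1) := by gcongr
        _ = _ := by ring
    linarith
end
section
lemma w3_le (hp : 2 ≤ p) (v : Ed) : w3 v ≤ 4 * (1 + ‖v‖ ^ (p+1)) := by
  have h1 := pow_le_add (p := 1) (q := p+1) zero_le_one lz (norm_nonneg v)
  have h2 := pow_le_add (p := 2) (q := p+1) nz lz (norm_nonneg v)
  have h3 := pow_le_add (p := 3) (q := p+1) nz lz (norm_nonneg v)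
  rw [rpow_one] at h1
  rw [rpow_two] at h2
  rw [show (3:ℝ) = (3:ℕ) by norm_num, rpow_natCast] at h3
  have h4 : 0 ≤ ‖v‖ ^ (p+1) := pz
  unfold w3 ww
  nlinarith
lemma w3_int (hp : 2 ≤ p) {x : Ms} (hx : S2 x) (hi : Integrable (fun v => ‖v‖ ^ (p+1)) x) :
    Integrable w3 x ∧ ∫ v, w3 v ∂x ≤ 4 * (1 + Mo (p+1) x) := by
  have := hx.prob
  have i2 := imul 4 (iadd (integrable_const 1) hi)
  have i3 : Integrable w3 x := Integrable.mono' i2 cont_w3.aestronglyMeasurable (Eventually.of_forall fun v => by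
    rw [norm_eq_abs, abs_of_nonneg (zero_le_one.trans (one_le_w3 v))]; exact w3_le hp v)
  refine ⟨i3, (integral_mono i3 i2 fun v => w3_le hp v).trans ?_⟩
  rw [integral_const_mul, integral_add (integrable_const 1) hi]; simp
lemma tail3 {a : ℝ} (hp : 2 ≤ p) (hR : 1 ≤ R) (a0 : 0 ≤ a) {x : Ms} (hx : S2 x) (hi : Integrable (fun v => ‖v‖ ^ (p+1)) x) :
    Integrable (fun v => (1 - chi R v) * (w3 v + (1 + ‖v‖) * a)) x ∧
    ∫ v, (1 - chi R v) * (w3 v + (1 + ‖v‖) * a) ∂x ≤ 4 * R ^ (2 - p) * (Mo (p+1) x) + 2 * a * R⁻¹ := by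
  have pt : ∀ v : Ed, (1 - chi R v) * (w3 v + (1 + ‖v‖) * a) ≤ 4 * R ^ (2 - p) * ‖v‖ ^ (p+1) + 2 * a * R⁻¹ * ‖v‖ ^ 2 := fun v => by
    have c0 : 0 ≤ 1 - chi R v := by have := chi_le R v; linarith
    have h1 := tail_pt (q := 3) (p := p+1) lz hR v
    have h2 := tail_pt (q := 1) (p := 2) nz hR v
    rw [show (3:ℝ) - (p + 1) = 2 - p by ring, show (3:ℝ) = (3:ℕ) by norm_num, rpow_natCast] at h1
    rw [show (1:ℝ) - 2 = -1 by norm_num, Real.rpow_neg_one, rpow_one, rpow_two] at h2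
    by_cases hv : ‖v‖ ≤ R
    · rw [chi_one hR hv]; simp; positivity
    · have hn : 1 ≤ ‖v‖ := lz
      have h3 : w3 v ≤ 4 * ‖v‖ ^ 3 := by
        unfold w3 ww
        calc (1 + ‖v‖) * (1 + ‖v‖ ^ 2) ≤ (‖v‖ + ‖v‖) * (‖v‖ ^ 2 + ‖v‖ ^ 2) := by gcongr; exact one_le_pow₀ hn
          _ = _ := by ring
      have h4 : (1 + ‖v‖) * a ≤ 2 * ‖v‖ * a := by gcongr; linarith
      calc (1 - chi R v) * (w3 v + (1 + ‖v‖) * a) ≤ (1 - chi R v) * (4 * ‖v‖ ^ 3 + 2 * ‖v‖ * a) := by gcongr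
        _ = 4 * ((1 - chi R v) * ‖v‖ ^ 3) + 2 * a * ((1 - chi R v) * ‖v‖) := by ring
        _ ≤ 4 * (R ^ (2 - p) * ‖v‖ ^ (p+1)) + 2 * a * (R⁻¹ * ‖v‖ ^ 2) := by gcongr
        _ = _ := by ring
  have i2 := iadd (imul (4 * R ^ (2 - p)) hi) (imul (2 * a * R⁻¹) hx.int)
  have i3 : Integrable (fun v => (1 - chi R v) * (w3 v + (1 + ‖v‖) * a)) x := Integrable.mono' i2 (by unfold chi w3 ww; fun_prop) (Eventually.of_forall fun v => by
    have c0 : 0 ≤ 1 - chi R v := by have := chi_le R v; linarith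
    have := one_le_w3 v
    rw [norm_eq_abs, abs_of_nonneg pz]; exact pt v)
  refine ⟨i3, (integral_mono i3 i2 pt).trans ?_⟩
  rw [integral_add (imul (4 * R ^ (2 - p)) hi) (imul (2 * a * R⁻¹) hx.int), integral_const_mul, integral_const_mul, hx.one, mul_one]
lemma AR_of_AA (h : AA c f) : AR R c ww f := ⟨fun v _ => h.bd v, fun v u _ _ => h.lip v u⟩
lemma AR_ww (R : ℝ) : AR R 1 ww (fun v : Ed => (-1) * ww v) := by
  refine ⟨fun v _ => ?_, fun v u _ _ => ?_⟩
  · have := ww_ge v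
    rw [abs_mul, abs_of_nonneg (lz : 0 ≤ ww v)]; simp
  · rw [← mul_sub, abs_mul, one_mul]
    simp only [abs_neg, abs_one, one_mul]
    refine (ww_sub v u).trans (mul_le_mul_of_nonneg_left ?_ (norm_nonneg _))
    unfold ww
    nlinarith [sq_nonneg (‖v‖ - 1), sq_nonneg (‖u‖ - 1)]
lemma S2.iw {x : Ms} (hx : S2 x) : Integrable ww x ∧ ∫ v, ww v ∂x = 2 := by
  have := hx.prob
  refine ⟨iadd (integrable_const 1) hx.int, ?_⟩
  unfold ww
  rw [integral_add (integrable_const 1) hx.int, hx.one]; simp; norm_num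
lemma W_le {x μ : Ms} (h : ∀ f ∈ testF d, ∫ v, f v ∂x - ∫ v, f v ∂μ ≤ b) : Wdist x μ ≤ b := by
  have : Nonempty (testF d) := ⟨⟨fun _ => 0, by simp [testF]⟩⟩
  exact ciSup_le fun f => h f.1 f.2
lemma test_ww (hf : f ∈ testF d) (v : Ed) : |f v| ≤ ww v := by
  have h := hf.1 v
  have := ww_ge v
  unfold ww at *
  rwa [abs_div, abs_of_pos (lz : 0 < 1 + ‖v‖ ^ 2), div_le_one lz] at h
lemma W_four {x μ : Ms} (hx : S2 x) (hμ : S2 μ) : Wdist x μ ≤ 4 := by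
  refine W_le fun f hf => ?_
  have b : ∀ {ν : Ms}, S2 ν → |∫ v, f v ∂ν| ≤ 2 := fun {ν} hν => by
    rw [← hν.iw.2]; exact norm_integral_le_of_norm_le (f := f) hν.iw.1 (Eventually.of_forall (test_ww hf))
  have := abs_le.1 (b hx)
  have := abs_le.1 (b hμ)
  linarith
lemma W_cut {Y M : ℝ} (hR : 1 ≤ R) (hp : 2 ≤ p) {x μ : Ms} (hx : S2 x) (hμ : S2 μ) (hi : Integrable (fun v => ‖v‖ ^ p) μ)
    (hM : Mo p μ ≤ M) (hY : ∀ f, AR R 1 ww f → ∫ v, cut R f v ∂x - ∫ v, cut R f v ∂μ ≤ Y) : Wdist x μ ≤ 3 * Y + 4 * R ^ (2 - p) * M := by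
  refine W_le fun f hf => ?_
  have ha := AA_of_testF hf
  have fc : Continuous f := ha.cont
  have cc : ∀ v : Ed, 0 ≤ 1 - chi R v ∧ 1 - chi R v ≤ 1 := fun v => ⟨by have := chi_le R v; linarith, by have := chi_nonneg R v; linarith⟩
  have it : ∀ {ν : Ms}, S2 ν → ∀ {g : Fn}, Measurable g → (∀ v, |g v| ≤ ww v) →
      Integrable (fun v => (1 - chi R v) * g v) ν ∧ Integrable (fun v => chi R v * g v) ν ∧ ∫ v, g v ∂ν = ∫ v, cut R g v ∂ν + ∫ v, (1 - chi R v) * g v ∂ν := fun {ν} hν g hg hb => by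
    have i1 : Integrable (fun v => (1 - chi R v) * g v) ν := Integrable.mono' hν.iw.1 (by unfold chi; fun_prop) (Eventually.of_forall fun v => by
      rw [norm_eq_abs, abs_mul, abs_of_nonneg (cc v).1]
      exact (mul_le_of_le_one_left (abs_nonneg _) (cc v).2).trans (hb v))
    have i2 : Integrable (fun v => chi R v * g v) ν := Integrable.mono' hν.iw.1 (by unfold chi; fun_prop) (Eventually.of_forall fun v => by
      rw [norm_eq_abs, abs_mul, abs_of_nonneg (chi_nonneg R v)]
      exact (mul_le_of_le_one_left (abs_nonneg _) (chi_le R v)).trans (hb v))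
    refine ⟨i1, i2, ?_⟩
    unfold cut
    rw [← integral_add i2 i1]; congr 1; ext v; ring
  have wb : ∀ v : Ed, |ww v| ≤ ww v := fun v => by rw [abs_of_nonneg (zero_le_one.trans (ww_ge v))]
  have tf : ∀ {ν : Ms}, S2 ν → |∫ v, (1 - chi R v) * f v ∂ν| ≤ ∫ v, (1 - chi R v) * ww v ∂ν := fun {ν} hν =>
    norm_integral_le_of_norm_le (f := fun v => (1 - chi R v) * f v) (it hν meas_ww wb).1 (Eventually.of_forall fun v => by
      rw [norm_eq_abs, abs_mul, abs_of_nonneg (cc v).1]; exact mul_le_mul_of_nonneg_left (test_ww hf v) (cc v).1)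
  have e1 := (it hx fc.measurable (test_ww hf)).2.2
  have e2 := (it hμ fc.measurable (test_ww hf)).2.2
  have w1 := (it hx meas_ww wb).2.2
  have w2 := (it hμ meas_ww wb).2.2
  rw [hx.iw.2] at w1
  rw [hμ.iw.2] at w2
  have y1 := hY _ (AR_norm two_pos (AR_of_AA (R := R) ha))
  have y2 := hY _ (AR_ww R)
  rw [cut_smul, integral_const_mul, integral_const_mul] at y1 y2
  have t1 := abs_le.1 (tf hx)
  have t2 := abs_le.1 (tf hμ)
  have t3 : ∫ v, (1 - chi R v) * ww v ∂μ ≤ 2 * R ^ (2 - p) * M := by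
    have i2 := imul (2 * R ^ (2 - p)) hi
    refine (integral_mono (it hμ meas_ww wb).1 i2 fun v => ?_).trans ?_
    · have h2 := tail_pt (q := 2) (p := p) hp hR v
      rw [rpow_two] at h2
      by_cases hv : ‖v‖ ≤ R
      · simp only [chi_one hR hv, sub_self, zero_mul]; positivity
      · have h3 : ww v ≤ 2 * ‖v‖ ^ 2 := by
          unfold ww
          have : 1 ≤ ‖v‖ ^ 2 := one_le_pow₀ lz
          linarith
        have := mul_le_mul_of_nonneg_left h3 (cc v).1
        simp only
        linarith
    · rw [integral_const_mul]
      gcongr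
  linarith [t1.1, t1.2, t2.1, t2.2]
end
section
lemma fin_path (hK : GoodK B κ K) {x μ : ℝ → Ms} (hx : Path x) (hμ : Path μ)
    (hR : 1 ≤ R) {Ξ : ℝ} (hM : ∀ g, AR R 1 w3 g → ∀ r ∈ Icc 0 T, |Mt B x (cut R g) r| ≤ Ξ)
    (hsol : ∀ g, AR R 1 w3 g → ∀ r, 0 ≤ r → Mt B μ (cut R g) r = 0) (hp : 2 ≤ p)
    (ix : ∀ s, Integrable (fun v => ‖v‖ ^ (p+1)) (x s)) (Ix : IntegrableOn (fun s => Mo (p+1) (x s)) (Ioc 0 T))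
    (iμ : ∀ᵐ s ∂(volume.restrict (Ioc 0 T)), Integrable (fun v => ‖v‖ ^ (p+1)) (μ s)) (Iμ : IntegrableOn (fun s => Mo (p+1) (μ s)) (Ioc 0 T))
    {H : ℝ} (hH : 2 * T + (∫ s in Ioc 0 T, Mo (p+1) (x s)) + (∫ s in Ioc 0 T, Mo (p+1) (μ s)) ≤ H)
    (hT0 : 0 ≤ T) (hD : ∀ f, AR R 1 ww f → (∫ v, cut R f v ∂(x 0)) - ∫ v, cut R f v ∂(μ 0) ≤ D0) (hD0 : 0 ≤ D0)
    (hΞ : 0 ≤ Ξ) (ht : t ∈ Icc 0 T) (hf : AR R 1 ww f) :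
    (∫ v, cut R f v ∂(x t)) - ∫ v, cut R f v ∂(μ t) ≤ (exp (80 * κ * H) * (1 + 80 * κ * H + 32 * H) + 1) * (D0 + Ξ + (R ^ (2 - p) + R⁻¹)) := by
  set m : ℝ → ℝ := fun s => 2 + (Mo (p+1) (x s)) + Mo (p+1) (μ s) with hm
  set ρ := R ^ (2 - p) + R⁻¹
  have hR0 : 0 < R := lz
  have ρ0 : 0 ≤ ρ := pz
  have p0 : ∀ ν : Ms, 0 ≤ Mo (p+1) ν := fun ν => integral_nonneg fun v => by positivity
  have m0 : ∀ s, 0 ≤ m s := fun s => by have := p0 (x s); have := p0 (μ s); simp only [hm]; linarith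
  have ic : IntegrableOn (fun s => tw + Mo (p+1) (x s)) (Ioc 0 T) := iadd (integrable_const 2) Ix
  have im : IntegrableOn m (Ioc 0 T) := iadd ic Iμ
  have em : ∫ s in Ioc 0 T, m s ≤ H := by
    refine le_trans (le_of_eq ?_) hH
    simp only [hm]
    rw [integral_add ic Iμ, integral_add (integrable_const 2) Ix]
    simp [hT0]; ring
  have e0 : 0 ≤ ∫ s in Ioc 0 T, m s := integral_nonneg m0
  have h1 := stab hK hx hμ hR hM hsol (a := fun s => 4 * m s) (θ := fun s => 32 * ρ * m s) (fun s => by have := m0 s; positivity) (fun s => by have := m0 s; positivity)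
    (imul 4 im) (imul (32 * ρ) im) (by
      filter_upwards [iμ] with s hs
      have w1 := w3_int hp (hx.s2 s) (ix s)
      have w2 := w3_int hp (hμ.s2 s) hs
      have a0 : 0 ≤ 4 * m s := by have := m0 s; positivity
      refine ⟨Tau_of (hx.s2 s) (hμ.s2 s) w1.1 w2.1 (by simp only [hm]; linarith [w1.2, w2.2]), ?_⟩
      have t1 := tail3 hp hR a0 (hx.s2 s) (ix s)
      have t2 := tail3 hp hR a0 (hμ.s2 s) hs
      rw [integral_add_measure t1.1 t2.1]
      have q1 := p0 (x s)
      have q2 := p0 (μ s)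
      have r1 : 0 ≤ R ^ (2 - p) := pz
      have e : 32 * ρ * m s = 8 * R ^ (2 - p) * ((Mo (p+1) (x s)) + Mo (p+1) (μ s)) + 32 * R⁻¹ * m s
        + R ^ (2 - p) * (64 + 24 * ((Mo (p+1) (x s)) + Mo (p+1) (μ s))) := by simp only [hm, ρ]; ring
      have : 0 ≤ R ^ (2 - p) * (64 + 24 * ((Mo (p+1) (x s)) + Mo (p+1) (μ s))) := pz
      rw [e]
      linarith [t1.2, t2.2]) hT0 hD hΞ ht hf
  rw [integral_const_mul, integral_const_mul] at h1
  set I := ∫ s in Ioc 0 T, m s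
  have hκ := hK.one_le
  have H0 : 0 ≤ H := e0.trans em
  refine h1.trans ?_
  have k1 : 20 * κ * (4 * I) ≤ 80 * κ * H := by
    calc 20 * κ * (4 * I) = 80 * κ * I := by ring
      _ ≤ _ := by gcongr
  have k2 : 32 * ρ * I ≤ 32 * H * ρ := by
    calc 32 * ρ * I ≤ 32 * ρ * H := by gcongr
      _ = _ := by ring
  have k3 : 0 ≤ 80 * κ * H := pz
  calc exp (20 * κ * (4 * I)) * (D0 + 20 * κ * (4 * I) * Ξ + 32 * ρ * I) + Ξ
      ≤ exp (80 * κ * H) * (D0 + 80 * κ * H * Ξ + 32 * H * ρ) + Ξ := by gcongr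
    _ ≤ exp (80 * κ * H) * ((1 + 80 * κ * H + 32 * H) * (D0 + Ξ + ρ)) + (D0 + Ξ + ρ) := by
        gcongr
        · have : (1 + 80 * κ * H + 32 * H) * (D0 + Ξ + ρ) = (D0 + 80 * κ * H * Ξ + 32 * H * ρ) + (Ξ + ρ + 80 * κ * H * (D0 + ρ) + 32 * H * (D0 + Ξ)) := by ring
          have : 0 ≤ (Ξ + ρ + 80 * κ * H * (D0 + ρ) + 32 * H * (D0 + Ξ)) := pz
          linarith
        · linarith
    _ = _ := by ring
lemma markov' {Ω : Type*} [MeasurableSpace Ω] {P : Measure Ω} [IsProbabilityMeasure P] {f : Ω → ℝ} {a : ℝ} {A : Set Ω} (hA : MeasurableSet A) (hm : Measurable f)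
    (hfi : IntegrableOn f A P) (f0 : ∀ ω, 0 ≤ f ω) (ha : 0 < a) (hc : ∫ ω in A, f ω ∂P ≤ c) : P (A ∩ {ω | a ≤ f ω}) ≤ ofReal (a⁻¹ * c) := by
  have h := mul_meas_ge_le_integral_of_nonneg (μ := P.restrict A) (Eventually.of_forall f0) hfi a
  rw [Set.inter_comm, ← Measure.restrict_apply (measurableSet_le measurable_const hm), ← ENNReal.ofReal_toReal (measure_ne_top (P.restrict A) {ω | a ≤ f ω})]
  refine ofReal_le_ofReal ?_
  rw [← div_eq_inv_mul, le_div_iff₀ ha, mul_comm]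
  exact h.trans hc
lemma kac_A {Ω : Type*} [m : MeasurableSpace Ω] {P : Measure Ω} [IsProbabilityMeasure P] {𝓕 : Filtration ℝ m}
    {μp : ℝ → Ω → Ms} (hk : IsKacProcess B N P 𝓕 μp) {M : ℝ} (hp : 0 ≤ p) (hM : 0 ≤ M) : MeasurableSet[𝓕 0] {ω | Mo p (μp 0 ω) ≤ M} := by
  have e : {ω | Mo p (μp 0 ω) ≤ M} = {ω | ∫⁻ v, ofReal (‖v‖ ^ p) ∂(μp 0 ω) ≤ ofReal M} := by
    ext ω
    simp only [Set.mem_setOf_eq]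
    rw [← ofReal_integral_eq_lintegral_ofReal (emp_intg (hk.mem 0 ω) mz) (Eventually.of_forall fun v => by positivity), ENNReal.ofReal_le_ofReal_iff hM]
  rw [e]
  exact @measurableSet_le _ _ _ _ _ (𝓕 0) _ _ _ _ _ (Measurable.comp (Measure.measurable_lintegral mz) (path_meas hk 0)) measurable_const
end
section
lemma prob_good {Ω : Type*} [MeasurableSpace Ω] {P : Measure Ω} [IsProbabilityMeasure P] (h0 : 0 < ε) (h1 : ε ≤ 1) {G : Set Ω} (hG : MeasurableSet G)
    (h : P Gᶜ ≤ ofReal (ε / 2)) : ofReal (1 - ε) < P G := by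
  have e : P.real G = 1 - P.real Gᶜ := by rw [probReal_compl_eq_one_sub hG]; ring
  have h2 : P.real Gᶜ ≤ ε / 2 := ENNReal.toReal_le_of_le_ofReal lz h
  have h3 : P G = ofReal (P.real G) := (ENNReal.ofReal_toReal (measure_ne_top P G)).symm
  rw [h3, ENNReal.ofReal_lt_ofReal_iff_of_nonneg lz]
  linarith
lemma SS_pos (p : ℝ) (J : ℕ) : 0 < SS p J := by unfold SS; exact Finset.sum_pos (fun _ _ => by positivity) (by simp)
lemma UU_pos (d k : ℕ) : 0 < UU d k := by unfold UU; exact Finset.sum_pos (fun _ _ => by positivity) (by simp)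
def rt (d : ℕ) (p : ℝ) (N J k : ℕ) : ℝ := SS p J * (√(N:ℝ)⁻¹ * UU d k + 1 / 2 ^ k) + ((tw ^ J) ^ (2 - p) + (tw ^ J)⁻¹)
lemma sol_cut {μsol : ℝ → Ms} (hsol : IsBoltzmannSolution B μsol) (hR : 1 ≤ R) (hg : AR R 1 w3 g)
    (hr : 0 ≤ r) : Mt B (solP μsol) (cut R g) r = 0 := by
  refine sol_Mt hsol (BM_cut hR zero_le_one hg) (HasCompactSupport.intro (isCompact_closedBall 0 (2 * R)) fun v hv => cut_zero hR g ?_) hr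
  rw [Metric.mem_closedBall, dist_zero_right, not_le] at hv
  exact hv.le
set_option maxHeartbeats 4000000 in
theorem main_bd (hd : 2 ≤ d) (hK : GoodK B κ K)
    (hp : 2 < p) {μ0 : Ms} (hμ0 : μ0 ∈ boltzmannSphere d) (hμ0p : momentL p μ0 ≠ ⊤)
    {μsol : ℝ → Ms} (hsol0 : μsol 0 = μ0) (hsol : IsBoltzmannSolution B μsol) (hsolbdd : LocBddMomentFrom p 0 μsol)
    (hε0 : 0 < ε) (hε1 : ε ≤ 1) (hT : 0 ≤ T) :
    ∃ C : ℝ, 0 ≤ C ∧ ∀ (Ω : Type) (m : MeasurableSpace Ω) (P : Measure Ω), IsProbabilityMeasure P →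
      ∀ (N : ℕ) (Vs : Fin N → Ω → Ed), (∀ i, Measurable (Vs i)) → iIndepFun Vs P → (∀ i, P.map (Vs i) = μ0) →
      ∀ μdef : Ms, μdef ∈ empiricalSphere d N → ∀ (𝓕 : MeasureTheory.Filtration ℝ m) (μp : ℝ → Ω → Ms),
        IsKacProcess B N P 𝓕 μp → (∀ ω, μp 0 ω = rescaledEmpirical Vs μdef ω) → ∀ J k : ℕ,
        ofReal (1 - ε) < P {ω | ∀ t ∈ Icc (0:ℝ) T, Wdist (μp t ω) (μsol t) ≤ C * rt d p N J k ^ (min 1 (p - 2))} := by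
  have hp2 : 2 ≤ p := hp.le
  have hp0 : 0 ≤ p := lz
  have hdR : (0:ℝ) < d := by exact_mod_cast (by omega : 0 < d)
  have hμP := hμ0.1
  obtain ⟨c, C, c0, C0, hpo⟩ := povz hK hp
  have hpv : Pov K p c C := ⟨c0, C0, hpo⟩
  obtain ⟨D, D0, hD⟩ := pov_D hp c0 C0
  obtain ⟨iμ0, -⟩ := mom_int hp0 hμ0p le_rfl
  obtain ⟨iμ, Iμ⟩ := pov_sol hK hp hpv hsol hsolbdd hT
  obtain ⟨Mb, hMb, hMs⟩ := hsolbdd T hT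
  have hMs' := fun t ht => mom_int hp0 hMb (hMs t ht)
  set Mμ := Mb.toReal
  have Mμ0 : 0 ≤ Mμ := ENNReal.toReal_nonneg
  obtain ⟨Mp, hMp⟩ : ∃ x, x = Mo p μ0 := ⟨_, rfl⟩
  have Mp0 : 0 ≤ Mp := hMp ▸ integral_nonneg fun v => by positivity
  obtain ⟨M1, hM1⟩ : ∃ x, x = 8 * (1 + Mp) / ε := ⟨_, rfl⟩
  have M10 : 0 < M1 := by rw [hM1]; positivity
  obtain ⟨M, hM⟩ : ∃ x : ℝ, x = 4 ^ p * (1 + M1) := ⟨_, rfl⟩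
  have M0 : 0 ≤ M := by rw [hM]; positivity
  obtain ⟨L, hL⟩ : ∃ x : ℝ, x = 1 + T + 2 ^ (p+3) * ((D * T + M) / c) := ⟨_, rfl⟩
  have L1 : 1 ≤ L := by rw [hL]; have : 0 ≤ 2 ^ (p+3) * ((D * T + M) / c) := pz
                        linarith
  obtain ⟨Lb, hLb⟩ : ∃ x : ℝ, x = 8 * L / ε := ⟨_, rfl⟩
  have Lb0 : 0 < Lb := by rw [hLb]; positivity
  obtain ⟨H, hH⟩ : ∃ x : ℝ, x = 2 * T + Lb + ∫ s in Ioc 0 T, Mo (p+1) (solP μsol s) := ⟨_, rfl⟩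
  obtain ⟨G0, hG0⟩ : ∃ x : ℝ, x = 48 * d * √(3 ^ d * 2 ^ p * (1 + Mp)) := ⟨_, rfl⟩
  have G00 : 0 < G0 := by rw [hG0]; positivity
  obtain ⟨G1, hG1⟩ : ∃ x : ℝ, x = 48 * d * √(3 ^ d * 2 ^ p * (16 * L)) := ⟨_, rfl⟩
  have G10 : 0 < G1 := by rw [hG1]; positivity
  obtain ⟨E0, hE0⟩ : ∃ x : ℝ, x = 8 / ε * G0 + 16 * d * 2 ^ p * (2 * (1 + Mp)) := ⟨_, rfl⟩
  have E00 : 0 ≤ E0 := by rw [hE0]; positivity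
  obtain ⟨E1, hE1⟩ : ∃ x : ℝ, x = 8 / ε * G1 + 16 * d * 2 ^ p * (2 * (1 + M) + 8 * Lb) := ⟨_, rfl⟩
  have E10 : 0 ≤ E1 := by rw [hE1]; positivity
  obtain ⟨E2, hE2⟩ : ∃ x : ℝ, x = 1 + E0 + (M1 + Mp) := ⟨_, rfl⟩
  have E21 : 1 ≤ E2 := by rw [hE2]; linarith
  obtain ⟨E3, hE3⟩ : ∃ x : ℝ, x = 1 + 24 * (2 ^ p * (1 + M1)) + E1 + 1 := ⟨_, rfl⟩
  have E30 : 0 ≤ E3 := by rw [hE3]; positivity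
  obtain ⟨C3, hC3⟩ : ∃ x : ℝ, x = exp (80 * κ * H) * (1 + 80 * κ * H + 32 * H) + 1 := ⟨_, rfl⟩
  have H0 : 0 ≤ H := by
    have : 0 ≤ ∫ s in Ioc 0 T, Mo (p+1) (solP μsol s) := integral_nonneg fun s => integral_nonneg fun v => by positivity
    rw [hH]; linarith
  have C30 : 0 ≤ C3 := by rw [hC3]; have := hK.one_le; positivity
  set θ := min 1 (p - 2) with hθ
  have t0 : 0 < θ := lt_min one_pos lz
  have t1 : θ ≤ 1 := min_le_left _ _
  have tp : 2 + θ ≤ p := by have := min_le_right 1 (p - 2); linarith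
  refine ⟨(3 * (C3 * E3) + 4 * Mμ + 32) * E2 ^ θ, pz, ?_⟩
  intro Ω m P hP N Vs hV hI hl μdef hdef 𝓕 μp hk h0 J k
  have hN : 0 < N := emp_pos hdef
  have hN' : (0:ℝ) < N := by exact_mod_cast hN
  set X := SS p J * (√(N:ℝ)⁻¹ * UU d k) with hX
  have X0 : 0 < X := by have := SS_pos p J; have := UU_pos d k; positivity
  set Y := SS p J * (1 / 2 ^ k) with hY
  have Y0 : 0 < Y := by have := SS_pos p J; positivity
  set R : ℝ := 2 ^ J with hR
  have R1 : 1 ≤ R := one_le_pow₀ nz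
  have R0 : 0 < R := lz
  set ρ := R ^ (2 - p) + R⁻¹ with hρ
  have ρ1 : R ^ (2 - p) ≤ ρ := by have : 0 < R⁻¹ := pz
                                  linarith
  have ρ0 : 0 ≤ R ^ (2 - p) := pz
  have hrt : rt d p N J k = X + Y + ρ := by unfold rt; rw [hX, hY]; ring
  rw [hrt]
  obtain ⟨δ, hδ⟩ : ∃ x : ℝ, x = E2 * (X + Y + ρ) := ⟨_, rfl⟩
  have δ0 : 0 ≤ δ := by rw [hδ]; have := ρ0.trans ρ1; positivity
  have eδ : (3 * (C3 * E3) + 4 * Mμ + 32) * E2 ^ θ * (X + Y + ρ) ^ θ = (3 * (C3 * E3) + 4 * Mμ + 32) * δ ^ θ := by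
    rw [hδ, mul_rpow lz (by have := ρ0.trans ρ1; positivity), mul_assoc]
  rw [eδ]
  have s2x : ∀ t ω, S2 (μp t ω) := fun t ω => S2_of_mem (hk.mem t ω).1
  have es : ∀ t ∈ Icc 0 T, solP μsol t = μsol t := fun t ht => by unfold solP; rw [max_eq_left ht.1]
  have s2s : ∀ t ∈ Icc 0 T, S2 (μsol t) := fun t ht => S2_of_mem (hsol.1 t ht.1)
  rcases le_or_gt δ (1/8) with h8 | h8
  swap
  · have : {ω | ∀ t ∈ Icc (0:ℝ) T, Wdist (μp t ω) (μsol t) ≤ (3 * (C3 * E3) + 4 * Mμ + 32) * δ ^ θ} = Set.univ := by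
      refine Set.eq_univ_of_forall fun ω t ht => (W_four (s2x t ω) (s2s t ht)).trans ?_
      have h1 : (1/8:ℝ) ≤ δ ^ θ := by
        calc (1/8:ℝ) = (1/8:ℝ) ^ (1:ℝ) := by simp
          _ ≤ (1/8:ℝ) ^ θ := Real.rpow_le_rpow_of_exponent_ge' nz nz t0.le t1
          _ ≤ _ := by gcongr
      have h2 : 0 ≤ (3 * (C3 * E3) + 4 * Mμ) * δ ^ θ := pz
      linarith
    rw [this, measure_univ, ← ENNReal.ofReal_one]
    exact (ENNReal.ofReal_lt_ofReal_iff one_pos).2 lz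
  have δθ : δ ≤ δ ^ θ := by
    calc δ = δ ^ (1:ℝ) := by simp
      _ ≤ _ := Real.rpow_le_rpow_of_exponent_ge' δ0 lz t0.le t1
  obtain ⟨E, mE, pE, hE⟩ := iid_bad hV hI hl hN (by omega) hp0 iμ0 hMp.ge (lam := 8 / ε * (G0 * X)) pz M10 J k
  set A := {ω | Mo p (μp 0 ω) ≤ M} with hA
  have mA : MeasurableSet[𝓕 0] A := kac_A hk hp0 M0
  have mA' : MeasurableSet A := 𝓕.le 0 _ mA
  obtain ⟨bL, hbL⟩ := kac_L (d := d) hk p hp0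
  have eL : ∀ s ω, Lp p (μp s ω) = ∫ v, (1 + 2 ^ (p+3) * ‖v‖ ^ (p+1)) ∂(μp s ω) := fun s ω => kac_Lp hk p s ω
  have iL : Integrable (fun ω => ∫ s in Ioc 0 T, Lp p (μp s ω)) P := by
    simp only [eL]; exact kac_J hk mz hbL hT
  have mL : Measurable (fun ω => ∫ s in Ioc 0 T, Lp p (μp s ω)) := by
    simp only [eL]; exact meas_tI (kac_measf hk (f := fun v => 1 + 2 ^ (p+3) * ‖v‖ ^ (p+1)) mz) T
  have bb : ∀ v : Ed, ‖v‖ ≤ √N → |‖v‖ ^ (p+1)| ≤ √N ^ (p+1) := fun v hv => by rw [abs_of_nonneg pz]; gcongr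
  have ip : ∀ ω, IntegrableOn (fun s => Mo (p+1) (μp s ω)) (Ioc 0 T) := fun ω => kac_I hk mz bb T ω
  have eLs : ∀ ω, ∫ s in Ioc 0 T, Lp p (μp s ω) = T + 2 ^ (p+3) * ∫ s in Ioc 0 T, Mo (p+1) (μp s ω) := fun ω => by
    unfold Lp
    rw [integral_add (integrable_const 1) (imul (2 ^ (p+3)) (ip ω)), integral_const_mul]
    simp [hT]
  have jp : Integrable (fun ω => ∫ s in Ioc 0 T, Mo (p+1) (μp s ω)) P := kac_J hk mz bb hT
  have hLA : ∫ ω in A, (∫ s in Ioc 0 T, Lp p (μp s ω)) ∂P ≤ L := by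
    simp only [eLs]
    rw [integral_add (integrable_const T) (imul (2 ^ (p+3)) jp.integrableOn), integral_const_mul]
    have h1 := pov_kac hK hk hp hpv D0 hD M0 mA (fun ω hω => hω) hT
    have h2 : ∫ ω in A, (∫ s in Ioc 0 T, Mo (p+1) (μp s ω)) ∂P ≤ (D * T + M) / c := by
      rw [le_div_iff₀ c0]; linarith
    have h3 : ∫ ω in A, T ∂P ≤ T := by
      simp only [integral_const, smul_eq_mul, MeasurableSet.univ, measureReal_restrict_apply, Set.univ_inter]
      exact mul_le_of_le_one_left hT measureReal_le_one
    have h4 := mul_le_mul_of_nonneg_left h2 (pz : (0:ℝ) ≤ 2 ^ (p+3))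
    rw [hL]; linarith
  obtain ⟨S, mS, pS, hS⟩ := kac_bad hK hk (by omega) hp0 M0 mA (fun ω hω => hω) hT hLA (lam := 8 / ε * (G1 * X)) pz J k
  have L0 : ∀ ω, 0 ≤ ∫ s in Ioc 0 T, Lp p (μp s ω) := fun ω => integral_nonneg fun s => by
    have : 0 ≤ Mo (p+1) (μp s ω) := integral_nonneg fun v => by positivity
    unfold Lp; positivity
  have pL := markov' mA' mL iL.integrableOn L0 Lb0 hLA
  rw [← hG0, ← hX] at pE
  rw [← hG1, ← hX] at pS
  set U := {ω | Lb ≤ ∫ s in Ioc 0 T, Lp p (μp s ω)} with hU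
  have mU : MeasurableSet U := measurableSet_le measurable_const mL
  have q1 : (8 / ε * (G0 * X))⁻¹ * (G0 * X) = ε / 8 := by field_simp
  have q2 : (8 / ε * (G1 * X))⁻¹ * (G1 * X) = ε / 8 := by field_simp
  have q3 : Lb⁻¹ * L = ε / 8 := by rw [hLb]; field_simp
  have q4 : M1⁻¹ * Mp ≤ ε / 8 := by
    rw [hM1, inv_div, div_mul_eq_mul_div, div_le_iff₀ pz]; nlinarith
  rw [q1] at pE
  rw [q2] at pS
  rw [q3] at pL
  refine (prob_good hε0 hε1 ((mE.diff (mA'.inter mS)).diff (mA'.inter mU)) ?_).trans_le (measure_mono fun ω hω t ht => ?_)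
  · have : ((E \ (A ∩ S)) \ (A ∩ U))ᶜ ⊆ (Eᶜ ∪ (A ∩ S)) ∪ (A ∩ U) := fun ω h => by
      simp only [Set.mem_compl_iff, Set.mem_diff, Set.mem_union] at h ⊢; tauto
    refine (measure_mono this).trans ((measure_union_le _ _).trans ?_)
    have z : (0:ℝ) ≤ ε / 8 := pz
    calc P (Eᶜ ∪ (A ∩ S)) + P (A ∩ U) ≤ (ofReal (ε / 8) + ofReal (ε / 8) + ofReal (ε / 8)) + ofReal (ε / 8) := by
          refine add_le_add ((measure_union_le _ _).trans (add_le_add (pE.trans ?_) pS)) pL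
          gcongr
      _ = ofReal (ε / 2) := by
          rw [← ENNReal.ofReal_add z z, ← ENNReal.ofReal_add pz z, ← ENNReal.ofReal_add pz z]; congr 1; ring
  · obtain ⟨⟨hωE, hωS⟩, hωU⟩ := hω
    obtain ⟨m1, hη⟩ := hE ω hωE
    rw [← hY] at hη
    have ηb : 8 / ε * (G0 * X) + 16 * d * 2 ^ p * (2 * (1 + Mp)) * Y ≤ E0 * (X + Y) := by
      have z : E0 * (X + Y) = 8 / ε * (G0 * X) + 16 * d * 2 ^ p * (2 * (1 + Mp)) * Y + (8 / ε * G0 * Y + 16 * d * 2 ^ p * (2 * (1 + Mp)) * X) := by rw [hE0]; ring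
      have : 0 ≤ 8 / ε * G0 * Y + 16 * d * 2 ^ p * (2 * (1 + Mp)) * X := pz
      linarith
    set η := 8 / ε * (G0 * X) + 16 * d * 2 ^ p * (2 * (1 + Mp)) * Y
    have η0 : 0 ≤ η := pz
    have hδ' : η + R ^ (2 - p) * (M1 + Mp) ≤ δ := by
      have z1 : R ^ (2 - p) * (M1 + Mp) ≤ ρ * (M1 + Mp) := by gcongr
      have z2 : δ = E0 * (X + Y) + ρ * (M1 + Mp) + (X + Y + ρ + E0 * ρ + (M1 + Mp) * (X + Y)) := by rw [hδ, hE2]; ring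
      have : 0 ≤ X + Y + ρ + E0 * ρ + (M1 + Mp) * (X + Y) := by have := ρ0.trans ρ1; positivity
      linarith
    have XYδ : X + Y + ρ ≤ δ := by rw [hδ]; exact le_mul_of_one_le_left (by have := ρ0.trans ρ1; positivity) E21
    obtain ⟨r1, r2⟩ := resc hN Vs μdef ω hμ0 R1 t0 t1 tp iμ0 hMp.ge m1 hη hδ' h8
    rw [← h0 ω] at r1 r2
    rw [← hM] at r1
    have hωA : ω ∈ A := r1
    have hωU' : ∫ s in Ioc 0 T, Lp p (μp s ω) ≤ Lb := by
      by_contra hc; exact hωU ⟨hωA, (not_le.1 hc).le⟩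
    have hΞ := hS ω ⟨hωA, fun h => hωS ⟨hωA, h⟩⟩
    rw [← hY] at hΞ
    have Ξb : 8 / ε * (G1 * X) + 16 * d * 2 ^ p * (2 * (1 + M) + 8 * ∫ s in Ioc 0 T, Lp p (μp s ω)) * Y ≤ E1 * (X + Y) := by
      have z : E1 * (X + Y) = 8 / ε * (G1 * X) + 16 * d * 2 ^ p * (2 * (1 + M) + 8 * Lb) * Y + (8 / ε * G1 * Y + 16 * d * 2 ^ p * (2 * (1 + M) + 8 * Lb) * X) := by rw [hE1]; ring
      have : 0 ≤ 8 / ε * G1 * Y + 16 * d * 2 ^ p * (2 * (1 + M) + 8 * Lb) * X := pz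
      have : 16 * d * 2 ^ p * (2 * (1 + M) + 8 * ∫ s in Ioc 0 T, Lp p (μp s ω)) * Y ≤ 16 * d * 2 ^ p * (2 * (1 + M) + 8 * Lb) * Y := by gcongr
      linarith
    have hHH : 2 * T + (∫ s in Ioc 0 T, Mo (p+1) (μp s ω)) + (∫ s in Ioc 0 T, Mo (p+1) (solP μsol s)) ≤ H := by
      have z : (∫ s in Ioc 0 T, Mo (p+1) (μp s ω)) ≤ Lb := by
        refine le_trans ?_ hωU'
        rw [eLs]
        have z1 : 0 ≤ ∫ s in Ioc 0 T, Mo (p+1) (μp s ω) := integral_nonneg fun s => integral_nonneg fun v => by positivity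
        have z2 : (1:ℝ) ≤ 2 ^ (p+3) := Real.one_le_rpow nz lz
        have := le_mul_of_one_le_left z1 z2
        linarith
      rw [hH]; linarith
    have fp := fun f hf => fin_path hK (x := fun s => μp s ω) (kac_path hk ω) (sol_path hK hsol) R1 (fun g hg r hr => (hΞ g hg r hr).trans Ξb)
      (fun g hg r hr => sol_cut hsol R1 hg hr) hp2 (fun s => emp_intg (hk.mem s ω) mz) (ip ω) iμ Iμ hHH hT
      (fun f hf => by
        have := r2 f hf
        have e : solP μsol 0 = μ0 := by rw [← hsol0]; unfold solP; simp
        rw [e]; exact this) pz pz ht (f := f) hf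
    rw [← hC3] at fp
    simp only [es t ht] at fp
    have hm := hMs' t ht
    refine (W_cut R1 hp2 (s2x t ω) (s2s t ht) hm.1 hm.2 fp).trans ?_
    have f1 : η + 24 * δ ^ θ * (2 ^ p * (1 + M1)) + E1 * (X + Y) + ρ ≤ E3 * δ ^ θ := by
      have z1 : η ≤ δ ^ θ := by
        have : 0 ≤ R ^ (2 - p) * (M1 + Mp) := pz
        linarith
      have z2 : E1 * (X + Y) ≤ E1 * δ ^ θ := by gcongr; linarith [ρ0.trans ρ1]
      have z3 : ρ ≤ δ ^ θ := lz
      have z4 : E3 * δ ^ θ = δ ^ θ + 24 * δ ^ θ * (2 ^ p * (1 + M1)) + E1 * δ ^ θ + δ ^ θ := by rw [hE3]; ring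
      linarith
    have f2 := mul_le_mul_of_nonneg_left f1 C30
    have f3 : R ^ (2 - p) * Mμ ≤ δ ^ θ * Mμ := by gcongr; linarith
    have f4 : 0 ≤ δ ^ θ := pz
    linarith
end
section
lemma emp_ne1 {μ : Ms} (h : μ ∈ empiricalSphere d 1) : False := by
  obtain ⟨⟨-, h1, h2⟩, x, rfl⟩ := h
  simp only [Nat.cast_one, inv_one, one_smul, Finset.univ_unique, Finset.sum_singleton, integral_dirac] at h1 h2
  rw [h1] at h2; simp at h2
lemma inv2 {m J : ℕ} (hm : 0 < m) (hN : 0 < N) (h : N < (2 ^ m) ^ (J+1)) : (tw ^ J)⁻¹ ≤ 2 * (N:ℝ) ^ (-(1:ℝ) / m) := by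
  have hN' : (0:ℝ) < N := by exact_mod_cast hN
  have h1 : (N:ℝ) ≤ (tw ^ (J+1)) ^ m := by rw [← pow_mul, mul_comm, pow_mul]; exact_mod_cast h.le
  have h2 : (N:ℝ) ^ ((m:ℝ)⁻¹) ≤ 2 ^ (J+1) := by
    rw [← Real.pow_rpow_inv_natCast (pz : (0:ℝ) ≤ 2 ^ (J+1)) hm.ne']
    gcongr
  have e : (-(1:ℝ) / m) = - (m:ℝ)⁻¹ := by ring
  have h3 : (0:ℝ) < (N:ℝ) ^ ((m:ℝ)⁻¹) := pz
  rw [e, rpow_neg hN'.le, inv_le_iff_one_le_mul₀ pz]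
  rw [pow_succ] at h2
  rw [show 2 * ((N:ℝ) ^ (m:ℝ)⁻¹)⁻¹ * 2 ^ J = (2 ^ J * 2) / (N:ℝ) ^ (m:ℝ)⁻¹ by ring, one_le_div h3]
  exact h2
lemma a_k (hN : 0 < N) (h : (2 ^ d) ^ k ≤ N) : √(N:ℝ)⁻¹ * (√(2 ^ d) / 2) ^ k ≤ (tw ^ k)⁻¹ := by
  have hN' : (0:ℝ) < N := by exact_mod_cast hN
  have h1 : √(tw ^ d) ^ k ≤ √N := by
    apply le_sqrt_of_sq_le
    rw [← pow_mul, mul_comm, pow_mul, Real.sq_sqrt pz]; exact_mod_cast h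
  rw [Real.sqrt_inv, div_pow, ← div_eq_inv_mul, div_le_iff₀ pz, div_eq_inv_mul]
  gcongr
lemma UU2 (hd : 2 ≤ d) (k : ℕ) : UU d k ≤ (k + 1) * (√(2 ^ d) / 2) ^ k := by
  have h : 1 ≤ √(tw ^ d) / 2 := by
    rw [le_div_iff₀ two_pos]; apply le_sqrt_of_sq_le
    calc (1 * 2 : ℝ) ^ 2 = 2 ^ 2 := nz
      _ ≤ 2 ^ d := pow_le_pow_right₀ nz hd
  unfold UU
  refine (Finset.sum_le_card_nsmul _ _ ((√(2 ^ d) / 2) ^ k) fun i hi => pow_le_pow_right₀ h ?_).trans ?_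
  · simp at hi; omega
  · simp
lemma UU3 (hd : 3 ≤ d) (k : ℕ) : UU d k ≤ 4 * (√(2 ^ d) / 2) ^ k := by
  have h : 4 / 3 ≤ √(tw ^ d) / 2 := by
    rw [le_div_iff₀ two_pos]; apply le_sqrt_of_sq_le
    calc (4 / 3 * 2 : ℝ) ^ 2 ≤ 2 ^ 3 := nz
      _ ≤ 2 ^ d := pow_le_pow_right₀ nz hd
  unfold UU
  induction k with
  | zero => simp
  | succ k ih =>
    rw [Finset.sum_range_succ, pow_succ]
    have : 0 ≤ (√(tw ^ d) / 2) ^ k := pz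
    nlinarith
lemma SS1 (hp : 8 < p) : ∃ S, 0 ≤ S ∧ ∀ J, SS p J ≤ S := by
  have h : 16 * √(tw ^ (-p)) < 1 := by
    have : √(tw ^ (-p)) < 1 / 16 := by
      rw [Real.sqrt_lt' nz]
      calc tw ^ (-p) < 2 ^ (-8:ℝ) := Real.rpow_lt_rpow_of_exponent_lt nz lz
        _ = _ := by rw [rpow_neg nz]; norm_num
    linarith
  refine ⟨(1 - 16 * √(tw ^ (-p)))⁻¹, by rw [inv_nonneg]; linarith, fun J => ?_⟩
  rw [← tsum_geometric_of_lt_one pz h]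
  exact (summable_geometric_of_lt_one pz h).sum_le_tsum _ fun _ _ => by positivity
lemma SS2 (hp : 2 < p) (J : ℕ) : SS p J ≤ 64 * 8 ^ J := by
  have h : 16 * √(tw ^ (-p)) ≤ 8 := by
    have : √(tw ^ (-p)) ≤ 1 / 2 := by
      rw [Real.sqrt_le_left nz]
      calc tw ^ (-p) ≤ 2 ^ (-2:ℝ) := Real.rpow_le_rpow_of_exponent_le nz lz
        _ = _ := by rw [rpow_neg nz]; norm_num
    linarith
  have : ∀ n : ℕ, ∑ j ∈ range n, (16 * √(tw ^ (-p))) ^ j ≤ 8 ^ n := fun n => by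
    induction n with
    | zero => simp
    | succ k ih =>
      rw [Finset.sum_range_succ, pow_succ]
      have : (16 * √(tw ^ (-p))) ^ k ≤ 8 ^ k := by gcongr
      have : (0:ℝ) < 8 ^ k := pz
      linarith
  refine (this (J+2)).trans_eq (by ring)
lemma rt8 (hp : 8 < p) {u S : ℝ} (hS0 : 0 ≤ S) (hS : SS p k ≤ S) (hN : 0 < N) (h : (2 ^ d) ^ k ≤ N) (u0 : 0 ≤ u) (hu : UU d k ≤ u * (√(2 ^ d) / 2) ^ k) :
    rt d p N k k ≤ (S * (u + 1) + 2) * (tw ^ k)⁻¹ := by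
  have h1 : √(N:ℝ)⁻¹ * UU d k ≤ u * (tw ^ k)⁻¹ := by
    calc √(N:ℝ)⁻¹ * UU d k ≤ √(N:ℝ)⁻¹ * (u * (√(2 ^ d) / 2) ^ k) := by gcongr
      _ = u * (√(N:ℝ)⁻¹ * (√(2 ^ d) / 2) ^ k) := by ring
      _ ≤ _ := by gcongr; exact a_k hN h
  have h2 : (tw ^ k) ^ (2 - p) ≤ (tw ^ k)⁻¹ := by
    rw [← Real.rpow_neg_one]; exact Real.rpow_le_rpow_of_exponent_le (one_le_pow₀ nz) lz
  have h3 : SS p k * (√(N:ℝ)⁻¹ * UU d k + 1 / 2 ^ k) ≤ S * (u * (tw ^ k)⁻¹ + (tw ^ k)⁻¹) := by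
    rw [one_div]; have := UU_pos d k; gcongr
  unfold rt; linarith
lemma rt2 (hd : 2 ≤ d) (hp : 2 < p) {J : ℕ} (hN : 0 < N) (h : (2 ^ (8 * d)) ^ J ≤ N) :
    rt d p N J (8 * J) ≤ 642 * ((tw ^ J)⁻¹) ^ (min 1 (p - 2)) := by
  have hR : (1:ℝ) ≤ 2 ^ J := one_le_pow₀ nz
  have h' : (2 ^ d) ^ (8 * J) ≤ N := by rw [← pow_mul] at h ⊢; rwa [show d * (8 * J) = 8 * d * J by ring]
  have h1 : √(N:ℝ)⁻¹ * UU d (8 * J) ≤ ((8 * J : ℕ) + 1) * (tw ^ (8 * J))⁻¹ := by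
    calc √(N:ℝ)⁻¹ * UU d (8 * J) ≤ √(N:ℝ)⁻¹ * (((8 * J : ℕ) + 1) * (√(2 ^ d) / 2) ^ (8 * J)) := by gcongr; exact UU2 hd _
      _ = ((8 * J : ℕ) + 1) * (√(N:ℝ)⁻¹ * (√(2 ^ d) / 2) ^ (8 * J)) := by ring
      _ ≤ _ := by gcongr; exact a_k hN h'
  have hJ : (J:ℝ) ≤ 2 ^ J := by exact_mod_cast J.lt_two_pow_self.le
  have h2 : √(N:ℝ)⁻¹ * UU d (8 * J) + 1 / 2 ^ (8 * J) ≤ 10 * 2 ^ J * (tw ^ (8 * J))⁻¹ := by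
    have : ((8 * J : ℕ) + 2) * (tw ^ (8 * J))⁻¹ ≤ 10 * 2 ^ J * (tw ^ (8 * J))⁻¹ := by
      gcongr; push_cast; linarith
    rw [one_div]; linarith
  have h3 : SS p J * (√(N:ℝ)⁻¹ * UU d (8 * J) + 1 / 2 ^ (8 * J)) ≤ 640 * (tw ^ J)⁻¹ := by
    calc _ ≤ 64 * 8 ^ J * (10 * 2 ^ J * (tw ^ (8 * J))⁻¹) := by
          have := UU_pos d (8 * J); gcongr; exact SS2 hp J
      _ = 640 * (tw ^ J)⁻¹ ^ 4 := by
          rw [show (8:ℝ) = 2 ^ 3 by norm_num, ← pow_mul]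
          have : tw ^ J ≠ 0 := pz
          rw [mul_comm 3 J, mul_comm 8 J, pow_mul, pow_mul]
          field_simp
          norm_num
      _ ≤ _ := by
          gcongr; exact pow_le_of_le_one pz (inv_le_one_of_one_le₀ hR) nz
  have h4 : (tw ^ J)⁻¹ ≤ ((tw ^ J)⁻¹) ^ (min 1 (p - 2)) := by
    conv_lhs => rw [← rpow_one (tw ^ J)⁻¹]
    exact rpow_le_rpow_of_exponent_ge pz (inv_le_one_of_one_le₀ hR) (min_le_left _ _)
  have h5 : (tw ^ J) ^ (2 - p) ≤ ((tw ^ J)⁻¹) ^ (min 1 (p - 2)) := by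
    rw [show 2 - p = -(p-2) by ring, rpow_neg pz, ← Real.inv_rpow pz]
    exact rpow_le_rpow_of_exponent_ge pz (inv_le_one_of_one_le₀ hR) (min_le_right _ _)
  unfold rt; linarith
lemma rt_nn (d : ℕ) (p : ℝ) (N J k : ℕ) : 0 ≤ rt d p N J k := by
  have := SS_pos p J; have := UU_pos d k; unfold rt; positivity
lemma fin1 (hd : 2 ≤ d) (hp : 2 < p) (hN : 0 < N) : ∃ J k, rt d p N J k ^ (min 1 (p - 2)) ≤
    (642 * 2 ^ (min 1 (p - 2))) ^ (min 1 (p - 2)) * (N:ℝ) ^ (-((min 1 (p - 2)) ^ 2 / (8 * d))) := by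
  set θ := min 1 (p - 2)
  have t0 : 0 ≤ θ := le_min zero_le_one lz
  have hb : 1 < 2 ^ (8 * d) := Nat.one_lt_two_pow (by omega)
  refine ⟨Nat.log (2 ^ (8 * d)) N, 8 * Nat.log (2 ^ (8 * d)) N, ?_⟩
  have h1 := rt2 hd hp hN (Nat.pow_log_le_self _ hN.ne')
  have h2 := inv2 (by omega) hN (Nat.lt_pow_succ_log_self hb N)
  have hN' : (0:ℝ) < N := by exact_mod_cast hN
  have h3 : rt d p N (Nat.log (2 ^ (8 * d)) N) (8 * Nat.log (2 ^ (8 * d)) N) ≤ 642 * (2 * (N:ℝ) ^ (-(1:ℝ) / (8 * d : ℕ))) ^ θ := by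
    refine h1.trans ?_; gcongr
  refine (rpow_le_rpow (rt_nn _ _ _ _ _) h3 t0).trans_eq ?_
  rw [mul_rpow two_pos.le pz, ← mul_assoc, mul_rpow pz pz, ← rpow_mul hN'.le, ← rpow_mul hN'.le]
  congr 2; push_cast; ring
lemma fin3 (hd : 3 ≤ d) (hp : 8 < p) : ∃ C, 0 ≤ C ∧ ∀ N : ℕ, 0 < N → ∃ J k, rt d p N J k ^ (min 1 (p - 2)) ≤ C * (N:ℝ) ^ (-(1:ℝ) / d) := by
  obtain ⟨S, S0, hS⟩ := SS1 hp
  refine ⟨(S * (4 + 1) + 2) * 2, pz, fun N hN => ?_⟩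
  have hb : 1 < 2 ^ d := Nat.one_lt_two_pow (by omega)
  refine ⟨Nat.log (2 ^ d) N, Nat.log (2 ^ d) N, ?_⟩
  rw [min_eq_left lz, rpow_one, mul_assoc]
  refine (rt8 hp S0 (hS _) hN (Nat.pow_log_le_self _ hN.ne') nz (UU3 hd _)).trans ?_
  have h2 := inv2 (by omega) hN (Nat.lt_pow_succ_log_self hb N)
  gcongr
lemma fin2 (hp : 8 < p) : ∃ C, 0 ≤ C ∧ ∀ N : ℕ, 2 ≤ N → ∃ J k, rt 2 p N J k ^ (min 1 (p - 2)) ≤ C * ((N:ℝ) ^ (-(1:ℝ) / 2) * log N) := by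
  obtain ⟨S, S0, hS⟩ := SS1 hp
  refine ⟨(S * 4 + 4) * 2, pz, fun N hN2 => ?_⟩
  have hN : 0 < N := by omega
  refine ⟨Nat.log (2 ^ 2) N, Nat.log (2 ^ 2) N, ?_⟩
  rw [min_eq_left lz, rpow_one]
  refine (rt8 hp S0 (hS _) hN (Nat.pow_log_le_self _ hN.ne') pz (UU2 le_rfl _)).trans ?_
  have h2 := inv2 (by omega) hN (Nat.lt_pow_succ_log_self (nz : 1 < 2 ^ 2) N)
  have h3 := Nat.pow_log_le_self (2 ^ 2) hN.ne'
  set k := Nat.log (2 ^ 2) N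
  have h4 : (k:ℝ) * log 4 ≤ log N := by
    rw [← Real.log_pow]; apply Real.log_le_log pz; norm_num at h3; exact_mod_cast h3
  have l4 : log 4 = 2 * log 2 := by rw [← Real.log_rpow nz]; norm_num
  have l2 := Real.log_two_gt_d9
  have lN : log 2 ≤ log N := Real.log_le_log nz (by exact_mod_cast hN2)
  have k0 : (0:ℝ) ≤ k := pz
  have hk : (k:ℝ) + 1 + 1 ≤ 4 * log N := by nlinarith
  have e : (S * 4 + 4) * 2 * ((N:ℝ) ^ (-(1:ℝ) / 2) * log N) = (S * (4 * log N) + 4 * log N) * (2 * (N:ℝ) ^ (-(1:ℝ) / 2)) := by ring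
  rw [e]
  push_cast at h2
  have : 0 ≤ log N := lz
  gcongr
  linarith
end
end KacPf

/-- Corollary 10.2 (stochastic approximation of Boltzmann solutions by Kac processes
started from rescaled sample empirical distributions). -/
theorem kac_sampled_converges_to_boltzmann
    (d : ℕ) (hd : 2 ≤ d) (B : Vd d → Measure (Vd d)) (κ : ℝ)
    (hB : IsCollisionKernel B) (hBL : IsLipschitzKernel B κ)
    (p : ℝ) (hp : 2 < p)
    (μ0 : Measure (Vd d)) (hμ0 : μ0 ∈ boltzmannSphere d)
    (hμ0p : momentL p μ0 ≠ ⊤)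
    (μsol : ℝ → Measure (Vd d)) (hsol0 : μsol 0 = μ0)
    (hsol : IsBoltzmannSolution B μsol) (hsolbdd : LocBddMomentFrom p 0 μsol)
    (ε : ℝ) (hε0 : 0 < ε) (hε1 : ε ≤ 1)
    (lam : ℝ) (hlam : momentL p μ0 ≤ ENNReal.ofReal lam)
    (T : ℝ) (hT : 0 ≤ T) :
    (∃ α : ℝ, 0 < α ∧ ∃ C : ℝ, 0 ≤ C ∧
      ∀ (Ω : Type) (m : MeasurableSpace Ω) (P : Measure Ω),
        IsProbabilityMeasure P →
      ∀ (N : ℕ) (Vs : Fin N → Ω → Vd d),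
        (∀ i, Measurable (Vs i)) →
        iIndepFun Vs P →
        (∀ i, P.map (Vs i) = μ0) →
      ∀ μdef : Measure (Vd d), μdef ∈ empiricalSphere d N →
      ∀ (𝓕 : MeasureTheory.Filtration ℝ m) (μp : ℝ → Ω → Measure (Vd d)),
        IsKacProcess B N P 𝓕 μp →
        (∀ ω, μp 0 ω = rescaledEmpirical Vs μdef ω) →
        ENNReal.ofReal (1 - ε) <
          P {ω | ∀ t ∈ Set.Icc (0:ℝ) T,
            Wdist (μp t ω) (μsol t) ≤ C * (N : ℝ) ^ (-α)}) ∧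
    (8 < p → 3 ≤ d → ∃ C : ℝ, 0 ≤ C ∧
      ∀ (Ω : Type) (m : MeasurableSpace Ω) (P : Measure Ω),
        IsProbabilityMeasure P →
      ∀ (N : ℕ) (Vs : Fin N → Ω → Vd d),
        (∀ i, Measurable (Vs i)) →
        iIndepFun Vs P →
        (∀ i, P.map (Vs i) = μ0) →
      ∀ μdef : Measure (Vd d), μdef ∈ empiricalSphere d N →
      ∀ (𝓕 : MeasureTheory.Filtration ℝ m) (μp : ℝ → Ω → Measure (Vd d)),
        IsKacProcess B N P 𝓕 μp →
        (∀ ω, μp 0 ω = rescaledEmpirical Vs μdef ω) →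
        ENNReal.ofReal (1 - ε) <
          P {ω | ∀ t ∈ Set.Icc (0:ℝ) T,
            Wdist (μp t ω) (μsol t) ≤ C * (N : ℝ) ^ (-(1:ℝ)/d)}) ∧
    (8 < p → d = 2 → ∃ C : ℝ, 0 ≤ C ∧
      ∀ (Ω : Type) (m : MeasurableSpace Ω) (P : Measure Ω),
        IsProbabilityMeasure P →
      ∀ (N : ℕ) (Vs : Fin N → Ω → Vd d),
        (∀ i, Measurable (Vs i)) →
        iIndepFun Vs P →
        (∀ i, P.map (Vs i) = μ0) →
      ∀ μdef : Measure (Vd d), μdef ∈ empiricalSphere d N →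
      ∀ (𝓕 : MeasureTheory.Filtration ℝ m) (μp : ℝ → Ω → Measure (Vd d)),
        IsKacProcess B N P 𝓕 μp →
        (∀ ω, μp 0 ω = rescaledEmpirical Vs μdef ω) →
        ENNReal.ofReal (1 - ε) <
          P {ω | ∀ t ∈ Set.Icc (0:ℝ) T,
            Wdist (μp t ω) (μsol t) ≤
              C * ((N : ℝ) ^ (-(1:ℝ)/2) * Real.log N)}) := by
  obtain ⟨K, hK⟩ := KacPf.exists_goodK hd B κ hB hBL
  obtain ⟨C, C0, h⟩ := KacPf.main_bd hd hK hp hμ0 hμ0p hsol0 hsol hsolbdd hε0 hε1 hT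
  have t0 : 0 < min 1 (p - 2) := lt_min one_pos (by linarith)
  have key : ∀ {x y z : ℝ}, x ≤ C * y → y ≤ z → x ≤ C * z := fun h1 h2 => h1.trans (mul_le_mul_of_nonneg_left h2 C0)
  refine ⟨⟨(min 1 (p - 2)) ^ 2 / (8 * d), by have : (0:ℝ) < d := (by exact_mod_cast (by omega : 0 < d)); positivity,
    C * (642 * 2 ^ (min 1 (p - 2))) ^ (min 1 (p - 2)), by positivity, ?_⟩, fun h8 h3 => ?_, fun h8 h2 => ?_⟩
  · intro Ω m P hP N Vs hV hI hl μdef hdef 𝓕 μp hk h0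
    obtain ⟨J, k, hr⟩ := KacPf.fin1 hd hp (KacPf.emp_pos hdef)
    refine (h Ω m P hP N Vs hV hI hl μdef hdef 𝓕 μp hk h0 J k).trans_le (measure_mono fun ω hω t ht => ?_)
    rw [mul_assoc]; exact key (hω t ht) hr
  · obtain ⟨S, S0, hS⟩ := KacPf.fin3 h3 h8
    refine ⟨C * S, by positivity, ?_⟩
    intro Ω m P hP N Vs hV hI hl μdef hdef 𝓕 μp hk h0
    obtain ⟨J, k, hr⟩ := hS N (KacPf.emp_pos hdef)
    refine (h Ω m P hP N Vs hV hI hl μdef hdef 𝓕 μp hk h0 J k).trans_le (measure_mono fun ω hω t ht => ?_)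
    rw [mul_assoc]; exact key (hω t ht) hr
  · subst h2
    obtain ⟨S, S0, hS⟩ := KacPf.fin2 h8
    refine ⟨C * S, by positivity, ?_⟩
    intro Ω m P hP N Vs hV hI hl μdef hdef 𝓕 μp hk h0
    have hN : 2 ≤ N := by
      rcases Nat.lt_or_ge N 2 with h' | h'
      · have h1 : N = 1 := by have := KacPf.emp_pos hdef; omega
        subst h1; exact (KacPf.emp_ne1 hdef).elim
      · exact h'
    obtain ⟨J, k, hr⟩ := hS N hN
    refine (h Ω m P hP N Vs hV hI hl μdef hdef 𝓕 μp hk h0 J k).trans_le (measure_mono fun ω hω t ht => ?_)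
    rw [mul_assoc]; exact key (hω t ht) hr
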